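/- arXiv:1507.07368 — 14 statements merged into one kernel-verified Lean document; each statement's English description precedes it below -/
import Mathlib

section
/- For every ε > 0 there exists an integer D₀ such that for all integers r, s, n with 1 ≤ r ≤ s, d := r + s ≥ D₀ and d ≤ n, there exists an (n,(r,s))-cover-free family F with |F| ≤ (d·C(d,r) / log₂ C(d,r))^{1+ε} · log₂ n, where C(d,r) denotes the binomial coefficient 'd choose r'. -/
/-- An `(n,(r,s))`-cover-free family: for every choice of `r+s` indices and every
subset `J` of them of size `r`, some `a ∈ F` is `1` on `J` and `0` on the rest. -/
def IsCFF (n r s : ℕ) (F : Finset (Fin n → Bool)) : Prop :=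
  ∀ S : Finset (Fin n), S.card = r + s →
    ∀ J ⊆ S, J.card = r →
      ∃ a ∈ F, (∀ i ∈ J, a i = true) ∧ ∀ i ∈ S \ J, a i = false

/-- A greedy choice covers a `q`-fraction of the remaining elements in each step, when every element
is covered with probability at least `q` under the weights `w`. -/
theorem exists_card_filter_not_covered_le {α β : Type*} [Fintype α] [Nonempty α] [DecidableEq α]
    (cov : α → β → Prop) [∀ a b, Decidable (cov a b)] (w : α → ℝ) (hw : ∀ a, 0 < w a)
    (hsum : ∑ a, w a = 1) (U : Finset β) (q : ℝ) (hq : q ≤ 1)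
    (hcov : ∀ u ∈ U, q ≤ ∑ a, if cov a u then w a else 0) (m : ℕ) :
    ∃ F : Finset α, F.card ≤ m ∧
      ((U.filter fun u => ∀ a ∈ F, ¬ cov a u).card : ℝ) ≤ (1 - q) ^ m * U.card := by
  induction m with
  | zero => exact ⟨∅, by simp⟩
  | succ m ih =>
    obtain ⟨F, hF, hU⟩ := ih
    set V := U.filter fun u => ∀ a ∈ F, ¬ cov a u with hV
    have key : ∑ a, w a * (q * V.card) ≤ ∑ a, w a * ((V.filter fun u => cov a u).card : ℝ) := by
      rw [← Finset.sum_mul, hsum, one_mul]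
      calc q * V.card = ∑ u ∈ V, q := by simp [mul_comm]
        _ ≤ ∑ u ∈ V, ∑ a, if cov a u then w a else 0 :=
          Finset.sum_le_sum fun u hu => hcov u (Finset.mem_filter.1 hu).1
        _ = ∑ a, w a * ((V.filter fun u => cov a u).card : ℝ) := by
          rw [Finset.sum_comm]
          refine Finset.sum_congr rfl fun a _ => ?_
          rw [← Finset.sum_filter, Finset.sum_const, nsmul_eq_mul, mul_comm]
    obtain ⟨a, -, ha⟩ := Finset.exists_le_of_sum_le Finset.univ_nonempty key
    have ha' := le_of_mul_le_mul_left ha (hw a)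
    refine ⟨insert a F, (Finset.card_insert_le _ _).trans (by omega), ?_⟩
    have hEq : (U.filter fun u => ∀ b ∈ insert a F, ¬ cov b u) = V.filter fun u => ¬ cov a u := by
      ext u
      simp only [hV, Finset.mem_filter, Finset.forall_mem_insert]
      tauto
    have hcard : ((V.filter fun u => cov a u).card : ℝ) + (V.filter fun u => ¬ cov a u).card
        = V.card := by
      exact_mod_cast Finset.card_filter_add_card_filter_not (s := V) (fun u => cov a u)
    rw [hEq, pow_succ]
    nlinarith [mul_le_mul_of_nonneg_left hU (sub_nonneg.2 hq)]

/-- The number of elements of a greedy cover. -/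
theorem exists_cover_card_le {α β : Type*} [Fintype α] [Nonempty α] [DecidableEq α]
    (cov : α → β → Prop) [∀ a b, Decidable (cov a b)] (w : α → ℝ) (hw : ∀ a, 0 < w a)
    (hsum : ∑ a, w a = 1) (U : Finset β) (q : ℝ) (hq₀ : 0 < q) (hq : q ≤ 1)
    (hcov : ∀ u ∈ U, q ≤ ∑ a, if cov a u then w a else 0) (L : ℝ) (hL : 0 ≤ L)
    (hU : (U.card : ℝ) ≤ Real.exp L) :
    ∃ F : Finset α, (F.card : ℝ) ≤ L / q + 1 ∧ ∀ u ∈ U, ∃ a ∈ F, cov a u := by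
  obtain ⟨F, hF, hF'⟩ := exists_card_filter_not_covered_le cov w hw hsum U q hq hcov
    (⌊L / q⌋₊ + 1)
  refine ⟨F, ?_, ?_⟩
  · calc (F.card : ℝ) ≤ ((⌊L / q⌋₊ + 1 : ℕ) : ℝ) := by exact_mod_cast hF
      _ ≤ L / q + 1 := by
        push_cast
        gcongr
        exact Nat.floor_le (by positivity)
  · set m := ⌊L / q⌋₊ + 1 with hm
    have hlt : L < q * m := by
      rw [mul_comm, ← div_lt_iff₀ hq₀, hm]
      exact_mod_cast Nat.lt_floor_add_one (L / q)
    have h1 : (1 - q) ^ m ≤ Real.exp (-(q * m)) := by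
      calc (1 - q) ^ m ≤ Real.exp (-q) ^ m :=
            pow_le_pow_left₀ (by linarith) (Real.one_sub_le_exp_neg q) m
        _ = Real.exp (-(q * m)) := by rw [← Real.exp_nat_mul]; ring_nf
    have h2 : (1 - q) ^ m * U.card < 1 := by
      calc (1 - q) ^ m * U.card ≤ Real.exp (-(q * m)) * Real.exp L := by gcongr
        _ = Real.exp (L - q * m) := by rw [← Real.exp_add]; ring_nf
        _ < 1 := by simpa using Real.exp_lt_exp.2 (by linarith : L - q * m < 0)
    have h3 : (U.filter fun u => ∀ a ∈ F, ¬ cov a u).card = 0 := by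
      have := hF'.trans_lt h2
      exact Nat.lt_one_iff.1 (by exact_mod_cast this)
    intro u hu
    by_contra! hno
    have := (Finset.card_eq_zero.1 h3) ▸ Finset.mem_filter.2 ⟨hu, hno⟩
    simp at this

/-- The probability that independent Bernoulli bits are `1` on `J` and `0` on `K`. -/
theorem sum_prod_bernoulli_eq {ι : Type*} [Fintype ι] [DecidableEq ι] (p : ℝ) (J K : Finset ι)
    (hJK : Disjoint J K) :
    (∑ a : ι → Bool, if (∀ i ∈ J, a i = true) ∧ ∀ i ∈ K, a i = false then
      ∏ i, (if a i then p else 1 - p) else 0) = p ^ J.card * (1 - p) ^ K.card := by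
  have h1 : ∀ a : ι → Bool, (if (∀ i ∈ J, a i = true) ∧ ∀ i ∈ K, a i = false then
      ∏ i, (if a i then p else 1 - p) else 0) =
      ∏ i, (if (i ∈ J → a i = true) ∧ (i ∈ K → a i = false) then
        (if a i then p else 1 - p) else 0) := by
    intro a
    split_ifs with h
    · exact Finset.prod_congr rfl fun i _ => (if_pos ⟨h.1 i, h.2 i⟩).symm
    · have : ∃ i, ¬ ((i ∈ J → a i = true) ∧ (i ∈ K → a i = false)) := by
        by_contra hc
        rw [not_exists_not] at hc
        exact h ⟨fun i hi => (hc i).1 hi, fun i hi => (hc i).2 hi⟩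
      obtain ⟨i, hi⟩ := this
      exact (Finset.prod_eq_zero (Finset.mem_univ i) (if_neg hi)).symm
  have h2 : ∀ i, (∑ b : Bool, if (i ∈ J → b = true) ∧ (i ∈ K → b = false) then
      (if b then p else 1 - p) else 0) =
      (if i ∈ J then p else 1) * (if i ∈ K then 1 - p else 1) := by
    intro i
    have : i ∈ J → i ∉ K := fun h => Finset.disjoint_left.1 hJK h
    by_cases hJ : i ∈ J <;> by_cases hK : i ∈ K <;> simp_all
  rw [Finset.sum_congr rfl fun a _ => h1 a]
  refine (Fintype.prod_sum fun i b => if (i ∈ J → b = true) ∧ (i ∈ K → b = false) then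
    (if b then p else 1 - p) else 0).symm.trans ?_
  rw [Finset.prod_congr rfl fun i _ => h2 i, Finset.prod_mul_distrib]
  simp

theorem monotone_factorial_mul_exp_div_pow :
    Monotone fun k : ℕ => (k.factorial : ℝ) * Real.exp k / (k : ℝ) ^ k := by
  refine monotone_nat_of_le_succ fun k => ?_
  rcases Nat.eq_zero_or_pos k with rfl | hk
  · simp
  have hk' : (0 : ℝ) < k := by exact_mod_cast hk
  have h : ((k : ℝ) + 1) ^ k ≤ Real.exp 1 * (k : ℝ) ^ k := by
    calc ((k : ℝ) + 1) ^ k = ((1 / k + 1) * k) ^ k := by congr 1; field_simp; ring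
      _ ≤ (Real.exp (1 / k) * k) ^ k := by gcongr; exact Real.add_one_le_exp _
      _ = Real.exp 1 * (k : ℝ) ^ k := by
        rw [mul_pow, ← Real.exp_nat_mul]; congr 2; field_simp
  rw [div_le_div_iff₀ (by positivity) (by positivity), Nat.factorial_succ]
  push_cast
  rw [Real.exp_add, pow_succ]
  calc (k.factorial : ℝ) * Real.exp k * (((k : ℝ) + 1) ^ k * (k + 1))
      ≤ (k.factorial : ℝ) * Real.exp k * ((Real.exp 1 * (k : ℝ) ^ k) * (k + 1)) := by gcongr
    _ = _ := by ring

theorem factorial_mul_exp_le {r : ℕ} (hr : 1 ≤ r) :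
    (r.factorial : ℝ) * Real.exp r ≤ Real.exp 1 * r * (r : ℝ) ^ r := by
  induction r, hr using Nat.le_induction with
  | base => simp
  | succ k hk ih =>
    have h : Real.exp 1 * (k : ℝ) ^ (k + 1) ≤ ((k : ℝ) + 1) ^ (k + 1) := by
      have h0 : (k : ℝ) ≤ (k + 1) * Real.exp (-(1 / (k + 1))) := by
        calc (k : ℝ) = (k + 1) * (1 - 1 / (k + 1)) := by field_simp; ring
          _ ≤ _ := by gcongr; exact Real.one_sub_le_exp_neg _
      calc Real.exp 1 * (k : ℝ) ^ (k + 1)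
          ≤ Real.exp 1 * ((k + 1) * Real.exp (-(1 / (k + 1)))) ^ (k + 1) := by gcongr
        _ = ((k : ℝ) + 1) ^ (k + 1) := by
          rw [mul_pow, ← Real.exp_nat_mul, mul_left_comm, ← Real.exp_add]
          have : (1 : ℝ) + ((k + 1 : ℕ) : ℝ) * -(1 / (k + 1)) = 0 := by
            push_cast; field_simp; ring
          rw [this]; simp
    rw [Nat.factorial_succ]
    push_cast
    rw [Real.exp_add]
    calc ((k : ℝ) + 1) * k.factorial * (Real.exp k * Real.exp 1)
        = (k + 1) * Real.exp 1 * (k.factorial * Real.exp k) := by ring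
      _ ≤ (k + 1) * Real.exp 1 * (Real.exp 1 * k * (k : ℝ) ^ k) := by gcongr
      _ = (k + 1) * Real.exp 1 * (Real.exp 1 * (k : ℝ) ^ (k + 1)) := by ring
      _ ≤ (k + 1) * Real.exp 1 * ((k : ℝ) + 1) ^ (k + 1) := by gcongr
      _ = _ := by ring

/-- The mode of a binomial distribution with mean `r` has probability at least `1 / (e r)`. -/
theorem pow_add_le_choose_mul {r s : ℕ} (hr : 1 ≤ r) (hs : 1 ≤ s) :
    ((r + s : ℕ) : ℝ) ^ (r + s) ≤
      Real.exp 1 * r * (r + s).choose r * ((r : ℝ) ^ r * (s : ℝ) ^ s) := by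
  have hs' : (0 : ℝ) < s := by exact_mod_cast hs
  have hA := monotone_factorial_mul_exp_div_pow (Nat.le_add_left s r)
  have hB := factorial_mul_exp_le hr
  have hC : ((r + s).choose r : ℝ) * r.factorial * s.factorial = (r + s).factorial := by
    have := Nat.choose_mul_factorial_mul_factorial (Nat.le_add_right r s)
    rw [Nat.add_sub_cancel_left] at this
    exact_mod_cast this
  simp only at hA
  rw [div_le_div_iff₀ (by positivity) (by positivity), ← hC] at hA
  rw [show Real.exp ((r + s : ℕ) : ℝ) = Real.exp r * Real.exp s by
    rw [← Real.exp_add]; push_cast; rfl] at hA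
  have hA' : ((r + s : ℕ) : ℝ) ^ (r + s) ≤
      (r + s).choose r * (s : ℝ) ^ s * (r.factorial * Real.exp r) := by
    refine le_of_mul_le_mul_left ?_ (by positivity : (0 : ℝ) < s.factorial * Real.exp s)
    linarith
  calc ((r + s : ℕ) : ℝ) ^ (r + s)
      ≤ (r + s).choose r * (s : ℝ) ^ s * (r.factorial * Real.exp r) := hA'
    _ ≤ (r + s).choose r * (s : ℝ) ^ s * (Real.exp 1 * r * (r : ℝ) ^ r) := by gcongr
    _ = _ := by ring

theorem exists_isCFF_card_le {r s n : ℕ} (hr : 1 ≤ r) (hs : 1 ≤ s) (hn : r + s ≤ n) :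
    ∃ F : Finset (Fin n → Bool), IsCFF n r s F ∧
      (F.card : ℝ) ≤ (r + s : ℕ) * Real.log n * (Real.exp 1 * r * (r + s).choose r) + 1 := by
  have hr' : (0 : ℝ) < r := by exact_mod_cast hr
  have hs' : (0 : ℝ) < s := by exact_mod_cast hs
  have hn' : (1 : ℝ) ≤ n := by exact_mod_cast (by omega : 1 ≤ n)
  set p : ℝ := r / (r + s) with hp
  have hp0 : 0 < p := by positivity
  have hp1 : 1 - p = s / (r + s) := by rw [hp]; field_simp; ring
  have hp1' : 0 < 1 - p := by rw [hp1]; positivity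
  set q : ℝ := p ^ r * (1 - p) ^ s with hq
  have hq0 : 0 < q := by positivity
  have hq1 : q ≤ 1 := mul_le_one₀ (pow_le_one₀ hp0.le (by linarith)) (by positivity)
    (pow_le_one₀ hp1'.le (by linarith))
  have hqinv : 1 / q ≤ Real.exp 1 * r * (r + s).choose r := by
    rw [div_le_iff₀ hq0, hq, hp1, hp, div_pow, div_pow, div_mul_div_comm, ← pow_add, mul_div_assoc',
      le_div_iff₀ (by positivity), one_mul]
    exact_mod_cast pow_add_le_choose_mul hr hs
  let U : Finset (Finset (Fin n) × Finset (Fin n)) :=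
    ((Finset.univ.powersetCard r) ×ˢ (Finset.univ.powersetCard s)).filter fun u => Disjoint u.1 u.2
  have hU : (U.card : ℝ) ≤ Real.exp ((r + s : ℕ) * Real.log n) := by
    rw [Real.exp_nat_mul, Real.exp_log (by linarith)]
    have : U.card ≤ n ^ (r + s) := by
      refine (Finset.card_filter_le _ _).trans ?_
      rw [Finset.card_product, Finset.card_powersetCard, Finset.card_powersetCard,
        Finset.card_univ, Fintype.card_fin, pow_add]
      exact Nat.mul_le_mul (Nat.choose_le_pow _ _) (Nat.choose_le_pow _ _)
    exact_mod_cast this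
  have hsum : ∑ a : Fin n → Bool, ∏ i, (if a i then p else 1 - p) = 1 := by
    simpa using sum_prod_bernoulli_eq p (∅ : Finset (Fin n)) ∅ (by simp)
  obtain ⟨F, hF, hF'⟩ := exists_cover_card_le
    (fun (a : Fin n → Bool) (u : Finset (Fin n) × Finset (Fin n)) =>
      (∀ i ∈ u.1, a i = true) ∧ ∀ i ∈ u.2, a i = false)
    (fun a => ∏ i, (if a i then p else 1 - p))
    (fun a => Finset.prod_pos fun i _ => by split_ifs <;> assumption)
    hsum U q hq0 hq1
    (by
      intro u hu
      simp only [U, Finset.mem_filter, Finset.mem_product, Finset.mem_powersetCard] at hu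
      refine le_of_eq ?_
      rw [hq, ← hu.1.1.2, ← hu.1.2.2]
      convert (sum_prod_bernoulli_eq p u.1 u.2 hu.2).symm)
    ((r + s : ℕ) * Real.log n) (mul_nonneg (by positivity) (Real.log_nonneg hn')) hU
  refine ⟨F, ?_, hF.trans ?_⟩
  · intro S hS J hJ hJr
    refine hF' (J, S \ J) ?_
    simp only [U, Finset.mem_filter, Finset.mem_product, Finset.mem_powersetCard]
    refine ⟨⟨⟨Finset.subset_univ _, hJr⟩, Finset.subset_univ _, ?_⟩, Finset.disjoint_sdiff⟩
    rw [Finset.card_sdiff_of_subset hJ]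
    omega
  · rw [div_eq_mul_one_div]
    have := Real.log_nonneg hn'
    gcongr

theorem le_choose_of_le {r s : ℕ} (hr : 1 ≤ r) (hs : 1 ≤ s) : r + s ≤ (r + s).choose r := by
  induction r, hr using Nat.le_induction with
  | base => simp
  | succ k hk ih =>
    rw [show k + 1 + s = (k + s) + 1 by omega, Nat.choose_succ_succ']
    have : 0 < (k + s).choose (k + 1) := Nat.choose_pos (by omega)
    omega

theorem two_pow_le_choose {r s : ℕ} (hrs : r ≤ s) : 2 ^ r ≤ (r + s).choose r := by
  refine le_trans ?_ (Nat.choose_le_choose r (by omega : 2 * r ≤ r + s))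
  rcases Nat.eq_zero_or_pos r with rfl | hr
  · simp
  have h := Nat.four_pow_le_two_mul_self_mul_centralBinom r hr
  rw [Nat.centralBinom_eq_two_mul_choose] at h
  have h2 : 2 * r ≤ 2 ^ r := by
    obtain ⟨k, rfl⟩ := Nat.exists_eq_add_of_le' hr
    have := Nat.lt_two_pow_self (n := k)
    rw [pow_succ]
    omega
  have h4 : 4 ^ r = 2 ^ r * 2 ^ r := by rw [← mul_pow]; norm_num
  rw [h4] at h
  exact Nat.le_of_mul_le_mul_left (h.trans (Nat.mul_le_mul_right _ h2)) (by positivity)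

theorem eventually_logb_sq_le_rpow {ε : ℝ} (hε : 0 < ε) :
    ∀ᶠ x : ℝ in Filter.atTop, 6 * Real.logb 2 x ^ 2 ≤ x ^ ε := by
  have h := (isLittleO_log_rpow_rpow_atTop 2 hε).bound
    (c := Real.log 2 ^ 2 / 6) (by have := Real.log_pos one_lt_two; positivity)
  filter_upwards [h, Filter.eventually_ge_atTop 1] with x hx hx1
  have hl := Real.log_pos one_lt_two
  rw [Real.rpow_two, Real.norm_of_nonneg (sq_nonneg _), Real.norm_of_nonneg (by positivity)] at hx
  rw [Real.logb, div_pow, mul_div_assoc', div_le_iff₀ (by positivity)]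
  linarith

/-- For every `ε > 0` there is `D₀` such that whenever `1 ≤ r ≤ s`, `d := r + s ≥ D₀`
and `d ≤ n`, there is an `(n,(r,s))`-CFF of size at most
`(d·C(d,r)/log₂ C(d,r))^{1+ε} · log₂ n`. -/
theorem almost_optimal_cff_exists :
    ∀ ε : ℝ, 0 < ε → ∃ D₀ : ℕ, ∀ r s n : ℕ, 1 ≤ r → r ≤ s → D₀ ≤ r + s → r + s ≤ n →
      ∃ F : Finset (Fin n → Bool), IsCFF n r s F ∧
        (F.card : ℝ) ≤
          ((((r + s) * (r + s).choose r : ℕ) : ℝ) / Real.logb 2 ((r + s).choose r)) ^ (1 + ε) *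
            Real.logb 2 n := by
  intro ε hε
  obtain ⟨x₀, hx₀⟩ := Filter.eventually_atTop.1 (eventually_logb_sq_le_rpow hε)
  refine ⟨⌈x₀⌉₊, fun r s n hr hrs hd hn => ?_⟩
  have hs : 1 ≤ s := hr.trans hrs
  obtain ⟨F, hF, hcard⟩ := exists_isCFF_card_le hr hs hn
  refine ⟨F, hF, hcard.trans ?_⟩
  set d := r + s with hd_def
  set C := d.choose r with hC_def
  set L := Real.logb 2 (C : ℝ) with hL_def
  have hd2 : (2 : ℝ) ≤ d := by exact_mod_cast (by omega : 2 ≤ d)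
  have hr1 : (1 : ℝ) ≤ r := by exact_mod_cast hr
  have hdC : (d : ℝ) ≤ C := by exact_mod_cast le_choose_of_le hr hs
  have hCpos : (0 : ℝ) < C := by linarith
  have hrL : (r : ℝ) ≤ L := by
    rw [hL_def, Real.le_logb_iff_rpow_le one_lt_two hCpos, Real.rpow_natCast]
    exact_mod_cast two_pow_le_choose hrs
  have hLd : L ≤ d := by
    rw [hL_def, Real.logb_le_iff_le_rpow one_lt_two hCpos, Real.rpow_natCast]
    exact_mod_cast Nat.choose_le_two_pow d r
  have hLpos : 0 < L := by linarith
  have hCε : 6 * L ^ 2 ≤ (C : ℝ) ^ ε :=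
    hx₀ C ((Nat.le_ceil x₀).trans ((Nat.cast_le.2 hd).trans hdC))
  have hN : (C : ℝ) ≤ d * C / L := by
    rw [le_div_iff₀ hLpos, mul_comm (d : ℝ)]
    gcongr
  have hn2 : (2 : ℝ) ≤ n := hd2.trans (by exact_mod_cast hn)
  have hlogn : Real.log 2 ≤ Real.log n := Real.log_le_log (by norm_num) hn2
  have hlog2 := Real.log_two_gt_d9
  have hlog2' := Real.log_two_lt_d9
  have hlogb : Real.log n ≤ Real.logb 2 n := by
    rw [Real.logb, le_div_iff₀ (by linarith)]
    nlinarith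
  have hX : 1 ≤ (d : ℝ) * Real.log n * (Real.exp 1 * r * C) := by
    have he : 1 ≤ Real.exp 1 := Real.one_le_exp (by norm_num)
    have h1 : 1 ≤ (d : ℝ) * Real.log n := by nlinarith
    exact one_le_mul_of_one_le_of_one_le h1
      (one_le_mul_of_one_le_of_one_le (one_le_mul_of_one_le_of_one_le he hr1) (by linarith))
  have he : Real.exp 1 ≤ 3 := by linarith [Real.exp_one_lt_d9]
  have hlogb0 : 0 ≤ Real.logb 2 n := by linarith
  push_cast
  rw [Real.rpow_add (by positivity), Real.rpow_one]
  calc (d : ℝ) * Real.log n * (Real.exp 1 * r * C) + 1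
      ≤ 2 * (d * Real.log n * (Real.exp 1 * r * C)) := by linarith
    _ ≤ 2 * (d * Real.logb 2 n * (3 * L * C)) := by gcongr
    _ = d * C / L * (6 * L ^ 2) * Real.logb 2 n := by field_simp; ring
    _ ≤ d * C / L * (d * C / L) ^ ε * Real.logb 2 n := by
      gcongr
      exact hCε.trans (by gcongr)
end

section
/- Let F be a set of boolean functions f : {1,…,q}^d → {0,1} that is closed under permutations of coordinates (i.e., for every f ∈ F and every permutation π of {1,…,d}, the function (x₁,…,x_d) ↦ f(x_{π(1)},…,x_{π(d)}) is in F). If H₂ is an (n,m,d)-perfect hash family and H₁ is an (m,F)-restriction family, then the family H₁(H₂) := { h₁ ∘ h₂ : h₁ ∈ H₁, h₂ ∈ H₂ } is an (n,F)-restriction family of size at most |H₁|·|H₂|. -/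
/-- An `(n,q,d)`-perfect hash family. -/
def IsPHF (n q d : ℕ) (H : Finset (Fin n → Fin q)) : Prop :=
  ∀ S : Finset (Fin n), S.card = d → ∃ h ∈ H, Set.InjOn h S

/-- An `(n,F)`-restriction family for a set `F` of boolean functions on `[q]^d`:
for every increasing tuple of `d` indices in `[n]` and every `f ∈ F`, some `h ∈ H`
satisfies `f(h(i₁),…,h(i_d)) = 1`. -/
def IsRF (n d q : ℕ) (F : Set ((Fin d → Fin q) → Bool)) (H : Finset (Fin n → Fin q)) : Prop :=
  ∀ i : Fin d → Fin n, StrictMono i → ∀ f ∈ F, ∃ h ∈ H, f (fun j => h (i j)) = true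

/-- If `F` is closed under permutations of coordinates, `H₂` is an `(n,m,d)`-PHF and
`H₁` is an `(m,F)`-restriction family, then `{h₁ ∘ h₂}` is an `(n,F)`-restriction
family of size at most `|H₁|·|H₂|`. -/
theorem rf_compose (d q n m : ℕ) (F : Set ((Fin d → Fin q) → Bool))
    (hperm : ∀ f ∈ F, ∀ π : Equiv.Perm (Fin d), (fun x : Fin d → Fin q => f (x ∘ π)) ∈ F)
    (H₂ : Finset (Fin n → Fin m)) (hH₂ : IsPHF n m d H₂)
    (H₁ : Finset (Fin m → Fin q)) (hH₁ : IsRF m d q F H₁) :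
    IsRF n d q F ((H₁ ×ˢ H₂).image fun p => p.1 ∘ p.2) ∧
      ((H₁ ×ˢ H₂).image fun p => p.1 ∘ p.2).card ≤ H₁.card * H₂.card := by
  refine ⟨fun i hi f hf => ?_, Finset.card_image_le.trans (Finset.card_product _ _).le⟩
  obtain ⟨h₂, hh₂, hinj⟩ := hH₂ (Finset.univ.map ⟨i, hi.injective⟩) (by simp)
  have hg : Function.Injective (h₂ ∘ i) := fun a b hab =>
    hi.injective (hinj (by simp) (by simp) hab)
  let σ := Tuple.sort (h₂ ∘ i)
  have hmono : StrictMono ((h₂ ∘ i) ∘ σ) :=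
    (Tuple.monotone_sort (h₂ ∘ i)).strictMono_of_injective (hg.comp σ.injective)
  obtain ⟨h₁, hh₁, hval⟩ := hH₁ _ hmono _ (hperm f hf σ⁻¹)
  refine ⟨h₁ ∘ h₂, Finset.mem_image.2 ⟨(h₁, h₂), Finset.mem_product.2 ⟨hh₁, hh₂⟩, rfl⟩, ?_⟩
  simpa [Function.comp_def] using hval
end

section
/- Let r, s be positive integers, d := r + s, and let q, n be integers with d ≤ q ≤ n. If H₁ is an (n,q,d)-perfect hash family and H is a (q,(r,s))-cover-free family (whose elements are viewed as functions {1,…,q} → {0,1}), then the family { h ∘ h₁ : h ∈ H, h₁ ∈ H₁ } ⊆ {0,1}^n is an (n,(r,s))-cover-free family of size at most |H|·|H₁|. -/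
/-- If `H₁` is an `(n,q,d)`-PHF (`d = r+s`) and `H` is a `(q,(r,s))`-CFF, then
`{h ∘ h₁ : h ∈ H, h₁ ∈ H₁}` is an `(n,(r,s))`-CFF of size at most `|H|·|H₁|`. -/
theorem cff_compose_phf (r s q n : ℕ) (hr : 1 ≤ r) (hs : 1 ≤ s)
    (hdq : r + s ≤ q) (hqn : q ≤ n)
    (H₁ : Finset (Fin n → Fin q)) (hH₁ : IsPHF n q (r + s) H₁)
    (H : Finset (Fin q → Bool)) (hH : IsCFF q r s H) :
    IsCFF n r s ((H ×ˢ H₁).image fun p => p.1 ∘ p.2) ∧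
      ((H ×ˢ H₁).image fun p => p.1 ∘ p.2).card ≤ H.card * H₁.card := by
  refine ⟨fun S hS J hJS hJ => ?_, Finset.card_image_le.trans_eq (Finset.card_product H H₁)⟩
  obtain ⟨g, hg, hinj⟩ := hH₁ S hS
  obtain ⟨a, ha, htrue, hfalse⟩ := hH (S.image g) (by rw [Finset.card_image_of_injOn hinj, hS])
    (J.image g) (Finset.image_subset_image hJS)
    (by rw [Finset.card_image_of_injOn (hinj.mono (Finset.coe_subset.mpr hJS)), hJ])
  refine ⟨a ∘ g, Finset.mem_image.mpr ⟨(a, g), Finset.mk_mem_product ha hg, rfl⟩,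
    fun i hi => htrue _ (Finset.mem_image_of_mem g hi), fun i hi => hfalse _ ?_⟩
  obtain ⟨hiS, hiJ⟩ := Finset.mem_sdiff.mp hi
  refine Finset.mem_sdiff.mpr ⟨Finset.mem_image_of_mem g hiS, fun hmem => ?_⟩
  obtain ⟨j, hj, hji⟩ := Finset.mem_image.mp hmem
  exact hiJ (hinj (hJS hj) hiS hji ▸ hj)
end

section
/- There exists a constant C > 0 such that for all integers t, k ≥ 1 there exists a hitting set H ⊆ {1,…,t}^k for combinatorial rectangles with sidewise density 1/3 of size |H| ≤ t^C · 2^{Ck}. -/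
/-- `H ⊆ [t]^k` is a hitting set for combinatorial rectangles with sidewise
density `γ`: it meets every rectangle `R₁ × ⋯ × R_k` with `|R_i| ≥ γ·t`. -/
def IsRectHitting (t k : ℕ) (γ : ℝ) (H : Finset (Fin k → Fin t)) : Prop :=
  ∀ R : Fin k → Finset (Fin t), (∀ i, γ * t ≤ ((R i).card : ℝ)) →
    ∃ v ∈ H, ∀ i, v i ∈ R i

open Finset in
/-- Union bound: a finite family of sets, each of density at least `δ` in `V`, has a hitting set
of size at most `n` as soon as the number of sets times `(1 - δ) ^ n` is less than `1`. -/
theorem exists_hitting_of_density {ι V : Type*} [Fintype V] [DecidableEq V] [Nonempty V]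
    (A : Finset ι) (S : ι → Finset V) (δ : ℝ) (n : ℕ)
    (hS : ∀ i ∈ A, δ * Fintype.card V ≤ ((S i).card : ℝ))
    (hn : (A.card : ℝ) * (1 - δ) ^ n < 1) :
    ∃ H : Finset V, H.card ≤ n ∧ ∀ i ∈ A, ∃ v ∈ H, v ∈ S i := by
  by_contra! hcon
  have hcover : (univ : Finset (Fin n → V)) ⊆
      A.biUnion fun i => Fintype.piFinset fun _ => (S i)ᶜ := by
    intro f _
    obtain ⟨i, hi, hf⟩ := hcon (univ.image f) (card_image_le.trans (by simp))
    simp only [mem_biUnion, Fintype.mem_piFinset, mem_compl]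
    exact ⟨i, hi, fun j => hf _ (mem_image_of_mem f (mem_univ j))⟩
  have hcard : Fintype.card V ^ n ≤ ∑ i ∈ A, (S i)ᶜ.card ^ n := by
    simpa using (card_le_card hcover).trans card_biUnion_le
  have hV : (0 : ℝ) < Fintype.card V := by exact_mod_cast Fintype.card_pos
  have hterm : ∀ i ∈ A, ((S i)ᶜ.card : ℝ) ^ n ≤ ((1 - δ) * Fintype.card V) ^ n := by
    intro i hi
    refine pow_le_pow_left₀ (by positivity) ?_ n
    have hsum : ((S i).card : ℝ) + (S i)ᶜ.card = Fintype.card V := by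
      exact_mod_cast card_add_card_compl (S i)
    linarith [hS i hi]
  have hle : (Fintype.card V : ℝ) ^ n ≤ A.card * (1 - δ) ^ n * (Fintype.card V : ℝ) ^ n :=
    calc (Fintype.card V : ℝ) ^ n ≤ ∑ i ∈ A, ((S i)ᶜ.card : ℝ) ^ n := by exact_mod_cast hcard
      _ ≤ ∑ _i ∈ A, ((1 - δ) * Fintype.card V) ^ n := sum_le_sum hterm
      _ = A.card * (1 - δ) ^ n * (Fintype.card V : ℝ) ^ n := by
        rw [sum_const, nsmul_eq_mul, mul_pow, mul_assoc]
  have hpow : (0 : ℝ) < (Fintype.card V : ℝ) ^ n := by positivity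
  nlinarith

/-- A rectangle with sidewise density `γ` has density at least `γ ^ k` in `[t]^k`. -/
theorem pow_mul_card_le_card_piFinset {t k : ℕ} {γ : ℝ} (hγ : 0 ≤ γ)
    (R : Fin k → Finset (Fin t)) (hR : ∀ i, γ * t ≤ ((R i).card : ℝ)) :
    γ ^ k * Fintype.card (Fin k → Fin t) ≤ ((Fintype.piFinset R).card : ℝ) := by
  calc γ ^ k * Fintype.card (Fin k → Fin t) = ∏ _i : Fin k, γ * t := by
        simp [mul_pow]
    _ ≤ ∏ i, ((R i).card : ℝ) := Finset.prod_le_prod (fun _ _ => by positivity) fun i _ => hR i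
    _ = ((Fintype.piFinset R).card : ℝ) := by simp

/-- For `N ≥ 1`, the quantity `2 ^ N * (1 - 1 / m) ^ (N * m)` is less than `1`. -/
theorem two_pow_mul_one_sub_inv_pow_lt_one {N m : ℕ} (hN : 1 ≤ N) (hm : 1 ≤ m) :
    (2 : ℝ) ^ N * (1 - (m : ℝ)⁻¹) ^ (N * m) < 1 := by
  have hm' : (1 : ℝ) ≤ m := by exact_mod_cast hm
  have hbase : (1 - (m : ℝ)⁻¹) ^ m ≤ Real.exp (-1) := by
    calc (1 - (m : ℝ)⁻¹) ^ m ≤ Real.exp (-(m : ℝ)⁻¹) ^ m :=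
          pow_le_pow_left₀ (sub_nonneg.2 (inv_le_one_of_one_le₀ hm'))
            (Real.one_sub_le_exp_neg _) m
      _ = Real.exp (-1) := by
        rw [← Real.exp_nat_mul]
        congr 1
        field_simp
  have hexp : 2 * Real.exp (-1) < 1 := by
    rw [Real.exp_neg, ← div_eq_mul_inv, div_lt_one (Real.exp_pos 1)]
    linarith [Real.exp_one_gt_d9]
  have hnonneg : 0 ≤ (1 - (m : ℝ)⁻¹) ^ m :=
    pow_nonneg (sub_nonneg.2 (inv_le_one_of_one_le₀ hm')) m
  rw [mul_comm N m, pow_mul, ← mul_pow]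
  exact pow_lt_one₀ (by positivity) (by linarith) (by omega)

/-- There is a constant `C > 0` such that for all `t, k ≥ 1` there is a hitting set
for rectangles with sidewise density `1/3` of size at most `t^C · 2^{Ck}`. -/
theorem rect_hitting_exists :
    ∃ C : ℝ, 0 < C ∧ ∀ t k : ℕ, 1 ≤ t → 1 ≤ k →
      ∃ H : Finset (Fin k → Fin t), IsRectHitting t k (1/3) H ∧
        (H.card : ℝ) ≤ (t : ℝ) ^ C * 2 ^ (C * k) := by
  classical
  refine ⟨3, by norm_num, fun t k ht hk => ?_⟩
  have : Nonempty (Fin t) := ⟨⟨0, ht⟩⟩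
  let A : Finset (Fin k → Finset (Fin t)) :=
    Finset.univ.filter fun R => ∀ i, (1 / 3 : ℝ) * t ≤ ((R i).card : ℝ)
  have hA : (A.card : ℝ) ≤ 2 ^ (t * k) := by
    have h : A.card ≤ 2 ^ (t * k) := by
      simpa [pow_mul] using A.card_le_univ
    exact_mod_cast h
  have hlt : (A.card : ℝ) * (1 - (1 / 3 : ℝ) ^ k) ^ (t * k * 3 ^ k) < 1 := by
    have h := two_pow_mul_one_sub_inv_pow_lt_one (Nat.mul_pos ht hk) (Nat.one_le_pow k 3 (by simp))
    have hinv : ((3 ^ k : ℕ) : ℝ)⁻¹ = (1 / 3 : ℝ) ^ k := by simp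
    rw [hinv] at h
    have hpos : (0 : ℝ) ≤ 1 - (1 / 3) ^ k :=
      sub_nonneg.2 (pow_le_one₀ (by norm_num) (by norm_num))
    exact (mul_le_mul_of_nonneg_right hA (pow_nonneg hpos _)).trans_lt h
  obtain ⟨H, hcard, hH⟩ := exists_hitting_of_density A (fun R => Fintype.piFinset R) _ _
    (fun R hR => pow_mul_card_le_card_piFinset (by norm_num) R (Finset.mem_filter.1 hR).2) hlt
  refine ⟨H, fun R hR => ?_, ?_⟩
  · simpa using hH R (Finset.mem_filter.2 ⟨Finset.mem_univ R, hR⟩)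
  · have hbound : H.card ≤ t ^ 3 * 2 ^ (3 * k) :=
      calc H.card ≤ t * k * 3 ^ k := hcard
        _ ≤ t ^ 3 * 2 ^ k * 4 ^ k := by
          gcongr
          · exact Nat.le_self_pow (by norm_num) t
          · exact Nat.lt_two_pow_self.le
          · norm_num
        _ = t ^ 3 * 2 ^ (3 * k) := by
          rw [mul_assoc, ← mul_pow, pow_mul]
          norm_num
    have hrpow : (t : ℝ) ^ (3 : ℝ) * 2 ^ ((3 : ℝ) * k) = ((t ^ 3 * 2 ^ (3 * k) : ℕ) : ℝ) := by
      push_cast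
      rw [← Real.rpow_natCast, ← Real.rpow_natCast]
      push_cast
      rfl
    rw [hrpow]
    exact_mod_cast hbound
end

section
/- There exists a constant C > 0 such that for all positive integers n, k and ρ_{1,1}, ρ_{1,2}, …, ρ_{k,1}, ρ_{k,2} with ρ_{i,1} + ρ_{i,2} ≤ n for all i, there exists an (n,((ρ_{1,1},ρ_{1,2}),…,(ρ_{k,1},ρ_{k,2})))-multi-CFF of size at most (2^k · (log₂ n) · max_i ρ_{i,1}ρ_{i,2})^C · ∏_{i=1}^k C(48·ρ_{i,1}ρ_{i,2}, ρ_{i,1}), where C(a,b) denotes the binomial coefficient. -/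
/-- An `(n,((ρ₁₁,ρ₁₂),…,(ρ_k₁,ρ_k₂)))`-multi-CFF: for every `k` pairs of disjoint
subsets of the prescribed sizes there is `h ∈ H` that is `1` on each `S_{i,1}` and
`0` on each `S_{i,2}`, simultaneously for all `i`. -/
def IsMCFF (n k : ℕ) (ρ₁ ρ₂ : Fin k → ℕ) (H : Finset (Fin k → Fin n → Bool)) : Prop :=
  ∀ S₁ S₂ : Fin k → Finset (Fin n),
    (∀ i, Disjoint (S₁ i) (S₂ i)) → (∀ i, (S₁ i).card = ρ₁ i) → (∀ i, (S₂ i).card = ρ₂ i) →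
      ∃ h ∈ H, ∀ i, (∀ x ∈ S₁ i, h i x = true) ∧ ∀ x ∈ S₂ i, h i x = false

/-- If every `t ∈ T` is related to at least a `1 / Q` fraction of `Ω`, then some `ω` is related
to at least a `1 / Q` fraction of `T`. -/
lemma exists_card_le_mul_card_filter {Ω τ : Type*} [Fintype Ω] [Nonempty Ω]
    (R : τ → Ω → Prop) [∀ t, DecidablePred (R t)] [∀ ω, DecidablePred fun t => R t ω]
    (T : Finset τ) (Q : ℕ)
    (h : ∀ t ∈ T, Fintype.card Ω ≤ Q * (Finset.univ.filter (R t)).card) :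
    ∃ ω, T.card ≤ Q * (T.filter fun t => R t ω).card := by
  by_contra! hlt
  have h1 : ∑ ω : Ω, Q * (T.filter fun t => R t ω).card < ∑ _ω : Ω, T.card :=
    Finset.sum_lt_sum_of_nonempty Finset.univ_nonempty fun ω _ => hlt ω
  have h2 : ∑ _t ∈ T, Fintype.card Ω ≤ ∑ t ∈ T, Q * (Finset.univ.filter (R t)).card :=
    Finset.sum_le_sum h
  have h3 : ∑ t ∈ T, (Finset.univ.filter (R t)).card
      = ∑ ω : Ω, (T.filter fun t => R t ω).card :=
    Finset.sum_card_bipartiteAbove_eq_sum_card_bipartiteBelow R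
  rw [← Finset.mul_sum, ← h3, Finset.mul_sum] at h1
  simp only [Finset.sum_const, smul_eq_mul, Finset.card_univ] at h1 h2
  rw [mul_comm] at h1
  omega

/-- After `m` greedy choices at most a `(1 - 1 / Q) ^ m` fraction of `T` is uncovered. -/
lemma exists_greedy_cover {Ω τ : Type*} [Fintype Ω] [Nonempty Ω] (R : τ → Ω → Prop)
    (T : Finset τ) (Q : ℕ) (hQ : 0 < Q)
    (h : ∀ t ∈ T, Fintype.card Ω ≤ Q * Nat.card {ω // R t ω}) (m : ℕ) :
    ∃ (H : Finset Ω) (U : Finset τ), H.card ≤ m ∧ U ⊆ T ∧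
      (∀ t ∈ T, t ∉ U → ∃ ω ∈ H, R t ω) ∧ (U.card : ℝ) ≤ (1 - 1 / (Q : ℝ)) ^ m * T.card := by
  classical
  induction m with
  | zero => exact ⟨∅, T, by simp, subset_rfl, fun t ht h => absurd ht h, by simp⟩
  | succ m ih =>
    obtain ⟨H, U, hH, hUT, hcov, hU⟩ := ih
    obtain ⟨ω, hω⟩ := exists_card_le_mul_card_filter R U Q fun t ht => by
      simpa [Nat.card_eq_fintype_card, Fintype.card_subtype] using h t (hUT ht)
    refine ⟨insert ω H, U.filter fun t => ¬ R t ω, (Finset.card_insert_le _ _).trans (by omega),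
      (Finset.filter_subset _ _).trans hUT, fun t ht hn => ?_, ?_⟩
    · by_cases htU : t ∈ U
      · exact ⟨ω, Finset.mem_insert_self _ _, by simpa [htU] using hn⟩
      · obtain ⟨ω', h1, h2⟩ := hcov t ht htU
        exact ⟨ω', Finset.mem_insert_of_mem h1, h2⟩
    · have hsum := Finset.card_filter_add_card_filter_not (s := U) (fun t => R t ω)
      have hQ' : (0 : ℝ) < Q := by exact_mod_cast hQ
      have hω' : (U.card : ℝ) / Q ≤ ((U.filter fun t => R t ω).card : ℝ) := by
        rw [div_le_iff₀' hQ']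
        exact_mod_cast hω
      have hsum' : ((U.filter fun t => R t ω).card : ℝ)
          + ((U.filter fun t => ¬ R t ω).card : ℝ) = U.card := by exact_mod_cast hsum
      have h1Q : 0 ≤ 1 - 1 / (Q : ℝ) := by
        rw [sub_nonneg, div_le_one hQ']
        exact_mod_cast hQ
      calc ((U.filter fun t => ¬ R t ω).card : ℝ) ≤ (1 - 1 / (Q : ℝ)) * U.card := by
            rw [sub_mul, one_mul, one_div_mul_eq_div]
            linarith
        _ ≤ (1 - 1 / (Q : ℝ)) * ((1 - 1 / (Q : ℝ)) ^ m * T.card) := by gcongr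
        _ = _ := by ring

/-- A family in which each `t ∈ T` is related to at least a `1 / Q` fraction of `Ω` is covered by
at most `Q log |T| + 1` elements of `Ω`. -/
lemma exists_cover_card_le_s7 {Ω τ : Type*} [Fintype Ω] [Nonempty Ω] (R : τ → Ω → Prop)
    (T : Finset τ) (Q : ℕ) (hQ : 0 < Q)
    (h : ∀ t ∈ T, Fintype.card Ω ≤ Q * Nat.card {ω // R t ω}) :
    ∃ H : Finset Ω, (H.card : ℝ) ≤ Q * Real.log T.card + 1 ∧ ∀ t ∈ T, ∃ ω ∈ H, R t ω := by
  have hQ' : (0 : ℝ) < Q := by exact_mod_cast hQ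
  have hlog : 0 ≤ (Q : ℝ) * Real.log T.card := by positivity
  obtain ⟨H, U, hH, -, hcov, hU⟩ :=
    exists_greedy_cover R T Q hQ h (⌊(Q : ℝ) * Real.log T.card⌋₊ + 1)
  refine ⟨H, ?_, fun t ht => hcov t ht fun htU => ?_⟩
  · have h1 : (H.card : ℝ) ≤ ⌊(Q : ℝ) * Real.log T.card⌋₊ + 1 := by exact_mod_cast hH
    linarith [Nat.floor_le hlog]
  · have hTpos : (0 : ℝ) < T.card := by exact_mod_cast Finset.card_pos.2 ⟨t, ht⟩
    have hUpos : (1 : ℝ) ≤ U.card := by exact_mod_cast Finset.card_pos.2 ⟨t, htU⟩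
    have hm := Nat.lt_floor_add_one ((Q : ℝ) * Real.log T.card)
    set m := ⌊(Q : ℝ) * Real.log T.card⌋₊ + 1
    have hm' : (Q : ℝ) * Real.log T.card < m := by simpa [m] using hm
    have h1Q : 0 ≤ 1 - 1 / (Q : ℝ) := by
      rw [sub_nonneg, div_le_one hQ']
      exact_mod_cast hQ
    have h2 : (1 - 1 / (Q : ℝ)) ^ m ≤ Real.exp (-(m / Q)) := by
      calc (1 - 1 / (Q : ℝ)) ^ m ≤ Real.exp (-(1 / Q)) ^ m := by
            gcongr
            exact Real.one_sub_le_exp_neg _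
        _ = Real.exp (-(m / Q)) := by
            rw [← Real.exp_nat_mul]
            ring_nf
    have h3 : Real.exp (-(m / Q)) * T.card < 1 := by
      rw [← Real.exp_log hTpos, ← Real.exp_add, Real.exp_lt_one_iff]
      have : Real.log T.card < m / Q := by rwa [lt_div_iff₀' hQ']
      linarith
    have h4 := mul_le_mul_of_nonneg_right h2 hTpos.le
    linarith

lemma succ_pow_self_le_three_mul (b : ℕ) : (b + 1) ^ b ≤ 3 * b ^ b := by
  rcases Nat.eq_zero_or_pos b with rfl | hb
  · simp
  have hb' : (0 : ℝ) < b := by exact_mod_cast hb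
  have h : ((b : ℝ) + 1) ^ b ≤ 3 * (b : ℝ) ^ b := by
    calc ((b : ℝ) + 1) ^ b = (1 / (b : ℝ) + 1) ^ b * (b : ℝ) ^ b := by
          rw [← mul_pow]
          congr 1
          field_simp
          ring
      _ ≤ Real.exp (1 / b) ^ b * (b : ℝ) ^ b := by
          gcongr
          exact Real.add_one_le_exp _
      _ = Real.exp 1 * (b : ℝ) ^ b := by
          rw [← Real.exp_nat_mul]
          congr 2
          field_simp
      _ ≤ 3 * (b : ℝ) ^ b := by
          gcongr
          exact Real.exp_one_lt_three.le
  exact_mod_cast h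

lemma three_mul_succ_pow_le_choose {a b : ℕ} (ha : 1 ≤ a) (hb : 1 ≤ b) :
    3 * (b + 1) ^ a ≤ (48 * (a * b)).choose a := by
  have h1 : (a * (47 * b)) ^ a ≤ a ^ a * (48 * (a * b)).choose a := by
    calc (a * (47 * b)) ^ a ≤ (48 * (a * b) + 1 - a) ^ a := by
          gcongr
          have : a ≤ a * b := Nat.le_mul_of_pos_right a hb
          have : a * (47 * b) = 47 * (a * b) := by ring
          omega
      _ ≤ (48 * (a * b)).descFactorial a := Nat.pow_sub_le_descFactorial _ _
      _ = a.factorial * (48 * (a * b)).choose a := Nat.descFactorial_eq_factorial_mul_choose _ _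
      _ ≤ a ^ a * (48 * (a * b)).choose a := by
          gcongr
          exact Nat.factorial_le_pow a
  rw [mul_pow] at h1
  refine le_trans ?_ (Nat.le_of_mul_le_mul_left h1 (by positivity))
  calc 3 * (b + 1) ^ a ≤ 3 ^ a * (b + 1) ^ a := by
        gcongr
        exact Nat.le_self_pow (by omega) 3
    _ = (3 * (b + 1)) ^ a := by rw [mul_pow]
    _ ≤ (47 * b) ^ a := Nat.pow_le_pow_left (by omega) a

/-- The functions `Fin n → Fin (b + 1)` vanishing on `A` and nowhere zero on `B` make up at
least a `1 / (48 * (a * b)).choose a` fraction of all functions. -/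
lemma pow_le_choose_mul_prod {n a b : ℕ} (ha : 1 ≤ a) (hb : 1 ≤ b) (A B : Finset (Fin n))
    (hAB : Disjoint A B) (hA : A.card = a) (hB : B.card = b) :
    (b + 1) ^ n ≤ (48 * (a * b)).choose a *
      ∏ x, (if x ∈ A then {0} else if x ∈ B then {0}ᶜ else Finset.univ :
        Finset (Fin (b + 1))).card := by
  have hprod : ∏ x, (if x ∈ A then {0} else if x ∈ B then {0}ᶜ else Finset.univ :
        Finset (Fin (b + 1))).card = b ^ b * (b + 1) ^ (A ∪ B)ᶜ.card := by
    have hcard : ∀ x, (if x ∈ A then {0} else if x ∈ B then {0}ᶜ else Finset.univ :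
        Finset (Fin (b + 1))).card
          = (if x ∈ B then b else 1) * (if x ∈ (A ∪ B)ᶜ then b + 1 else 1) := by
      intro x
      by_cases h1 : x ∈ A
      · have h2 : x ∉ B := Finset.disjoint_left.1 hAB h1
        simp [h1, h2]
      · by_cases h2 : x ∈ B <;> simp [h1, h2, Finset.card_compl]
    rw [Finset.prod_congr rfl fun x _ => hcard x, Finset.prod_mul_distrib,
      Finset.prod_ite_mem, Finset.prod_ite_mem]
    simp [hB]
  have hn : n = a + (b + (A ∪ B)ᶜ.card) := by
    have h1 := Finset.card_add_card_compl (A ∪ B)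
    rw [Finset.card_union_of_disjoint hAB, hA, hB, Fintype.card_fin] at h1
    omega
  rw [hprod]
  generalize (A ∪ B)ᶜ.card = c at hn
  rw [hn, pow_add, pow_add]
  calc (b + 1) ^ a * ((b + 1) ^ b * (b + 1) ^ c)
      ≤ (b + 1) ^ a * ((3 * b ^ b) * (b + 1) ^ c) := by
        gcongr
        exact succ_pow_self_le_three_mul b
    _ = (3 * (b + 1) ^ a) * (b ^ b * (b + 1) ^ c) := by ring
    _ ≤ _ := by
        gcongr
        exact three_mul_succ_pow_le_choose ha hb

lemma exists_isMCFF_card_le (n k : ℕ) (ρ₁ ρ₂ : Fin k → ℕ) (h₁ : ∀ i, 1 ≤ ρ₁ i)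
    (h₂ : ∀ i, 1 ≤ ρ₂ i) :
    ∃ H : Finset (Fin k → Fin n → Bool), IsMCFF n k ρ₁ ρ₂ H ∧
      (H.card : ℝ) ≤ (∏ i, (((48 * (ρ₁ i * ρ₂ i)).choose (ρ₁ i) : ℕ) : ℝ)) *
        Real.log ((∏ i, n ^ (ρ₁ i + ρ₂ i) : ℕ) : ℝ) + 1 := by
  classical
  let Q : ℕ := ∏ i, (48 * (ρ₁ i * ρ₂ i)).choose (ρ₁ i)
  let T : Finset (Fin k → Finset (Fin n) × Finset (Fin n)) := Fintype.piFinset fun i =>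
    (Finset.univ.powersetCard (ρ₁ i) ×ˢ Finset.univ.powersetCard (ρ₂ i)).filter
      fun p => Disjoint p.1 p.2
  let R : (Fin k → Finset (Fin n) × Finset (Fin n)) →
      ((i : Fin k) → Fin n → Fin (ρ₂ i + 1)) → Prop :=
    fun S f => ∀ i, (∀ x ∈ (S i).1, f i x = 0) ∧ ∀ x ∈ (S i).2, f i x ≠ 0
  have hQ : 0 < Q := Finset.prod_pos fun i _ =>
    lt_of_lt_of_le (by positivity) (three_mul_succ_pow_le_choose (h₁ i) (h₂ i))
  have hT : T.card ≤ ∏ i, n ^ (ρ₁ i + ρ₂ i) := by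
    rw [Fintype.card_piFinset]
    refine Finset.prod_le_prod' fun i _ => (Finset.card_filter_le _ _).trans ?_
    rw [Finset.card_product, Finset.card_powersetCard, Finset.card_powersetCard,
      Finset.card_univ, Fintype.card_fin, pow_add]
    exact Nat.mul_le_mul (Nat.choose_le_pow _ _) (Nat.choose_le_pow _ _)
  have hR : ∀ S ∈ T, Fintype.card ((i : Fin k) → Fin n → Fin (ρ₂ i + 1)) ≤
      Q * Nat.card {f // R S f} := by
    intro S hS
    simp only [T, Fintype.mem_piFinset, Finset.mem_filter, Finset.mem_product,
      Finset.mem_powersetCard_univ] at hS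
    have hgood : Finset.univ.filter (R S) = Fintype.piFinset fun i => Fintype.piFinset fun x =>
        (if x ∈ (S i).1 then {0} else if x ∈ (S i).2 then {0}ᶜ else Finset.univ :
          Finset (Fin (ρ₂ i + 1))) := by
      ext f
      simp only [R, Finset.mem_filter, Finset.mem_univ, true_and, Fintype.mem_piFinset]
      refine forall_congr' fun i => ?_
      rw [← forall_and]
      refine forall_congr' fun x => ?_
      by_cases hx1 : x ∈ (S i).1
      · have hx2 : x ∉ (S i).2 := Finset.disjoint_left.1 (hS i).2 hx1
        simp [hx1, hx2]
      · by_cases hx2 : x ∈ (S i).2 <;> simp [hx1, hx2]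
    rw [Nat.card_eq_fintype_card, Fintype.card_subtype, hgood, Fintype.card_piFinset,
      Fintype.card_pi, ← Finset.prod_mul_distrib]
    refine Finset.prod_le_prod' fun i _ => ?_
    rw [Fintype.card_piFinset, Fintype.card_fun, Fintype.card_fin, Fintype.card_fin]
    exact pow_le_choose_mul_prod (h₁ i) (h₂ i) _ _ (hS i).2 (hS i).1.1 (hS i).1.2
  obtain ⟨H, hH, hcov⟩ := exists_cover_card_le_s7 R T Q hQ hR
  refine ⟨H.image fun f i x => decide (f i x = 0), fun S₁ S₂ hd hc₁ hc₂ => ?_, ?_⟩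
  · obtain ⟨f, hf, hRf⟩ := hcov (fun i => (S₁ i, S₂ i)) (by simp [T, hd, hc₁, hc₂])
    exact ⟨_, Finset.mem_image_of_mem _ hf, fun i =>
      ⟨fun x hx => by simpa using (hRf i).1 x hx, fun x hx => by simpa using (hRf i).2 x hx⟩⟩
  · have hle : ((H.image fun f i x => decide (f i x = 0)).card : ℝ) ≤ H.card := by
      exact_mod_cast Finset.card_image_le
    have hlog : Real.log T.card ≤ Real.log ((∏ i, n ^ (ρ₁ i + ρ₂ i) : ℕ) : ℝ) := by
      rcases Nat.eq_zero_or_pos T.card with h0 | h0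
      · rw [h0, Nat.cast_zero, Real.log_zero]
        exact Real.log_natCast_nonneg _
      · exact Real.log_le_log (by exact_mod_cast h0) (by exact_mod_cast hT)
    have hmul : (Q : ℝ) * Real.log T.card ≤
        Q * Real.log ((∏ i, n ^ (ρ₁ i + ρ₂ i) : ℕ) : ℝ) := by gcongr
    have hQc : (Q : ℝ) = ∏ i, (((48 * (ρ₁ i * ρ₂ i)).choose (ρ₁ i) : ℕ) : ℝ) := by
      simp only [Q, Nat.cast_prod]
    rw [← hQc]
    linarith

/-- There is a constant `C > 0` such that for all `n, k ≥ 1` and all sizes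
`ρ_{i,1} + ρ_{i,2} ≤ n` there is a multi-CFF of size at most
`(2^k·log₂ n·max_i ρ_{i,1}ρ_{i,2})^C · ∏_i C(48ρ_{i,1}ρ_{i,2}, ρ_{i,1})`. -/
theorem mcff_exists :
    ∃ C : ℝ, 0 < C ∧ ∀ n k : ℕ, 1 ≤ n → 1 ≤ k → ∀ ρ₁ ρ₂ : Fin k → ℕ,
      (∀ i, 1 ≤ ρ₁ i) → (∀ i, 1 ≤ ρ₂ i) → (∀ i, ρ₁ i + ρ₂ i ≤ n) →
      ∃ H : Finset (Fin k → Fin n → Bool), IsMCFF n k ρ₁ ρ₂ H ∧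
        (H.card : ℝ) ≤
          ((2 ^ k : ℝ) * Real.logb 2 n *
              ((Finset.univ.sup fun i => ρ₁ i * ρ₂ i : ℕ) : ℝ)) ^ C *
            ∏ i, (((48 * (ρ₁ i * ρ₂ i)).choose (ρ₁ i) : ℕ) : ℝ) := by
  refine ⟨3, by norm_num, fun n k _ hk ρ₁ ρ₂ h₁ h₂ hsum => ?_⟩
  obtain ⟨H, hH, hcard⟩ := exists_isMCFF_card_le n k ρ₁ ρ₂ h₁ h₂
  refine ⟨H, hH, hcard.trans ?_⟩
  set P : ℝ := ∏ i, (((48 * (ρ₁ i * ρ₂ i)).choose (ρ₁ i) : ℕ) : ℝ)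
  set M : ℕ := Finset.univ.sup fun i => ρ₁ i * ρ₂ i
  set L : ℝ := Real.logb 2 n
  have hle : ∀ i, ρ₁ i * ρ₂ i ≤ M := fun i =>
    Finset.le_sup (f := fun i => ρ₁ i * ρ₂ i) (Finset.mem_univ i)
  have hn : 2 ≤ n := by linarith [h₁ ⟨0, hk⟩, h₂ ⟨0, hk⟩, hsum ⟨0, hk⟩]
  have hM : (1 : ℝ) ≤ M := by
    exact_mod_cast (Nat.mul_pos (h₁ ⟨0, hk⟩) (h₂ ⟨0, hk⟩)).trans_le (hle _)
  have hn' : (2 : ℝ) ≤ n := by exact_mod_cast hn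
  have hL : 1 ≤ L := by
    rw [Real.le_logb_iff_rpow_le (by norm_num) (by linarith)]
    simpa using hn'
  have hP : 1 ≤ P := by
    have : ∀ i ∈ Finset.univ, (1 : ℝ) ≤ (((48 * (ρ₁ i * ρ₂ i)).choose (ρ₁ i) : ℕ) : ℝ) := by
      intro i _
      have h3 := three_mul_succ_pow_le_choose (h₁ i) (h₂ i)
      have : 0 < (ρ₂ i + 1) ^ ρ₁ i := by positivity
      exact_mod_cast (by omega : 1 ≤ (48 * (ρ₁ i * ρ₂ i)).choose (ρ₁ i))
    exact Finset.prod_induction _ (fun x => 1 ≤ x) (fun _ _ => one_le_mul_of_one_le_of_one_le)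
      le_rfl this
  have hlogn : Real.log n ≤ L := by
    have h0 : 0 ≤ Real.log n := Real.log_natCast_nonneg n
    simp only [L, Real.logb]
    rw [le_div_iff₀ (Real.log_pos (by norm_num))]
    nlinarith [Real.log_two_lt_d9]
  have hlog : Real.log ((∏ i, n ^ (ρ₁ i + ρ₂ i) : ℕ) : ℝ) ≤ 2 * (2 ^ k * L * M) := by
    rw [Finset.prod_pow_eq_pow_sum, Nat.cast_pow, Real.log_pow]
    have hs : ∑ i, (ρ₁ i + ρ₂ i) ≤ k * (2 * M) := by
      calc ∑ i, (ρ₁ i + ρ₂ i) ≤ ∑ _i : Fin k, 2 * M := by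
            refine Finset.sum_le_sum fun i _ => ?_
            nlinarith [hle i, h₁ i, h₂ i]
        _ = k * (2 * M) := by simp
    have hs' : ((∑ i, (ρ₁ i + ρ₂ i) : ℕ) : ℝ) ≤ 2 ^ k * (2 * M) := by
      have h2k : k * (2 * M) ≤ 2 ^ k * (2 * M) :=
        Nat.mul_le_mul_right _ Nat.lt_two_pow_self.le
      exact_mod_cast hs.trans h2k
    calc _ ≤ (2 ^ k * (2 * M)) * L :=
          mul_le_mul hs' hlogn (Real.log_natCast_nonneg n) (by positivity)
      _ = _ := by ring
  have hX : 2 ≤ 2 ^ k * L * M := by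
    have h2k : (2 : ℝ) ≤ 2 ^ k := le_self_pow₀ (by norm_num) (by omega)
    calc (2 : ℝ) = 2 * 1 * 1 := by norm_num
      _ ≤ 2 ^ k * L * M := by gcongr
  set X : ℝ := 2 ^ k * L * M
  rw [show (3 : ℝ) = ((3 : ℕ) : ℝ) by norm_num, Real.rpow_natCast]
  have hX3 : 2 * X + 1 ≤ X ^ 3 := by nlinarith [sq_nonneg (X - 2), mul_self_nonneg X]
  calc P * Real.log ((∏ i, n ^ (ρ₁ i + ρ₂ i) : ℕ) : ℝ) + 1 ≤ P * (2 * X) + P := by gcongr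
    _ = (2 * X + 1) * P := by ring
    _ ≤ X ^ 3 * P := by gcongr
end

section
/- There exist constants C > 0 and r₀ such that for all integers r ≥ r₀, all integers k with √r ≤ k ≤ r, and all integers n ≥ r, setting z := 16·r·log₂ k / (k·log₂(4r/k)), there exists an (n,r,k)-splitter of size at most r^{C·z} · σ(r,k) · log₂ n, where σ(r,k) := (2πr/k)^{k/2} · e^{k²/(12r)}. -/
/-- An `(n,r,k)`-splitter. -/
def IsSplitter (n r k : ℕ) (H : Finset (Fin n → Fin k)) : Prop :=
  ∀ S : Finset (Fin n), S.card = r → ∃ h ∈ H, ∀ j : Fin k,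
    (S.filter fun i => h i = j).card = r / k ∨
    (S.filter fun i => h i = j).card = (r + k - 1) / k

/-- `σ(r,k) = (2πr/k)^{k/2} · e^{k²/(12r)}`. -/
noncomputable def sigmaRK (r k : ℕ) : ℝ :=
  (2 * Real.pi * r / k) ^ ((k : ℝ) / 2) * Real.exp ((k : ℝ) ^ 2 / (12 * r))

open Finset in
/-- If every `b ∈ U` is hit by a proportion at least `p` of `A`, then some `m` elements of `A`
miss at most a proportion `(1 - p) ^ m` of `U`. -/
theorem exists_cover {A B : Type*} [Fintype A] [Nonempty A] [DecidableEq A]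
    (R : A → B → Prop) [∀ a b, Decidable (R a b)] {p : ℝ} (hp1 : p ≤ 1) (U : Finset B)
    (hU : ∀ b ∈ U, p * Fintype.card A ≤ #{a | R a b}) (m : ℕ) :
    ∃ H : Finset A, #H ≤ m ∧ (#{b ∈ U | ∀ a ∈ H, ¬ R a b} : ℝ) ≤ (1 - p) ^ m * #U := by
  induction m with
  | zero => exact ⟨∅, by simp⟩
  | succ m ih =>
    obtain ⟨H, hH, hle⟩ := ih
    set V := {b ∈ U | ∀ a ∈ H, ¬ R a b} with hV
    obtain ⟨a, -, ha⟩ : ∃ a ∈ (univ : Finset A), p * #V ≤ (#{b ∈ V | R a b} : ℝ) := by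
      refine exists_le_of_sum_le univ_nonempty ?_
      have hswap : ∑ a : A, #{b ∈ V | R a b} = ∑ b ∈ V, #{a | R a b} :=
        sum_card_bipartiteAbove_eq_sum_card_bipartiteBelow R
      calc ∑ _a : A, p * (#V : ℝ) = ∑ _b ∈ V, p * Fintype.card A := by simp; ring
        _ ≤ ∑ b ∈ V, (#{a | R a b} : ℝ) :=
          sum_le_sum fun b hb => hU b (mem_filter.1 hb).1
        _ = ∑ a : A, (#{b ∈ V | R a b} : ℝ) := by exact_mod_cast hswap.symm
    refine ⟨insert a H, (card_insert_le _ _).trans (by omega), ?_⟩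
    have hset : {b ∈ U | ∀ a' ∈ insert a H, ¬ R a' b} = {b ∈ V | ¬ R a b} := by
      ext b; simp [hV]; tauto
    have hsplit : (#{b ∈ V | R a b} : ℝ) + #{b ∈ V | ¬ R a b} = #V := by
      exact_mod_cast card_filter_add_card_filter_not (s := V) (fun b => R a b)
    rw [hset]
    calc (#{b ∈ V | ¬ R a b} : ℝ) ≤ (1 - p) * #V := by linarith
      _ ≤ (1 - p) * ((1 - p) ^ m * #U) := mul_le_mul_of_nonneg_left hle (by linarith)
      _ = (1 - p) ^ (m + 1) * #U := by ring

open Finset in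
open scoped Nat in
/-- The number of functions with prescribed fibre sizes is at least the multinomial coefficient. -/
theorem factorial_le_card_fiber_profile_mul_prod {α ι : Type*} [Fintype α] [DecidableEq α]
    [Fintype ι] [DecidableEq ι] (a : ι → ℕ) (ha : ∑ j, a j = Fintype.card α) :
    (Fintype.card α)! ≤ #{f : α → ι | ∀ j, #{x | f x = j} = a j} * ∏ j, (a j)! := by
  have e : α ≃ Σ j, Fin (a j) := Fintype.equivOfCardEq (by simp [ha])
  let g : α → ι := fun x => (e x).1
  have hg : ∀ j, #{x | g x = j} = a j := fun j => by
    rw [← Fintype.card_subtype, Fintype.card_congr (e.subtypeEquiv (q := fun y => y.1 = j)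
      fun x => Iff.rfl), Fintype.card_congr (Equiv.sigmaSubtype j), Fintype.card_fin]
  have hstab : #{τ : Equiv.Perm α | g ∘ τ = g} = ∏ j, (a j)! := by
    rw [← Fintype.card_subtype, DomMulAct.stabilizer_card]
    simp_rw [Fintype.card_subtype, hg]
  rw [← Fintype.card_perm, ← Finset.card_univ, mul_comm]
  refine card_le_mul_card_image_of_maps_to (f := fun τ : Equiv.Perm α => g ∘ τ) ?_ _ ?_
  · intro τ _
    simp only [mem_filter, mem_univ, true_and]
    intro j
    rw [← hg j]
    exact card_equiv τ (by simp)
  · intro f _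
    rcases eq_empty_or_nonempty (univ.filter fun τ : Equiv.Perm α => g ∘ τ = f) with h | ⟨τ, hτ⟩
    · simp [h]
    · simp only [mem_filter, mem_univ, true_and] at hτ
      rw [← hstab]
      refine card_le_card_of_injOn (fun ρ : Equiv.Perm α => τ⁻¹.trans ρ) ?_ ?_
      · intro ρ hρ
        simp only [mem_univ, true_and, coe_filter, Set.mem_ofPred_eq] at hρ ⊢
        rw [← hτ] at hρ
        funext x
        simpa using congrFun hρ (τ⁻¹ x)
      · intro ρ _ ρ' _ h
        ext x
        simpa using congrArg (fun π => π (τ x)) h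

open Finset in
open scoped Nat in
/-- A lower bound for the number of functions to `Fin k` with balanced fibres. -/
theorem choose_mul_factorial_le_card_balanced {α : Type*} [Fintype α] [DecidableEq α]
    {k : ℕ} (hk : 0 < k) :
    k.choose (Fintype.card α % k) * (Fintype.card α)! ≤
      #{f : α → Fin k | ∀ j, #{x | f x = j} = Fintype.card α / k ∨
        #{x | f x = j} = (Fintype.card α + k - 1) / k} *
      ((Fintype.card α / k)! ^ k * (Fintype.card α / k + 1) ^ (Fintype.card α % k)) := by
  set r := Fintype.card α with hr
  set q := r / k with hq
  set s := r % k with hs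
  have hqs : k * q + s = r := Nat.div_add_mod r k
  have hsk : s < k := Nat.mod_lt _ hk
  let F : Finset (Fin k) → Finset (α → Fin k) := fun T =>
    {f | ∀ j, #{x | f x = j} = q + if j ∈ T then 1 else 0}
  have hF : ∀ T ∈ powersetCard s (univ : Finset (Fin k)),
      r ! ≤ #(F T) * (q ! ^ k * (q + 1) ^ s) := by
    intro T hT
    have hT' : #T = s := (mem_powersetCard.1 hT).2
    have hprod : ∏ j : Fin k, (q + if j ∈ T then 1 else 0)! = q ! ^ k * (q + 1) ^ s := by
      have h : ∀ j : Fin k, (q + if j ∈ T then 1 else 0)! = q ! * if j ∈ T then q + 1 else 1 := by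
        intro j
        split_ifs
        · rw [Nat.factorial_succ, mul_comm]
        · simp
      rw [prod_congr rfl fun j _ => h j, prod_mul_distrib]
      simp [hT']
    rw [← hprod]
    have hsum : ∑ j : Fin k, (q + if j ∈ T then 1 else 0) = Fintype.card α := by
      simp [sum_add_distrib, hT', hqs, ← hr]
    convert factorial_le_card_fiber_profile_mul_prod (α := α) _ hsum
  have hdisj : (powersetCard s (univ : Finset (Fin k)) : Set (Finset (Fin k))).PairwiseDisjoint F := by
    intro T _ T' _ hne
    refine Finset.disjoint_left.2 fun f hf hf' => hne ?_
    simp only [F, mem_filter, mem_univ, true_and] at hf hf'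
    ext j
    have h := (hf j).symm.trans (hf' j)
    by_cases h1 : j ∈ T <;> by_cases h2 : j ∈ T' <;> simp_all
  have hsub : (powersetCard s univ).biUnion F ⊆ ({f : α → Fin k | ∀ j, #{x | f x = j} = q ∨
      #{x | f x = j} = (r + k - 1) / k} : Finset (α → Fin k)) := by
    intro f hf
    obtain ⟨T, hT, hf⟩ := mem_biUnion.1 hf
    simp only [F, mem_filter, mem_univ, true_and] at hf ⊢
    intro j
    rw [hf j]
    split_ifs with hj
    · right
      have hs0 : 0 < s := (mem_powersetCard.1 hT).2 ▸ card_pos.2 ⟨j, hj⟩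
      have h : r + k - 1 = (s - 1) + k * (q + 1) := by
        rw [← hqs, mul_add]; omega
      rw [h, Nat.add_mul_div_left _ _ hk, Nat.div_eq_of_lt (by omega)]
      omega
    · left; simp
  calc k.choose s * r ! = ∑ _T ∈ powersetCard s (univ : Finset (Fin k)), r ! := by simp
    _ ≤ ∑ T ∈ powersetCard s (univ : Finset (Fin k)), #(F T) * (q ! ^ k * (q + 1) ^ s) :=
      sum_le_sum hF
    _ = #((powersetCard s univ).biUnion F) * (q ! ^ k * (q + 1) ^ s) := by
      rw [← sum_mul, card_biUnion hdisj]
    _ ≤ _ := Nat.mul_le_mul_right _ (card_le_card hsub)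

open Finset in
/-- A property of the restriction to `S` has the same density among functions on `Fin n` as
among functions on `S`. -/
theorem card_restrict_mul {n r k : ℕ} (S : Finset (Fin n)) (P : (S → Fin k) → Prop)
    [DecidablePred P] (hS : #S = r) :
    #{h : Fin n → Fin k | P fun x => h x} * k ^ r = #{f | P f} * k ^ n := by
  have h1 : #{h : Fin n → Fin k | P fun x => h x} = #{f | P f} * k ^ (n - r) := by
    let e := Equiv.piEquivPiSubtypeProd (fun x => x ∈ S) (fun _ : Fin n => Fin k)
    have h2 : #{h : Fin n → Fin k | P fun x => h x} =
        #(({f | P f} : Finset (S → Fin k)) ×ˢ (univ : Finset ({x // x ∉ S} → Fin k))) :=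
      card_equiv e (by intro h; simp [e])
    rw [h2, card_product, Finset.card_univ]
    simp [Fintype.card_subtype_compl, hS]
  have hr : r ≤ n := by simpa [hS] using card_le_univ S
  rw [h1, mul_assoc, ← pow_add, Nat.sub_add_cancel hr]
section

open Real
open scoped Nat

/-- The logarithm of Robbins' upper bound for `x!`, as a function of a real variable. -/
noncomputable def robbins (x : ℝ) : ℝ := x * log x - x + log (2 * π * x) / 2 + 1 / (12 * x)

/-- Robbins' upper bound in Stirling's formula. -/
theorem log_factorial_le_robbins {n : ℕ} (hn : n ≠ 0) : log n ! ≤ robbins n := by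
  unfold robbins
  obtain ⟨n, rfl⟩ := Nat.exists_eq_succ_of_ne_zero hn
  have hmono : Monotone fun m : ℕ => log (Stirling.stirlingSeq (m + 1)) - 1 / (12 * ((m : ℝ) + 1)) := by
    refine monotone_nat_of_le_succ fun m => ?_
    have h := Stirling.log_stirlingSeq_sdiff_le (m + 1)
    have e : (1 : ℝ) / (12 * ((m : ℝ) + 1)) - 1 / (12 * (((m + 1 : ℕ) : ℝ) + 1)) =
      1 / (12 * (m + 1) * (m + 2)) := by
      push_cast; field_simp; ring
    have e' : (1 : ℝ) / (12 * ((m + 1 : ℕ) : ℝ) * (((m + 1 : ℕ) : ℝ) + 1)) =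
      1 / (12 * (m + 1) * (m + 2)) := by
      push_cast; ring
    linarith
  have htend : Filter.Tendsto
      (fun m : ℕ => log (Stirling.stirlingSeq (m + 1)) - 1 / (12 * ((m : ℝ) + 1))) Filter.atTop
      (nhds (log √π - 0)) := by
    refine Filter.Tendsto.sub ?_ ?_
    · exact ((Stirling.tendsto_stirlingSeq_sqrt_pi.comp (Filter.tendsto_add_atTop_nat 1)).log
        (by positivity))
    · have := (tendsto_one_div_add_atTop_nhds_zero_nat (𝕜 := ℝ)).const_mul (1 / 12)
      simpa [mul_comm] using this
  have h := hmono.ge_of_tendsto htend n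
  rw [Stirling.log_stirlingSeq_formula, log_sqrt (by positivity), log_div (by positivity) (by positivity), log_exp,
    log_mul (by positivity) (by positivity)] at h
  rw [log_mul (by positivity) (by positivity), log_mul (by positivity) (by positivity)]
  push_cast [Nat.succ_eq_add_one] at h ⊢
  linarith

theorem log_factorial_le_weak (n : ℕ) :
    log n ! ≤ n * log n - n + log n + 2 := by
  rcases eq_or_ne n 0 with rfl | hn
  · simp
  have h := log_factorial_le_robbins hn
  unfold robbins at h
  have h1 : (1 : ℝ) ≤ n := by exact_mod_cast Nat.one_le_iff_ne_zero.2 hn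
  have h2 : (1 : ℝ) / (12 * n) ≤ 1 / 12 := by gcongr; linarith
  have h3 : log (2 * π) ≤ 2 := by
    rw [log_le_iff_le_exp (by positivity)]
    have := exp_one_gt_d9
    have h4 : exp 2 = exp 1 * exp 1 := by rw [← exp_add]; norm_num
    nlinarith [pi_lt_d2]
  rw [log_mul (by positivity) (by positivity)] at h
  have := log_nonneg h1
  linarith

theorem le_log_factorial_weak (n : ℕ) : n * log n - n ≤ log n ! := by
  rcases eq_or_ne n 0 with rfl | hn
  · simp
  have h := Stirling.le_log_factorial_stirling hn
  have h1 : (1 : ℝ) ≤ n := by exact_mod_cast Nat.one_le_iff_ne_zero.2 hn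
  have := log_nonneg h1
  have : 0 ≤ log (2 * π) := log_nonneg (by nlinarith [pi_gt_three])
  linarith

theorem le_log_choose {k s : ℕ} (hs : s ≤ k) :
    k * log k - s * log s - (k - s) * log (k - s) - 2 * log k - 4 ≤ log (k.choose s) := by
  have h0 : log (k.choose s) = log k ! - log s ! - log (k - s)! := by
    rw [← Nat.choose_mul_factorial_mul_factorial hs]
    have := Nat.choose_pos hs
    push_cast
    rw [log_mul (by positivity) (by positivity), log_mul (by positivity) (by positivity)]
    ring
  have h1 := le_log_factorial_weak k
  have h2 := log_factorial_le_weak s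
  have h3 := log_factorial_le_weak (k - s)
  have hl : ∀ m : ℕ, m ≤ k → log m ≤ log k := fun m hm => by
    rcases eq_or_ne m 0 with rfl | h
    · simpa using log_natCast_nonneg k
    · exact log_le_log (by positivity) (by exact_mod_cast hm)
  have h4 := hl s hs
  have h5 := hl (k - s) (by omega)
  rw [Nat.cast_sub hs] at h3 h5
  linarith

/-- The binary entropy dominates `2θ(1-θ)`. -/
theorem entropy_lower {k s : ℝ} (hs : 0 ≤ s) (hk : s < k) :
    2 * (s * (k - s) / k) ≤ k * log k - s * log s - (k - s) * log (k - s) := by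
  have hk0 : 0 < k := by linarith
  have h1 : s * (k - s) / k ≤ s * (log k - log s) := by
    rcases hs.eq_or_lt with rfl | hs
    · simp
    have := log_le_sub_one_of_pos (div_pos hs hk0)
    rw [log_div hs.ne' hk0.ne'] at this
    have h : s * (k - s) / k = s * (1 - s / k) := by field_simp
    rw [h]; exact mul_le_mul_of_nonneg_left (by linarith) hs.le
  have h2 : s * (k - s) / k ≤ (k - s) * (log k - log (k - s)) := by
    have := log_le_sub_one_of_pos (div_pos (sub_pos.2 hk) hk0)
    rw [log_div (by linarith) hk0.ne'] at this
    have h : s * (k - s) / k = (k - s) * (1 - (k - s) / k) := by field_simp; ring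
    rw [h]; exact mul_le_mul_of_nonneg_left (by linarith) (by linarith)
  linarith

/-- A chord of `robbins` over a unit interval exceeds the function by at most `2θ(1-θ)`. -/
theorem robbins_chord {q θ : ℝ} (hq : 1 ≤ q) (h0 : 0 ≤ θ) (h1 : θ ≤ 1) :
    (1 - θ) * robbins q + θ * robbins (q + 1) ≤ robbins (q + θ) + 2 * (θ * (1 - θ)) := by
  have hx : 0 < q + θ := by linarith
  have hq0 : 0 < q := by linarith
  have l1 : log q ≤ log (q + θ) - θ / (q + θ) := by
    have := log_le_sub_one_of_pos (div_pos hq0 hx)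
    rw [log_div hq0.ne' hx.ne'] at this
    have e : q / (q + θ) - 1 = - (θ / (q + θ)) := by field_simp; ring
    linarith
  have l2 : log (q + 1) ≤ log (q + θ) + (1 - θ) / (q + θ) := by
    have := log_le_sub_one_of_pos (div_pos (by linarith : 0 < q + 1) hx)
    rw [log_div (by linarith) hx.ne'] at this
    have e : (q + 1) / (q + θ) - 1 = (1 - θ) / (q + θ) := by field_simp; ring
    linarith
  have l3 : (1 - θ) * log q + θ * log (q + 1) ≤ log (q + θ) := by
    have := add_le_add (mul_le_mul_of_nonneg_left l1 (sub_nonneg.2 h1))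
      (mul_le_mul_of_nonneg_left l2 h0)
    refine this.trans (le_of_eq ?_)
    field_simp; ring
  have hnn : 0 ≤ θ * (1 - θ) := mul_nonneg h0 (sub_nonneg.2 h1)
  have l4 : (1 - θ) * (q * log q) + θ * ((q + 1) * log (q + 1)) ≤
      (q + θ) * log (q + θ) + θ * (1 - θ) := by
    have := add_le_add (mul_le_mul_of_nonneg_left l1 (mul_nonneg (sub_nonneg.2 h1) hq0.le))
      (mul_le_mul_of_nonneg_left l2 (mul_nonneg h0 (by linarith : 0 ≤ q + 1)))
    have e : (1 - θ) * q * (log (q + θ) - θ / (q + θ)) +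
        θ * (q + 1) * (log (q + θ) + (1 - θ) / (q + θ)) =
        (q + θ) * log (q + θ) + θ * (1 - θ) / (q + θ) := by field_simp; ring
    have : θ * (1 - θ) / (q + θ) ≤ θ * (1 - θ) := div_le_self hnn (by linarith)
    linarith
  have l5 : (1 - θ) * (1 / (12 * q)) + θ * (1 / (12 * (q + 1))) ≤
      1 / (12 * (q + θ)) + θ * (1 - θ) := by
    have e : (1 - θ) * (1 / (12 * q)) + θ * (1 / (12 * (q + 1))) =
        1 / (12 * (q + θ)) + θ * (1 - θ) / (12 * (q * (q + 1) * (q + θ))) := by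
      field_simp; ring
    have hb : 1 ≤ q * (q + 1) := by nlinarith
    have : θ * (1 - θ) / (12 * (q * (q + 1) * (q + θ))) ≤ θ * (1 - θ) :=
      div_le_self hnn (by nlinarith)
    linarith
  have hl : ∀ y : ℝ, 0 < y → log (2 * π * y) = log (2 * π) + log y := fun y hy =>
    log_mul (by positivity) hy.ne'
  unfold robbins
  rw [hl _ hx, hl _ hq0, hl _ (by linarith)]
  linarith

theorem sigmaRK_pos {r k : ℕ} (hr : 0 < r) (hk : 0 < k) : 0 < sigmaRK r k := by
  unfold sigmaRK; positivity

theorem log_sigmaRK {r k : ℕ} (hr : 0 < r) (hk : 0 < k) :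
    log (sigmaRK r k) =
      k * (robbins ((r : ℝ) / k)) - r * (log r - log k) + r := by
  unfold sigmaRK robbins
  rw [log_mul (by positivity) (by positivity), log_exp, log_rpow (by positivity),
    log_div (x := (r : ℝ)) (by positivity) (by positivity), ← mul_div_assoc]
  field_simp
  ring

/-- The reciprocal of the probability that a uniformly random function splits an `r`-set evenly is
at most `e⁴k²σ(r,k)`. -/
theorem balanced_denominator_le {r k : ℕ} (hk : 0 < k) (hkr : k ≤ r) :
    (((r / k)! ^ k * (r / k + 1) ^ (r % k) * k ^ r : ℕ) : ℝ) ≤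
      exp 4 * k ^ 2 * sigmaRK r k * ((k.choose (r % k) * r ! : ℕ) : ℝ) := by
  have hr : 0 < r := by omega
  have hσ := sigmaRK_pos hr hk
  set q := r / k with hq
  set s := r % k with hs
  have hqs : k * q + s = r := Nat.div_add_mod r k
  have hsk : s < k := Nat.mod_lt _ hk
  have hq1 : 1 ≤ q := (Nat.one_le_div_iff hk).2 hkr
  have hC := Nat.choose_pos hsk.le
  have hk' : (0 : ℝ) < k := by exact_mod_cast hk
  have hsk' : (s : ℝ) < k := by exact_mod_cast hsk
  push_cast
  rw [← log_le_log_iff (by positivity) (by positivity)]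
  rw [log_mul (by positivity) (by positivity), log_mul (by positivity) (by positivity),
    log_mul (by positivity) (by positivity), log_mul (by positivity) (by positivity),
    log_mul (by positivity) (by positivity), log_mul (by positivity) (by positivity),
    log_pow, log_pow, log_pow, log_pow, log_exp, log_sigmaRK hr hk]
  have hfac : log ((q + 1)! : ℕ) = log q ! + log ((q : ℝ) + 1) := by
    rw [Nat.factorial_succ]
    push_cast
    rw [log_mul (by positivity) (by positivity), add_comm]
  have h1 := log_factorial_le_robbins (n := q) (by omega)
  have h2 := log_factorial_le_robbins (n := q + 1) (by omega)
  have h3 := robbins_chord (q := q) (θ := s / k) (by exact_mod_cast hq1) (by positivity)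
    ((div_le_one hk').2 hsk'.le)
  have h4 := entropy_lower (k := k) (s := s) (by positivity) hsk'
  have h5 := le_log_choose hsk.le
  have h6 := le_log_factorial_weak r
  have hx : (q : ℝ) + s / k = r / k := by
    rw [← hqs]; push_cast; field_simp
  rw [hx] at h3
  have h3' := mul_le_mul_of_nonneg_left h3 hk'.le
  have e1 : (k : ℝ) * ((1 - s / k) * robbins q + s / k * robbins (q + 1)) =
      (k - s) * robbins q + s * robbins (q + 1) := by field_simp
  have e2 : (k : ℝ) * (robbins (r / k) + 2 * (s / k * (1 - s / k))) =
      k * robbins (r / k) + 2 * (s * (k - s) / k) := by field_simp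
  rw [e1, e2] at h3'
  rw [hfac] at h2
  push_cast at h2 ⊢
  have h7 := mul_le_mul_of_nonneg_left h1 (sub_nonneg.2 hsk'.le)
  have h8 := mul_le_mul_of_nonneg_left h2 (Nat.cast_nonneg (α := ℝ) s)
  linarith

/-- A random family of functions gives a splitter. -/
theorem exists_splitter_card_le {r k n : ℕ} (hk : 0 < k) (hkr : k ≤ r) (hr : 3 ≤ r) (hrn : r ≤ n) :
    ∃ H : Finset (Fin n → Fin k), IsSplitter n r k H ∧
      (H.card : ℝ) ≤ 2 * (r * log n) * (exp 4 * k ^ 2 * sigmaRK r k) := by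
  classical
  set N := k.choose (r % k) * r ! with hN
  set W := (r / k)! ^ k * (r / k + 1) ^ (r % k) with hW
  have hNpos : 0 < N := Nat.mul_pos (Nat.choose_pos (Nat.mod_lt _ hk).le) r.factorial_pos
  have hWpos : 0 < W := by positivity
  have : Nonempty (Fin k) := ⟨⟨0, hk⟩⟩
  let R : (Fin n → Fin k) → Finset (Fin n) → Prop := fun h S => ∀ j : Fin k,
    (S.filter fun i => h i = j).card = r / k ∨
    (S.filter fun i => h i = j).card = (r + k - 1) / k
  have hgood : ∀ S : Finset (Fin n), S.card = r →
      N * k ^ n ≤ (Finset.univ.filter fun h => R h S).card * (W * k ^ r) := by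
    intro S hS
    have h1 := choose_mul_factorial_le_card_balanced (α := S) hk
    simp only [Fintype.card_coe, hS] at h1
    have h2 := card_restrict_mul (k := k) S (fun f => ∀ j,
      (Finset.univ.filter fun x => f x = j).card = r / k ∨
      (Finset.univ.filter fun x => f x = j).card = (r + k - 1) / k) hS
    have h3 : ∀ (h : Fin n → Fin k) (j : Fin k),
        (Finset.univ.filter fun x : S => h x = j).card = (S.filter fun i => h i = j).card := by
      intro h j
      rw [Finset.univ_eq_attach, Finset.filter_attach (fun i => h i = j), Finset.card_map,
        Finset.card_attach]
    simp only [h3] at h2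
    calc N * k ^ n ≤ _ * W * k ^ n := Nat.mul_le_mul_right _ h1
      _ = (_ * k ^ n) * W := by ring
      _ = _ := by rw [← h2]; ring
  have hDpos : 0 < W * k ^ r := by positivity
  set p : ℝ := (N : ℝ) / ((W * k ^ r : ℕ) : ℝ) with hp
  have hp0 : 0 < p := by positivity
  have hcardA : Fintype.card (Fin n → Fin k) = k ^ n := by simp
  have hU : ∀ S ∈ Finset.powersetCard r (Finset.univ : Finset (Fin n)),
      p * Fintype.card (Fin n → Fin k) ≤ (Finset.univ.filter fun h => R h S).card := by
    intro S hS
    have h := hgood S (Finset.mem_powersetCard.1 hS).2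
    rw [hcardA, hp, div_mul_eq_mul_div, div_le_iff₀ (by positivity)]
    exact_mod_cast h
  have hp1 : p ≤ 1 := by
    obtain ⟨S, hS⟩ := Finset.powersetCard_nonempty.2
      (show r ≤ (Finset.univ : Finset (Fin n)).card by simpa using hrn)
    have h1 := hU S hS
    have h2 : ((Finset.univ.filter fun h => R h S).card : ℝ) ≤ Fintype.card (Fin n → Fin k) := by
      exact_mod_cast Finset.card_le_univ _
    have h3 : (0 : ℝ) < Fintype.card (Fin n → Fin k) := by
      exact_mod_cast Fintype.card_pos
    exact le_of_mul_le_mul_right (by linarith) h3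
  have hinv : 1 / p ≤ exp 4 * k ^ 2 * sigmaRK r k := by
    rw [hp, one_div_div, div_le_iff₀ (by positivity)]
    exact balanced_denominator_le hk hkr
  have hn : (3 : ℝ) ≤ n := by exact_mod_cast hr.trans hrn
  have hr' : (3 : ℝ) ≤ r := by exact_mod_cast hr
  have hlog : 1 ≤ log n := by
    rw [le_log_iff_exp_le (by linarith)]
    linarith [exp_one_lt_d9]
  have hrl : 1 ≤ r * log n := by nlinarith
  obtain ⟨H, hH, hle⟩ := exists_cover R hp1 _ hU (⌊r * log n / p⌋₊ + 1)
  refine ⟨H, ?_, ?_⟩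
  · set m := ⌊r * log n / p⌋₊ + 1 with hm
    have hmp : r * log n < m * p := by
      rw [← div_lt_iff₀ hp0, hm]
      push_cast
      exact Nat.lt_floor_add_one _
    have hlt : (1 - p) ^ m * ((Finset.powersetCard r (Finset.univ : Finset (Fin n))).card : ℝ) < 1 := by
      have h1 : (1 - p) ^ m ≤ exp (-(m * p)) := by
        have := pow_le_pow_left₀ (by linarith) (one_sub_le_exp_neg p) m
        rwa [← exp_nat_mul, mul_neg] at this
      have h2 : ((Finset.powersetCard r (Finset.univ : Finset (Fin n))).card : ℝ) ≤
          exp (r * log n) := by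
        rw [exp_nat_mul, exp_log (by linarith), Finset.card_powersetCard, Finset.card_fin]
        exact_mod_cast Nat.choose_le_pow n r
      calc _ ≤ exp (-(m * p)) * exp (r * log n) := by gcongr
        _ = exp (r * log n - m * p) := by rw [← exp_add]; ring_nf
        _ < 1 := exp_lt_one_iff.2 (by linarith)
    have hzero := hle.trans_lt hlt
    rw [Nat.cast_lt_one, Finset.card_eq_zero] at hzero
    intro S hS
    by_contra hcon
    refine Finset.notMem_empty S (hzero ▸ Finset.mem_filter.2 ⟨?_, ?_⟩)
    · exact Finset.mem_powersetCard.2 ⟨Finset.subset_univ _, hS⟩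
    · exact fun a ha hR => hcon ⟨a, ha, hR⟩
  · have h1 : (H.card : ℝ) ≤ ⌊r * log n / p⌋₊ + 1 := by exact_mod_cast hH
    have h2 := Nat.floor_le (show 0 ≤ r * log n / p by positivity)
    have h3 : 1 ≤ r * log n / p := by
      rw [one_le_div hp0]; linarith
    calc (H.card : ℝ) ≤ 2 * (r * log n) * (1 / p) := by
          rw [mul_one_div, mul_div_assoc]; linarith
      _ ≤ _ := by gcongr

theorem eight_le_exponent {r k : ℕ} (hk : 2 ≤ k) (hkr : k ≤ r) :
    8 ≤ 16 * r * logb 2 k / (k * logb 2 (4 * r / k)) := by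
  have hk' : (2 : ℝ) ≤ k := by exact_mod_cast hk
  have hkr' : (k : ℝ) ≤ r := by exact_mod_cast hkr
  have hx : 1 ≤ (r : ℝ) / k := (one_le_div (by linarith)).2 hkr'
  have hlog2 := log_two_gt_d9
  have hle : logb 2 (4 * r / k) ≤ 2 * (r / k) := by
    rw [logb, div_le_iff₀ (by linarith), mul_div_assoc, log_mul (by norm_num) (by linarith)]
    have h4 : log 4 = 2 * log 2 := by
      rw [← log_rpow (by norm_num)]; norm_num
    have := log_le_sub_one_of_pos (show 0 < (r : ℝ) / k by linarith)
    nlinarith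
  have hpos : 0 < logb 2 (4 * r / k) := by
    refine logb_pos (by norm_num) ?_
    rw [mul_div_assoc]; linarith
  have hlk : 1 ≤ logb 2 k := by
    rw [le_logb_iff_rpow_le (by norm_num) (by linarith)]; simpa using hk'
  rw [le_div_iff₀ (by positivity)]
  have h1 : k * logb 2 (4 * r / k) ≤ 2 * r := by
    calc k * logb 2 (4 * r / k) ≤ k * (2 * (r / k)) := by gcongr
      _ = 2 * r := by field_simp
  nlinarith

end

/-- There are constants `C > 0` and `r₀` such that for all `r ≥ r₀`, all
`√r ≤ k ≤ r` and all `n ≥ r`, with `z := 16r·log₂ k/(k·log₂(4r/k))`, there is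
an `(n,r,k)`-splitter of size at most `r^{Cz} · σ(r,k) · log₂ n`. -/
theorem splitter_exists_linear_time :
    ∃ C : ℝ, 0 < C ∧ ∃ r₀ : ℕ, ∀ r k n : ℕ, r₀ ≤ r →
      Real.sqrt r ≤ (k : ℝ) → k ≤ r → r ≤ n →
      ∃ H : Finset (Fin n → Fin k), IsSplitter n r k H ∧
        (H.card : ℝ) ≤
          (r : ℝ) ^ (C * (16 * r * Real.logb 2 k / (k * Real.logb 2 (4 * r / k)))) *
            sigmaRK r k * Real.logb 2 n := by
  refine ⟨1, one_pos, 4, fun r k n hr hsq hkr hrn => ?_⟩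
  have hr' : (4 : ℝ) ≤ r := by exact_mod_cast hr
  have hk2 : (2 : ℝ) ≤ k := le_trans (Real.le_sqrt_of_sq_le (by linarith)) hsq
  have hk : 2 ≤ k := by exact_mod_cast hk2
  have hkr' : (k : ℝ) ≤ r := by exact_mod_cast hkr
  obtain ⟨H, hH, hcard⟩ := exists_splitter_card_le (by omega) hkr (by omega) hrn
  refine ⟨H, hH, hcard.trans ?_⟩
  have hσ := sigmaRK_pos (r := r) (k := k) (by omega) (by omega)
  have hn : (4 : ℝ) ≤ n := by exact_mod_cast hr.trans hrn
  have hlog : Real.log n ≤ Real.logb 2 n := by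
    rw [Real.logb, le_div_iff₀ (Real.log_pos (by norm_num))]
    exact mul_le_of_le_one_right (Real.log_nonneg (by linarith)) (by linarith [Real.log_two_lt_d9])
  have hexp : 2 * Real.exp 4 ≤ (r : ℝ) ^ 4 := by
    have h : Real.exp 4 = Real.exp 1 ^ 4 := by rw [← Real.exp_nat_mul]; norm_num
    calc 2 * Real.exp 4 ≤ 2 * 3 ^ 4 := by
          rw [h]; gcongr; linarith [Real.exp_one_lt_d9]
      _ ≤ 4 ^ 4 := by norm_num
      _ ≤ (r : ℝ) ^ 4 := by gcongr
  have hpow : (r : ℝ) ^ 7 ≤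
      (r : ℝ) ^ (1 * (16 * r * Real.logb 2 k / (k * Real.logb 2 (4 * r / k)))) := by
    rw [← Real.rpow_natCast]
    refine Real.rpow_le_rpow_of_exponent_le (by linarith) ?_
    have := eight_le_exponent hk hkr
    push_cast
    linarith
  have hlogn : 0 ≤ Real.logb 2 n := Real.logb_nonneg (by norm_num) (by linarith)
  calc 2 * (r * Real.log n) * (Real.exp 4 * k ^ 2 * sigmaRK r k)
      = 2 * Real.exp 4 * r * k ^ 2 * sigmaRK r k * Real.log n := by ring
    _ ≤ (r : ℝ) ^ 4 * r * r ^ 2 * sigmaRK r k * Real.logb 2 n := by gcongr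
    _ = (r : ℝ) ^ 7 * sigmaRK r k * Real.logb 2 n := by ring
    _ ≤ _ := by gcongr
end

section
/- There exists r₀ such that for every integer r ≥ r₀ the function z(k) := 16·r·log₂ k / (k·log₂(4r/k)) is monotonically decreasing in k on the real interval [√r, r], and for every k ∈ [√r, r] one has 8·log₂ r ≤ z(k) ≤ 16·√r. -/
/-- The quotient `t / (k * (A - t))` with `t = log k` decreases from `a` to `b` as soon as `log a`
is large and `A - log b` is bounded away from `1`. -/
lemma log_div_mul_sub_log_le {A a b : ℝ} (ha : 0 < a) (hab : a ≤ b) (hs : 4 ≤ Real.log a)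
    (hu : 1.38 ≤ A - Real.log b) :
    Real.log b / (b * (A - Real.log b)) ≤ Real.log a / (a * (A - Real.log a)) := by
  have hb : 0 < b := ha.trans_le hab
  have hst : Real.log a ≤ Real.log b := Real.log_le_log ha hab
  have hexp := Real.quadratic_le_exp_of_nonneg (sub_nonneg.2 hst)
  rw [Real.exp_sub, Real.exp_log hb, Real.exp_log ha, le_div_iff₀ ha] at hexp
  rw [div_le_div_iff₀ (by nlinarith) (by nlinarith)]
  generalize Real.log a = s at *
  generalize Real.log b = t at *
  obtain ⟨d, rfl⟩ : ∃ d, t = s + d := ⟨t - s, by ring⟩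
  obtain ⟨u, rfl⟩ : ∃ u, A = u + (s + d) := ⟨A - (s + d), by ring⟩
  simp only [add_sub_cancel_left, add_sub_cancel_right] at *
  have hd : 0 ≤ d := by linarith
  have hsu : s + u ≤ s * u := by nlinarith
  have hmain : s + d + u ≤ s * u * (1 + d / 2) := by nlinarith
  have hquad : (s + d) * (u + d) ≤ s * u * (1 + d + d ^ 2 / 2) := by
    nlinarith [mul_le_mul_of_nonneg_left hmain hd]
  calc (s + d) * (a * (u + (s + d) - s)) = (s + d) * (u + d) * a := by ring
    _ ≤ s * u * (1 + d + d ^ 2 / 2) * a := by gcongr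
    _ = s * u * ((1 + d + d ^ 2 / 2) * a) := by ring
    _ ≤ s * u * b := by gcongr
    _ = s * (b * u) := by ring

lemma mul_logb_div_eq {b r k : ℝ} (hb : Real.log b ≠ 0) (hr : 0 < r) (hk : 0 < k) :
    16 * r * Real.logb b k / (k * Real.logb b (4 * r / k)) =
      16 * r * (Real.log k / (k * (Real.log (4 * r) - Real.log k))) := by
  rw [← Real.log_div (by positivity) hk.ne', Real.logb, Real.logb, mul_div_assoc', mul_div_assoc',
    mul_div_assoc', div_div_div_cancel_right₀ hb]


/-- For all sufficiently large `r`, the function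
`z(k) = 16r·log₂ k/(k·log₂(4r/k))` is monotonically decreasing on `[√r, r]`,
and satisfies `8·log₂ r ≤ z(k) ≤ 16·√r` there. -/
theorem z_monotone_and_bounds :
    ∃ r₀ : ℕ, ∀ r : ℕ, r₀ ≤ r →
      AntitoneOn (fun k : ℝ => 16 * r * Real.logb 2 k / (k * Real.logb 2 (4 * r / k)))
        (Set.Icc (Real.sqrt r) (r : ℝ)) ∧
      ∀ k ∈ Set.Icc (Real.sqrt r) (r : ℝ),
        8 * Real.logb 2 r ≤ 16 * r * Real.logb 2 k / (k * Real.logb 2 (4 * r / k)) ∧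
        16 * r * Real.logb 2 k / (k * Real.logb 2 (4 * r / k)) ≤ 16 * Real.sqrt r := by
  refine ⟨⌈Real.exp 8⌉₊, fun r hr₀ => ?_⟩
  have hexp : Real.exp 8 ≤ r := (Nat.le_ceil _).trans (by exact_mod_cast hr₀)
  have hr : (0 : ℝ) < r := (Real.exp_pos 8).trans_le hexp
  have hlog : 8 ≤ Real.log r := (Real.le_log_iff_exp_le hr).2 hexp
  have hr1 : (1 : ℝ) ≤ r := (Real.one_le_exp (by norm_num)).trans hexp
  have hsqrt : 0 < Real.sqrt r := Real.sqrt_pos.2 hr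
  have hlog4 : Real.log 4 = 2 * Real.log 2 := by
    rw [show (4 : ℝ) = 2 ^ 2 by norm_num, Real.log_pow]
    ring
  have hlog2 := Real.log_two_gt_d9
  have hlog4r : Real.log (4 * r) = Real.log 4 + Real.log r :=
    Real.log_mul (by norm_num) hr.ne'
  have hlogsqrt : Real.log (Real.sqrt r) = Real.log r / 2 := Real.log_sqrt hr.le
  have hle : Real.sqrt r ≤ r := Real.sqrt_le_iff.2 ⟨hr.le, by nlinarith⟩
  have hanti : AntitoneOn
      (fun k : ℝ => 16 * r * Real.logb 2 k / (k * Real.logb 2 (4 * r / k)))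
      (Set.Icc (Real.sqrt r) (r : ℝ)) := by
    rintro a ⟨ha, _⟩ b ⟨hb, hbr⟩ hab
    have ha0 := hsqrt.trans_le ha
    have hb0 := hsqrt.trans_le hb
    have hla := Real.log_le_log hsqrt ha
    have hlb := Real.log_le_log hb0 hbr
    simp only [mul_logb_div_eq (Real.log_pos one_lt_two).ne' hr ha0,
      mul_logb_div_eq (Real.log_pos one_lt_two).ne' hr hb0]
    gcongr 16 * r * ?_
    exact log_div_mul_sub_log_le ha0 hab (by linarith) (by linarith)
  refine ⟨hanti, fun k hk => ⟨?_, ?_⟩⟩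
  · refine le_trans (le_of_eq ?_) (hanti hk ⟨hle, le_rfl⟩ hk.2)
    have : Real.logb 2 4 = 2 := by
      rw [Real.logb, hlog4, mul_div_cancel_right₀ _ (by linarith)]
    simp only [mul_div_cancel_right₀ _ hr.ne', this]
    field_simp
    ring
  · refine (hanti ⟨le_rfl, hle⟩ hk hk.1).trans ?_
    simp only [mul_logb_div_eq (Real.log_pos one_lt_two).ne' hr hsqrt]
    rw [hlogsqrt, hlog4r, mul_div_assoc', div_le_iff₀ (mul_pos hsqrt (by linarith))]
    calc 16 * r * (Real.log r / 2)
        ≤ 16 * r * (Real.log 4 + Real.log r - Real.log r / 2) := by gcongr; linarith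
      _ = 16 * (Real.sqrt r * Real.sqrt r) * (Real.log 4 + Real.log r - Real.log r / 2) := by
        rw [Real.mul_self_sqrt hr.le]
      _ = _ := by ring
end

section
/- Let k : ℕ → ℕ be any function with k(r) ≤ r for all r and k(r)/√r → ∞ as r → ∞, and suppose z(r) := 16·r·log₂ k(r) / (k(r)·log₂(4r/k(r))) satisfies z(r) > 8 for all large r. Then lim_{r→∞} [ √(r/z(r)) · σ(r/z(r), k(r)/z(r)) · (r/z(r))^{4r/z(r)} · log₂(r/z(r)) ] / σ(r, k(r)) = 0, where σ(x,y) := (2πx/y)^{y/2} · e^{y²/(12x)} for positive reals x, y. -/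
/-- `σ(x,y) = (2πx/y)^{y/2} · e^{y²/(12x)}` for positive reals. -/
noncomputable def sigmaXY (x y : ℝ) : ℝ :=
  (2 * Real.pi * x / y) ^ (y / 2) * Real.exp (y ^ 2 / (12 * x))

open Real in
theorem sigmaXY_eq_exp {x y : ℝ} (hx : 0 < x) (hy : 0 < y) :
    sigmaXY x y = exp (y / 2 * log (2 * π * (x / y)) + y ^ 2 / (12 * x)) := by
  have h : 0 < 2 * π * x / y := by positivity
  rw [sigmaXY, rpow_def_of_pos h, ← exp_add, mul_div_assoc, mul_comm (log _)]

open Real in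
theorem sigmaXY_div_div {x y z : ℝ} (hx : 0 < x) (hy : 0 < y) (hz : 0 < z) :
    sigmaXY (x / z) (y / z) =
      exp ((y / 2 * log (2 * π * (x / y)) + y ^ 2 / (12 * x)) / z) := by
  rw [sigmaXY_eq_exp (by positivity) (by positivity), div_div_div_cancel_right₀ hz.ne']
  congr 1
  field_simp

open Real in
/-- Explicit exponential bound on the quotient by `σ(r,k)`. -/
theorem sigmaXY_quotient_le {r k z : ℝ} (hk : 2 ≤ k) (hlog : 16 * log k ≤ k) (hkr : k ≤ r)
    (hrk : r ≤ k ^ 2) (hz : z = 16 * r * logb 2 k / (k * logb 2 (4 * r / k))) (hz8 : 8 < z) :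
    0 ≤ √(r / z) * sigmaXY (r / z) (k / z) * (r / z) ^ (4 * r / z) * logb 2 (r / z) /
        sigmaXY r k ∧
    √(r / z) * sigmaXY (r / z) (k / z) * (r / z) ^ (4 * r / z) * logb 2 (r / z) /
        sigmaXY r k ≤ 2 * k ^ 2 * exp (-(3 / 16 * k)) := by
  have hk0 : 0 < k := by linarith
  have hr0 : 0 < r := by linarith
  have hz0 : 0 < z := by linarith
  have hlog2 := log_two_gt_d9
  have hlog20 : 0 < log 2 := by linarith
  have hlogk : log 2 ≤ log k := log_le_log (by norm_num) hk
  have hlogk0 : 0 < log k := by linarith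
  have hlog4 : log 4 = 2 * log 2 := by
    rw [show (4 : ℝ) = 2 ^ 2 by norm_num, log_pow]; norm_num
  set L := log (4 * r / k) with hL
  have hL1 : 1 ≤ L := by
    have : log 4 ≤ L := log_le_log (by norm_num) (by rw [le_div_iff₀ hk0]; linarith)
    linarith
  have hLk : L ≤ 16 * log k := by
    have : L ≤ log (4 * k) :=
      log_le_log (by positivity) (by rw [div_le_iff₀ hk0]; nlinarith)
    rw [log_mul (by norm_num) hk0.ne'] at this
    linarith
  have hx : r / z = k * L / (16 * log k) := by
    rw [hz, logb, logb, ← hL]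
    field_simp
  have h4x : 4 * r / z = 4 * (r / z) := by ring
  rw [h4x, sigmaXY_div_div hr0 hk0 hz0, sigmaXY_eq_exp hr0 hk0]
  set x := r / z
  have hx1 : 1 ≤ x := by
    rw [hx, le_div_iff₀ (by positivity)]
    nlinarith
  have hxk : x ≤ k := by
    rw [hx, div_le_iff₀ (by positivity)]
    exact mul_le_mul_of_nonneg_left hLk hk0.le
  have hx0 : 0 < x := by linarith
  have hlogx0 : 0 ≤ log x := log_nonneg hx1
  have hpow : 4 * x * log x ≤ k / 4 * L := by
    calc 4 * x * log x ≤ 4 * x * log k := by gcongr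
      _ = k / 4 * L := by rw [hx]; field_simp; ring
  have hsqrt : √x ≤ k := by
    rw [sqrt_le_left hk0.le]; nlinarith
  have hlogb : logb 2 x ≤ 2 * k := by
    rw [logb, div_le_iff₀ hlog20]
    nlinarith [log_le_sub_one_of_pos hx0]
  have hlogb0 : 0 ≤ logb 2 x := logb_nonneg (by norm_num) hx1
  set M := k / 2 * log (2 * π * (r / k)) + k ^ 2 / (12 * r) with hM
  have hML : k / 2 * L ≤ M := by
    have h1 : L ≤ log (2 * π * (r / k)) := by
      rw [hL, mul_div_assoc]
      gcongr
      linarith [pi_gt_three]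
    have h2 : 0 ≤ k ^ 2 / (12 * r) := by positivity
    have := mul_le_mul_of_nonneg_left h1 (by positivity : 0 ≤ k / 2)
    linarith
  have hMz : M / z ≤ M / 8 :=
    div_le_div_of_nonneg_left (le_trans (by positivity) hML) (by norm_num) hz8.le
  have hexp : exp (M / z) * x ^ (4 * x) / exp M ≤ exp (-(3 / 16 * k)) := by
    rw [rpow_def_of_pos hx0, ← exp_add, ← exp_sub, exp_le_exp]
    nlinarith
  have hfac : √x * exp (M / z) * x ^ (4 * x) * logb 2 x / exp M =
      √x * logb 2 x * (exp (M / z) * x ^ (4 * x) / exp M) := by ring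
  rw [hfac]
  refine ⟨by positivity, ?_⟩
  calc √x * logb 2 x * (exp (M / z) * x ^ (4 * x) / exp M)
      ≤ k * (2 * k) * exp (-(3 / 16 * k)) := by gcongr
    _ = 2 * k ^ 2 * exp (-(3 / 16 * k)) := by ring

open Real Filter in
theorem tendsto_two_mul_sq_mul_exp_neg :
    Tendsto (fun k : ℝ => 2 * k ^ 2 * exp (-(3 / 16 * k))) atTop (nhds 0) := by
  have h := ((tendsto_pow_mul_exp_neg_atTop_nhds_zero 2).comp
    (tendsto_id.const_mul_atTop (by norm_num : (0 : ℝ) < 3 / 16))).const_mul (2 * (16 / 3) ^ 2)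
  rw [mul_zero] at h
  refine h.congr fun k => ?_
  simp only [Function.comp, id]
  ring

/-- If `k(r) ≤ r`, `k(r)/√r → ∞`, and `z(r) := 16r·log₂ k(r)/(k(r)·log₂(4r/k(r))) > 8`
for all large `r`, then
`√(r/z)·σ(r/z, k/z)·(r/z)^{4r/z}·log₂(r/z) = o(σ(r,k))`. -/
theorem sigma_small_splitter_negligible (k : ℕ → ℕ) (hk : ∀ r, k r ≤ r)
    (hinf : Filter.Tendsto (fun r : ℕ => (k r : ℝ) / Real.sqrt r) Filter.atTop Filter.atTop)
    (z : ℕ → ℝ)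
    (hz : ∀ r : ℕ, z r = 16 * r * Real.logb 2 (k r) / (k r * Real.logb 2 (4 * r / (k r))))
    (hz8 : ∀ᶠ r in Filter.atTop, 8 < z r) :
    Filter.Tendsto (fun r : ℕ =>
      (Real.sqrt ((r : ℝ) / z r) * sigmaXY ((r : ℝ) / z r) ((k r : ℝ) / z r) *
          ((r : ℝ) / z r) ^ (4 * (r : ℝ) / z r) * Real.logb 2 ((r : ℝ) / z r)) /
        sigmaXY (r : ℝ) (k r : ℝ))
      Filter.atTop (nhds 0) := by
  have hsqrt : Filter.Tendsto (fun r : ℕ => √(r : ℝ)) Filter.atTop Filter.atTop :=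
    Real.tendsto_sqrt_atTop.comp tendsto_natCast_atTop_atTop
  have hkge : ∀ᶠ r : ℕ in Filter.atTop, √(r : ℝ) ≤ k r := by
    filter_upwards [hinf.eventually_ge_atTop 1, hsqrt.eventually_gt_atTop 0] with r h1 h0
    rwa [le_div_iff₀ h0, one_mul] at h1
  have hktop : Filter.Tendsto (fun r => (k r : ℝ)) Filter.atTop Filter.atTop :=
    Filter.tendsto_atTop_mono' _ hkge hsqrt
  have hlog : ∀ᶠ y : ℝ in Filter.atTop, 16 * Real.log y ≤ y := by
    filter_upwards [Real.isLittleO_log_id_atTop.bound (by norm_num : (0 : ℝ) < 1 / 16),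
      Filter.eventually_ge_atTop 0] with y hy hy0
    rw [id, Real.norm_of_nonneg hy0] at hy
    linarith [Real.le_norm_self (Real.log y)]
  have hbound : ∀ᶠ r : ℕ in Filter.atTop, _ :=
    hkge.and ((hktop.eventually hlog).and ((hktop.eventually_ge_atTop 2).and hz8))
  have key : ∀ᶠ r : ℕ in Filter.atTop, _ := hbound.mono fun r h =>
    sigmaXY_quotient_le h.2.2.1 h.2.1 (Nat.cast_le.mpr (hk r))
      ((Real.sqrt_le_left (Nat.cast_nonneg _)).mp h.1) (hz r) h.2.2.2
  exact tendsto_of_tendsto_of_tendsto_of_le_of_le' tendsto_const_nhds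
    (tendsto_two_mul_sq_mul_exp_neg.comp hktop) (key.mono fun _ h => h.1)
    (key.mono fun _ h => h.2)
end

section
/- For every constant c₁ > 0 there exist a constant c₂ > 0 and r₀ such that for all integers r ≥ r₀ and all integers k with √r ≤ k ≤ r for which z := 16·r·log₂ k / (k·log₂(4r/k)) is a positive integer, one has C(r², z−1) · ( c₁ · (r/z)^{5/2} · σ(r/z, k/z) · log₂(r/z) · log₂ r )^z ≤ r^{c₂·z} · σ(r,k), where C(a,b) denotes the binomial coefficient and σ(x,y) := (2πx/y)^{y/2} · e^{y²/(12x)}. -/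
theorem sigmaXY_div_pow {x y : ℝ} (hx : 0 < x) (hy : 0 < y) {n : ℕ} (hn : 0 < n) :
    sigmaXY (x / n) (y / n) ^ n = sigmaXY x y := by
  have hn' : (0 : ℝ) < n := by exact_mod_cast hn
  have hbase : 2 * Real.pi * (x / n) / (y / n) = 2 * Real.pi * x / y := by
    field_simp
  unfold sigmaXY
  rw [hbase, mul_pow, ← Real.rpow_mul_natCast (by positivity), ← Real.exp_nat_mul]
  congr 2 <;> field_simp

theorem sigmaXY_pos {x y : ℝ} (hx : 0 < x) (hy : 0 < y) : 0 < sigmaXY x y := by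
  unfold sigmaXY
  positivity

theorem logb_two_le_two_mul {x : ℝ} (hx : 0 < x) : Real.logb 2 x ≤ 2 * x := by
  have h2 : (1 : ℝ) / 2 < Real.log 2 := by linarith [Real.log_two_gt_d9]
  rw [Real.logb, div_le_iff₀ (by linarith)]
  nlinarith [Real.log_le_sub_one_of_pos hx]

theorem abs_logb_div_le {b r z : ℝ} (hb : 1 < b) (hr : 0 < r) (hz : 1 ≤ z) (hzr : z ≤ r ^ 2) :
    |Real.logb b (r / z)| ≤ Real.logb b r := by
  have hz0 : 0 < z := by linarith
  have hlow := Real.logb_nonneg hb hz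
  have hupp := Real.logb_le_logb_of_le hb hz0 hzr
  rw [Real.logb_pow] at hupp
  rw [Real.logb_div hr.ne' hz0.ne', abs_le]
  push_cast at hupp
  constructor <;> linarith

theorem splitter_count_le {r k : ℝ} (hk : 0 < k) (hkr : k ≤ r) :
    16 * r * Real.logb 2 k / (k * Real.logb 2 (4 * r / k)) ≤ 16 * r := by
  have hr : 0 < r := hk.trans_le hkr
  have hL : 2 ≤ Real.logb 2 (4 * r / k) := by
    rw [Real.le_logb_iff_rpow_le (by norm_num) (by positivity), le_div_iff₀ hk]
    norm_num
    exact hkr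
  rw [div_le_iff₀ (by positivity)]
  gcongr
  nlinarith [logb_two_le_two_mul hk]

theorem splitter_factor_le {c r z s : ℝ} (hr : 16 ≤ r) (hc : 0 < c) (hcr : c ≤ r) (hz : 1 ≤ z)
    (hzr : z ≤ r ^ 2) (hs : 0 < s) :
    |c * (r / z) ^ ((5 : ℝ) / 2) * s * Real.logb 2 (r / z) * Real.logb 2 r| ≤ r ^ 8 * s := by
  have hr0 : 0 < r := by linarith
  have hlog : 0 ≤ Real.logb 2 r := Real.logb_nonneg (by norm_num) (by linarith)
  have hpow : (r / z) ^ ((5 : ℝ) / 2) ≤ r ^ 3 := by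
    calc (r / z) ^ ((5 : ℝ) / 2) ≤ r ^ ((5 : ℝ) / 2) := by
          gcongr
          exact div_le_self hr0.le hz
      _ ≤ r ^ ((3 : ℕ) : ℝ) := Real.rpow_le_rpow_of_exponent_le (by linarith) (by norm_num)
      _ = r ^ 3 := Real.rpow_natCast r 3
  have hz0 : 0 < z := by linarith
  have hpow0 : 0 ≤ (r / z) ^ ((5 : ℝ) / 2) := by positivity
  have habs := abs_logb_div_le (b := 2) (by norm_num) hr0 hz hzr
  have hlogr := logb_two_le_two_mul hr0
  rw [abs_mul, abs_mul, abs_of_nonneg hlog, abs_of_nonneg (by positivity :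
    0 ≤ c * (r / z) ^ ((5 : ℝ) / 2) * s)]
  calc c * (r / z) ^ ((5 : ℝ) / 2) * s * |Real.logb 2 (r / z)| * Real.logb 2 r
      ≤ r * r ^ 3 * s * (2 * r) * (2 * r) := by
        gcongr
        exact habs.trans hlogr
    _ = 4 * (r ^ 6 * s) := by ring
    _ ≤ r ^ 2 * (r ^ 6 * s) := by
        gcongr
        nlinarith
    _ = r ^ 8 * s := by ring

/-- For every `c₁ > 0` there are `c₂ > 0` and `r₀` such that for all `r ≥ r₀`,
`√r ≤ k ≤ r` for which `z := 16r·log₂ k/(k·log₂(4r/k))` is a positive integer,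
`C(r², z−1)·(c₁·(r/z)^{5/2}·σ(r/z,k/z)·log₂(r/z)·log₂ r)^z ≤ r^{c₂z}·σ(r,k)`. -/
theorem composed_splitter_size_bound :
    ∀ c₁ : ℝ, 0 < c₁ → ∃ c₂ : ℝ, 0 < c₂ ∧ ∃ r₀ : ℕ, ∀ r k : ℕ, r₀ ≤ r →
      Real.sqrt r ≤ (k : ℝ) → k ≤ r → ∀ z : ℕ, 0 < z →
      (z : ℝ) = 16 * r * Real.logb 2 k / (k * Real.logb 2 (4 * r / k)) →
      ((r ^ 2).choose (z - 1) : ℝ) *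
          (c₁ * ((r : ℝ) / z) ^ ((5 : ℝ) / 2) * sigmaXY ((r : ℝ) / z) ((k : ℝ) / z) *
            Real.logb 2 ((r : ℝ) / z) * Real.logb 2 r) ^ z ≤
        (r : ℝ) ^ (c₂ * z) * sigmaXY (r : ℝ) (k : ℝ) := by
  intro c₁ hc₁
  refine ⟨10, by norm_num, max 16 ⌈c₁⌉₊, fun r k hr hk hkr z hz hzeq => ?_⟩
  have hr16 : (16 : ℝ) ≤ r := by exact_mod_cast (le_max_left _ _).trans hr
  have hcr : c₁ ≤ r := (Nat.le_ceil c₁).trans (by exact_mod_cast (le_max_right _ _).trans hr)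
  have hr0 : (0 : ℝ) < r := by linarith
  have hk0 : (0 : ℝ) < k := (Real.sqrt_pos.mpr hr0).trans_le hk
  have hkr' : (k : ℝ) ≤ r := by exact_mod_cast hkr
  have hz1 : (1 : ℝ) ≤ z := by exact_mod_cast hz
  have hz0 : (0 : ℝ) < z := by linarith
  have hzr : (z : ℝ) ≤ (r : ℝ) ^ 2 := by
    have := splitter_count_le hk0 hkr'
    rw [← hzeq] at this
    nlinarith
  have hs : 0 < sigmaXY ((r : ℝ) / z) ((k : ℝ) / z) :=
    sigmaXY_pos (by positivity) (by positivity)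
  have hchoose : ((r ^ 2).choose (z - 1) : ℝ) ≤ (r : ℝ) ^ (2 * z) := by
    calc ((r ^ 2).choose (z - 1) : ℝ) ≤ ((r : ℝ) ^ 2) ^ (z - 1) := by
          exact_mod_cast Nat.choose_le_pow (r ^ 2) (z - 1)
      _ = (r : ℝ) ^ (2 * (z - 1)) := (pow_mul _ _ _).symm
      _ ≤ (r : ℝ) ^ (2 * z) := pow_le_pow_right₀ (by linarith) (by omega)
  have hfactor := pow_le_pow_left₀ (abs_nonneg _)
    (splitter_factor_le hr16 hc₁ hcr hz1 hzr hs) z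
  rw [← abs_pow, mul_pow ((r : ℝ) ^ 8), sigmaXY_div_pow hr0 hk0 hz] at hfactor
  have hexp : (r : ℝ) ^ ((10 : ℝ) * z) = (r : ℝ) ^ (2 * z) * ((r : ℝ) ^ 8) ^ z := by
    rw [← pow_mul, ← pow_add, ← Real.rpow_natCast]
    congr 1
    push_cast
    ring
  rw [hexp, mul_assoc ((r : ℝ) ^ (2 * z))]
  refine (mul_le_mul_of_nonneg_left ((le_abs_self _).trans hfactor) (Nat.cast_nonneg _)).trans ?_
  exact mul_le_mul_of_nonneg_right hchoose ((abs_nonneg _).trans hfactor)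
end

section
/- There exists a constant C > 0 such that for all integers 2 ≤ t < k ≤ n the following holds: if there exists a (k²,(t,k−t))-cover-free family of size M, then there exists a (t,k)-minimal separating family of functions from {1,…,n} to {1,…,t+1} of size at most k^C · M · e^{t + C·(log₂ t)²} · (log₂ k) · (log₂ n). -/
/-- A `(t,k)`-minimal separating family of functions `[n] → [t+1]`: for every
pair of disjoint `C, D ⊆ [n]` with `|C| = t` and `|D| ≤ k − t` there is `h ∈ H`
with `h(C) = [t]` (injectively onto `{1,…,t}`) and `h(D) ⊆ {t+1}`. -/
def IsMinSep (n t k : ℕ) (H : Finset (Fin n → Fin (t + 1))) : Prop :=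
  ∀ C D : Finset (Fin n), Disjoint C D → C.card = t → D.card ≤ k - t →
    ∃ h ∈ H, C.image h = (Finset.univ : Finset (Fin (t + 1))).erase (Fin.last t) ∧
      ∀ x ∈ D, h x = Fin.last t

/-- Averaging: if every `i ∈ I` is related to at least a `p`-fraction of `Ω`, then some `ω` is
related to at least a `p`-fraction of `I`. -/
theorem exists_mul_card_le_card_filter {ι Ω : Type*} [Fintype Ω] [Nonempty Ω] (R : ι → Ω → Prop)
    [∀ i ω, Decidable (R i ω)] {p : ℝ} {I : Finset ι}
    (hR : ∀ i ∈ I, p * Fintype.card Ω ≤ (Finset.univ.filter fun ω => R i ω).card) :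
    ∃ ω, p * I.card ≤ ((I.filter fun i => R i ω).card : ℝ) := by
  have hsum : ∑ _ω : Ω, p * (I.card : ℝ) ≤ ∑ ω : Ω, ((I.filter fun i => R i ω).card : ℝ) := by
    have hcomm := Finset.sum_card_bipartiteAbove_eq_sum_card_bipartiteBelow
      (s := I) (t := (Finset.univ : Finset Ω)) R
    simp only [Finset.bipartiteAbove, Finset.bipartiteBelow] at hcomm
    have hle := Finset.sum_le_sum hR
    rw [← Nat.cast_sum, ← hcomm, Nat.cast_sum]
    refine le_trans (le_of_eq ?_) hle
    simp only [Finset.sum_const, Finset.card_univ, nsmul_eq_mul]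
    ring
  obtain ⟨ω, -, hω⟩ := Finset.exists_le_of_sum_le Finset.univ_nonempty hsum
  exact ⟨ω, hω⟩

/-- Greedy covering: `m` points can be chosen that miss at most a `(1 - p) ^ m` fraction of `I`. -/
theorem exists_greedy_cover_s15 {ι Ω : Type*} [Fintype Ω] [Nonempty Ω] [DecidableEq Ω]
    (R : ι → Ω → Prop) [∀ i ω, Decidable (R i ω)] {p : ℝ} (hp : p ≤ 1) {I : Finset ι}
    (hR : ∀ i ∈ I, p * Fintype.card Ω ≤ (Finset.univ.filter fun ω => R i ω).card) (m : ℕ) :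
    ∃ T : Finset Ω, T.card ≤ m ∧
      ((I.filter fun i => ∀ ω ∈ T, ¬ R i ω).card : ℝ) ≤ (1 - p) ^ m * I.card := by
  induction m with
  | zero => exact ⟨∅, by simp, by simp⟩
  | succ m ih =>
    obtain ⟨T, hT, hU⟩ := ih
    set U := I.filter fun i => ∀ ω ∈ T, ¬ R i ω with hUdef
    obtain ⟨ω, hω⟩ := exists_mul_card_le_card_filter R (I := U) (p := p)
      fun i hi => hR i (Finset.mem_filter.1 hi).1
    refine ⟨insert ω T, (Finset.card_insert_le _ _).trans (by omega), ?_⟩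
    have hsplit : (I.filter fun i => ∀ ω' ∈ insert ω T, ¬ R i ω') = U.filter fun i => ¬ R i ω := by
      ext i
      simp only [hUdef, Finset.mem_filter, Finset.mem_insert, forall_eq_or_imp]
      tauto
    have hcard : ((U.filter fun i => R i ω).card : ℝ) + (U.filter fun i => ¬ R i ω).card
        = U.card := by
      exact_mod_cast Finset.card_filter_add_card_filter_not (s := U) (fun i => R i ω)
    rw [hsplit, pow_succ]
    nlinarith [mul_le_mul_of_nonneg_left hU (sub_nonneg.2 hp)]

/-- A hitting set of logarithmic size. -/
theorem exists_hitting_set {ι Ω : Type*} [Fintype Ω] [Nonempty Ω] [DecidableEq Ω]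
    (R : ι → Ω → Prop) [∀ i ω, Decidable (R i ω)] {p : ℝ} (hp0 : 0 < p) (hp : p ≤ 1)
    {I : Finset ι} {L : ℝ} (hL : 0 ≤ L) (hI : (I.card : ℝ) ≤ Real.exp L)
    (hR : ∀ i ∈ I, p * Fintype.card Ω ≤ (Finset.univ.filter fun ω => R i ω).card) :
    ∃ T : Finset Ω, (T.card : ℝ) ≤ L / p + 1 ∧ ∀ i ∈ I, ∃ ω ∈ T, R i ω := by
  obtain ⟨T, hT, hU⟩ := exists_greedy_cover_s15 R hp hR (⌊L / p⌋₊ + 1)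
  have hm : L / p < ((⌊L / p⌋₊ + 1 : ℕ) : ℝ) := by
    push_cast
    exact Nat.lt_floor_add_one _
  refine ⟨T, ?_, ?_⟩
  · calc (T.card : ℝ) ≤ ((⌊L / p⌋₊ + 1 : ℕ) : ℝ) := by exact_mod_cast hT
      _ ≤ L / p + 1 := by
        push_cast
        linarith [Nat.floor_le (div_nonneg hL hp0.le)]
  · generalize ⌊L / p⌋₊ + 1 = m at hU hm
    have hpow : (1 - p) ^ m ≤ Real.exp (-(p * m)) := by
      calc (1 - p) ^ m ≤ Real.exp (-p) ^ m :=
            pow_le_pow_left₀ (sub_nonneg.2 hp) (by linarith [Real.add_one_le_exp (-p)]) m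
        _ = Real.exp (-(p * m)) := by
            rw [← Real.exp_nat_mul]
            ring_nf
    have hlt : Real.exp (-(p * m)) * Real.exp L < 1 := by
      rw [← Real.exp_add, Real.exp_lt_one_iff]
      rw [div_lt_iff₀ hp0] at hm
      linarith
    have hzero : (I.filter fun i => ∀ ω ∈ T, ¬ R i ω).card = 0 := by
      have : ((I.filter fun i => ∀ ω ∈ T, ¬ R i ω).card : ℝ) < 1 :=
        (hU.trans (mul_le_mul hpow hI (Nat.cast_nonneg _) (Real.exp_pos _).le)).trans_lt hlt
      exact Nat.lt_one_iff.1 (by exact_mod_cast this)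
    intro i hi
    by_contra! hcon
    exact Finset.filter_eq_empty_iff.1 (Finset.card_eq_zero.1 hzero) hi hcon

/-- The number of functions that are injective on a given finite set. -/
theorem card_filter_injOn {α β : Type*} [Fintype α] [DecidableEq α] [Fintype β] (S : Finset α)
    [DecidablePred fun f : α → β => Set.InjOn f S] :
    (Finset.univ.filter fun f : α → β => Set.InjOn f S).card
      = (Fintype.card β).descFactorial S.card * Fintype.card β ^ (Fintype.card α - S.card) := by
  classical
  have e : {f : α → β // Set.InjOn f S} ≃ (S ↪ β) × ({x // ¬ x ∈ S} → β) :=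
    calc {f : α → β // Set.InjOn f S}
        ≃ {q : (S → β) × ({x // ¬ x ∈ S} → β) // Function.Injective q.1} :=
          (Equiv.piEquivPiSubtypeProd (· ∈ S) fun _ => β).subtypeEquiv
            fun f => Set.injOn_iff_injective
      _ ≃ {f : S → β // Function.Injective f} × ({x // ¬ x ∈ S} → β) :=
          Equiv.prodSubtypeFstEquivSubtypeProd
      _ ≃ (S ↪ β) × ({x // ¬ x ∈ S} → β) :=
          Equiv.prodCongr (Equiv.subtypeInjectiveEquivEmbedding _ _) (Equiv.refl _)
  rw [← Fintype.card_subtype, Fintype.card_congr e, Fintype.card_prod, Fintype.card_embedding_eq,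
    Fintype.card_fun, Fintype.card_subtype_compl, Fintype.card_coe]

theorem pow_sq_le_mul_descFactorial {k : ℕ} (hk : 0 < k) :
    ((k ^ 2 : ℕ) : ℝ) ^ k ≤ k * ((k ^ 2).descFactorial k : ℝ) := by
  have hk' : (0 : ℝ) < k := by exact_mod_cast hk
  have hk1 : (1 : ℝ) ≤ k := by exact_mod_cast hk
  have hle : k ≤ k ^ 2 + 1 := by nlinarith
  have h1 : ((k : ℝ) ^ 2 + 1 - k) ^ k ≤ ((k ^ 2).descFactorial k : ℝ) := by
    have := Nat.pow_sub_le_descFactorial (k ^ 2) k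
    rw [← Nat.cast_le (α := ℝ)] at this
    push_cast [Nat.cast_sub hle] at this
    exact this
  have hinv : ((k : ℝ) - 1) / k ^ 2 ≤ 1 := by
    rw [div_le_one (by positivity)]
    nlinarith
  have h2 : 1 / (k : ℝ) ≤ (1 + -(((k : ℝ) - 1) / k ^ 2)) ^ k := by
    refine le_trans (le_of_eq ?_) (one_add_mul_le_pow (by linarith) k)
    field_simp
    ring
  have h3 : ((k : ℝ) ^ 2 + 1 - k) = k ^ 2 * (1 + -(((k : ℝ) - 1) / k ^ 2)) := by
    field_simp
    ring
  rw [h3, mul_pow] at h1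
  push_cast
  calc ((k : ℝ) ^ 2) ^ k = k * (((k : ℝ) ^ 2) ^ k * (1 / k)) := by field_simp
    _ ≤ k * ((k ^ 2).descFactorial k : ℝ) := by
      gcongr
      exact le_trans (by gcongr) h1

theorem card_le_mul_card_filter_injOn {α : Type*} [Fintype α] [DecidableEq α] {k : ℕ} (hk : 0 < k)
    {S : Finset α} (hS : S.card = k)
    [DecidablePred fun f : α → Fin (k ^ 2) => Set.InjOn f S] :
    (Fintype.card (α → Fin (k ^ 2)) : ℝ)
      ≤ k * (Finset.univ.filter fun f : α → Fin (k ^ 2) => Set.InjOn f S).card := by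
  have hle : k ≤ Fintype.card α := hS ▸ S.card_le_univ
  rw [card_filter_injOn, hS, Fintype.card_fun, Fintype.card_fin]
  have hsplit : Fintype.card α = k + (Fintype.card α - k) := by omega
  conv_lhs => rw [hsplit, pow_add]
  rw [Nat.cast_mul, Nat.cast_mul, ← mul_assoc]
  gcongr
  rw [Nat.cast_pow]
  exact pow_sq_le_mul_descFactorial hk

theorem card_le_exp_mul_card_filter_injOn {α : Type*} [Fintype α] [DecidableEq α] {t : ℕ}
    {S : Finset α} (hS : S.card = t)
    [DecidablePred fun f : α → Fin t => Set.InjOn f S] :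
    (Fintype.card (α → Fin t) : ℝ)
      ≤ Real.exp t * (Finset.univ.filter fun f : α → Fin t => Set.InjOn f S).card := by
  have hle : t ≤ Fintype.card α := hS ▸ S.card_le_univ
  rw [card_filter_injOn, hS, Fintype.card_fun, Fintype.card_fin, Nat.descFactorial_self]
  have hsplit : Fintype.card α = t + (Fintype.card α - t) := by omega
  conv_lhs => rw [hsplit, pow_add]
  rw [Nat.cast_mul, Nat.cast_mul, ← mul_assoc]
  gcongr
  have := Real.pow_div_factorial_le_exp (t : ℝ) (Nat.cast_nonneg t) t
  rw [div_le_iff₀ (by positivity)] at this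
  exact_mod_cast this

/-- Hash `[n]` to `[N]` by `φ`; points whose hash lies in the support of `a` are coloured by `g`,
the others receive the last colour. -/
def hashColoring {n N t : ℕ} (φ : Fin n → Fin N) (a : Fin N → Bool) (g : Fin n → Fin t) :
    Fin n → Fin (t + 1) :=
  fun x => if a (φ x) = true then (g x).castSucc else Fin.last t

/-- The function `h` maps `C` bijectively onto the first `t` colours and `D` to the last colour. -/
def Separates {n t : ℕ} (C D : Finset (Fin n)) (h : Fin n → Fin (t + 1)) : Prop :=
  C.image h = (Finset.univ : Finset (Fin (t + 1))).erase (Fin.last t) ∧ ∀ x ∈ D, h x = Fin.last t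

theorem separates_hashColoring {n N t : ℕ} {C D : Finset (Fin n)} (hC : C.card = t)
    {φ : Fin n → Fin N} {a : Fin N → Bool} {g : Fin n → Fin t} (hg : Set.InjOn g C)
    (haC : ∀ x ∈ C, a (φ x) = true) (haD : ∀ x ∈ D, a (φ x) = false) :
    Separates C D (hashColoring φ a g) := by
  have hval : ∀ x ∈ C, hashColoring φ a g x = (g x).castSucc := fun x hx => by
    simp [hashColoring, haC x hx]
  refine ⟨Finset.eq_of_subset_of_card_le ?_ ?_, fun x hx => by simp [hashColoring, haD x hx]⟩
  · intro y hy
    obtain ⟨x, hx, rfl⟩ := Finset.mem_image.1 hy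
    rw [hval x hx]
    simp [Fin.castSucc_ne_last]
  · rw [Finset.card_image_of_injOn, hC, Finset.card_erase_of_mem (Finset.mem_univ _)]
    · simp
    · intro x hx y hy hxy
      rw [hval x hx, hval y hy] at hxy
      exact hg hx hy (Fin.castSucc_injective t hxy)

theorem IsCFF.exists_of_injOn {n N r s : ℕ} {F : Finset (Fin N → Bool)} (hF : IsCFF N r s F)
    {C D : Finset (Fin n)} (hCD : Disjoint C D) (hC : C.card = r) (hD : D.card = s)
    {φ : Fin n → Fin N} (hφ : Set.InjOn φ (C ∪ D : Finset (Fin n))) :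
    ∃ a ∈ F, (∀ x ∈ C, a (φ x) = true) ∧ ∀ x ∈ D, a (φ x) = false := by
  obtain ⟨a, haF, ha1, ha0⟩ := hF ((C ∪ D).image φ)
    (by rw [Finset.card_image_of_injOn hφ, Finset.card_union_of_disjoint hCD, hC, hD])
    (C.image φ) (Finset.image_subset_image Finset.subset_union_left)
    (by rw [Finset.card_image_of_injOn (hφ.mono (by simp)), hC])
  refine ⟨a, haF, fun x hx => ha1 _ (Finset.mem_image_of_mem φ hx), fun x hx => ha0 _ ?_⟩
  refine Finset.mem_sdiff.2
    ⟨Finset.mem_image_of_mem φ (Finset.mem_union_right C hx), fun hmem => ?_⟩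
  obtain ⟨y, hy, hyx⟩ := Finset.mem_image.1 hmem
  have hyx' : y = x := hφ (Finset.mem_union_left D hy) (Finset.mem_union_right C hx) hyx
  exact Finset.disjoint_left.1 hCD hy (hyx' ▸ hx)

open Classical in
/-- For each pair `(C, D)`, a uniformly random `hashColoring` separates it with probability at
least `1 / (k * M * e ^ t)`. -/
theorem IsCFF.card_le_mul_card_separates {n t k : ℕ} (hk : 0 < k) (htk : t ≤ k)
    {F : Finset (Fin (k ^ 2) → Bool)} (hF : IsCFF (k ^ 2) t (k - t) F)
    {C D : Finset (Fin n)} (hCD : Disjoint C D) (hC : C.card = t) (hD : D.card = k - t) :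
    (Fintype.card ((Fin n → Fin (k ^ 2)) × F × (Fin n → Fin t)) : ℝ)
      ≤ (k * F.card * Real.exp t) *
        (Finset.univ.filter fun q : (Fin n → Fin (k ^ 2)) × F × (Fin n → Fin t) =>
          Separates C D (hashColoring q.1 q.2.1 q.2.2)).card := by
  have hS : (C ∪ D).card = k := by
    rw [Finset.card_union_of_disjoint hCD, hC, hD]
    omega
  set A := Finset.univ.filter fun φ : Fin n → Fin (k ^ 2) =>
    Set.InjOn φ (C ∪ D : Finset (Fin n)) with hA
  set B := Finset.univ.filter fun g : Fin n → Fin t => Set.InjOn g C with hB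
  have hex : ∀ φ : A, ∃ a : F,
      (∀ x ∈ C, a.1 (φ.1 x) = true) ∧ ∀ x ∈ D, a.1 (φ.1 x) = false := fun φ => by
    obtain ⟨a, haF, ha⟩ := hF.exists_of_injOn hCD hC hD (Finset.mem_filter.1 φ.2).2
    exact ⟨⟨a, haF⟩, ha⟩
  choose a ha using hex
  have hcard : A.card * B.card ≤
      (Finset.univ.filter fun q : (Fin n → Fin (k ^ 2)) × F × (Fin n → Fin t) =>
        Separates C D (hashColoring q.1 q.2.1 q.2.2)).card := by
    rw [← Fintype.card_coe A, ← Fintype.card_coe B, ← Fintype.card_prod, ← Finset.card_univ]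
    refine Finset.card_le_card_of_injOn (fun q : A × B => (q.1.1, a q.1, q.2.1)) ?_ ?_
    · intro q _
      simp only [Finset.coe_filter, Finset.mem_univ, true_and, Set.mem_ofPred_eq]
      exact separates_hashColoring hC (Finset.mem_filter.1 q.2.2).2 (ha q.1).1 (ha q.1).2
    · rintro ⟨⟨φ, _⟩, ⟨g, _⟩⟩ _ ⟨⟨φ', _⟩, ⟨g', _⟩⟩ _ h
      simp only [Prod.mk.injEq] at h
      obtain ⟨rfl, -, rfl⟩ := h
      rfl
  have h1 := card_le_mul_card_filter_injOn hk hS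
  have h2 := card_le_exp_mul_card_filter_injOn hC
  rw [← hA] at h1
  rw [← hB] at h2
  rw [Fintype.card_prod, Fintype.card_prod, Fintype.card_coe, Nat.cast_mul, Nat.cast_mul]
  calc _ ≤ (k * A.card : ℝ) * (F.card * (Real.exp t * B.card)) := by gcongr
    _ = (k * F.card * Real.exp t) * ((A.card * B.card : ℕ) : ℝ) := by
      push_cast
      ring
    _ ≤ _ := by gcongr

theorem isMinSep_of_forall_card_eq {n t k : ℕ} (htk : t ≤ k) (hkn : k ≤ n)
    {H : Finset (Fin n → Fin (t + 1))}
    (hH : ∀ C D : Finset (Fin n), Disjoint C D → C.card = t → D.card = k - t →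
      ∃ h ∈ H, Separates C D h) : IsMinSep n t k H := by
  intro C D hCD hC hD
  obtain ⟨D', hDD', hD'C, hD'⟩ := Finset.exists_subsuperset_card_eq
    (s := D) (t := Cᶜ) (n := k - t)
    (fun x hx => Finset.mem_compl.2 fun hxC => Finset.disjoint_left.1 hCD hxC hx) hD
    (by rw [Finset.card_compl, Fintype.card_fin, hC]; omega)
  obtain ⟨h, hhH, hhC, hhD⟩ := hH C D'
    (Finset.disjoint_left.2 fun x hxC hxD => Finset.mem_compl.1 (hD'C hxD) hxC) hC hD'
  exact ⟨h, hhH, hhC, fun x hx => hhD x (hDD' hx)⟩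

theorem IsCFF.nonempty {n r s : ℕ} (h : r + s ≤ n) {F : Finset (Fin n → Bool)}
    (hF : IsCFF n r s F) : F.Nonempty := by
  obtain ⟨S, -, hS⟩ := Finset.exists_subset_card_eq
    (s := (Finset.univ : Finset (Fin n))) (n := r + s) (by simpa using h)
  obtain ⟨J, hJS, hJ⟩ := Finset.exists_subset_card_eq (s := S) (n := r) (by omega)
  obtain ⟨a, ha, -⟩ := hF S hS J hJS hJ
  exact ⟨a, ha⟩

open Classical in
theorem IsCFF.exists_isMinSep {n t k : ℕ} (ht : 0 < t) (htk : t ≤ k) (hkn : k ≤ n)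
    {F : Finset (Fin (k ^ 2) → Bool)} (hF : IsCFF (k ^ 2) t (k - t) F) :
    ∃ H : Finset (Fin n → Fin (t + 1)), IsMinSep n t k H ∧
      (H.card : ℝ) ≤ k * Real.log n * (k * F.card * Real.exp t) + 1 := by
  have hk : 0 < k := by omega
  have hFne : F.Nonempty := hF.nonempty (by nlinarith [Nat.add_sub_cancel' htk])
  have hF1 : (1 : ℝ) ≤ F.card := by exact_mod_cast hFne.card_pos
  have hk1 : (1 : ℝ) ≤ k := by exact_mod_cast hk
  have hQ : 1 ≤ k * F.card * Real.exp t :=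
    one_le_mul_of_one_le_of_one_le (one_le_mul_of_one_le_of_one_le hk1 hF1)
      (Real.one_le_exp (Nat.cast_nonneg t))
  have hn : (0 : ℝ) < n := by exact_mod_cast hk.trans_le hkn
  have : Nonempty F := hFne.to_subtype
  have : NeZero t := ⟨ht.ne'⟩
  have : NeZero (k ^ 2) := ⟨by positivity⟩
  let I := ((Finset.univ : Finset (Fin n)).powersetCard t ×ˢ
    (Finset.univ : Finset (Fin n)).powersetCard (k - t)).filter fun i => Disjoint i.1 i.2
  have hI : (I.card : ℝ) ≤ Real.exp (k * Real.log n) := by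
    rw [Real.exp_nat_mul, Real.exp_log hn]
    have hle : I.card ≤ n ^ k := by
      refine (Finset.card_filter_le _ _).trans ?_
      rw [Finset.card_product, Finset.card_powersetCard, Finset.card_powersetCard,
        Finset.card_univ, Fintype.card_fin, ← Nat.add_sub_cancel' htk, pow_add,
        Nat.add_sub_cancel_left]
      exact Nat.mul_le_mul (Nat.choose_le_pow _ _) (Nat.choose_le_pow _ _)
    exact_mod_cast hle
  obtain ⟨T, hT, hhit⟩ := exists_hitting_set
    (fun (i : Finset (Fin n) × Finset (Fin n))
      (q : (Fin n → Fin (k ^ 2)) × F × (Fin n → Fin t)) =>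
        Separates i.1 i.2 (hashColoring q.1 q.2.1 q.2.2))
    (inv_pos.2 (by linarith)) (inv_le_one_of_one_le₀ hQ)
    (mul_nonneg k.cast_nonneg (Real.log_natCast_nonneg n)) hI (by
      intro i hi
      simp only [I, Finset.mem_filter, Finset.mem_product, Finset.mem_powersetCard_univ] at hi
      rw [inv_mul_le_iff₀ (by linarith)]
      exact hF.card_le_mul_card_separates hk htk hi.2 hi.1.1 hi.1.2)
  refine ⟨T.image fun q => hashColoring q.1 q.2.1 q.2.2,
    isMinSep_of_forall_card_eq htk hkn fun C D hCD hC hD => ?_, ?_⟩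
  · obtain ⟨q, hq, hsep⟩ := hhit (C, D) (by simp [I, hC, hD, hCD])
    exact ⟨_, Finset.mem_image_of_mem _ hq, hsep⟩
  · rw [div_inv_eq_mul] at hT
    exact le_trans (by exact_mod_cast Finset.card_image_le) hT

/-- There is a constant `C > 0` such that for all `2 ≤ t < k ≤ n`: any
`(k²,(t,k−t))`-CFF of size `M` yields a `(t,k)`-minimal separating family of size
at most `k^C · M · e^{t + C(log₂ t)²} · log₂ k · log₂ n`. -/
theorem cff_to_minsep :
    ∃ C : ℝ, 0 < C ∧ ∀ t k n : ℕ, 2 ≤ t → t < k → k ≤ n →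
      ∀ F : Finset (Fin (k ^ 2) → Bool), IsCFF (k ^ 2) t (k - t) F →
        ∃ H : Finset (Fin n → Fin (t + 1)), IsMinSep n t k H ∧
          (H.card : ℝ) ≤ (k : ℝ) ^ C * F.card *
            Real.exp (t + C * (Real.logb 2 t) ^ 2) * Real.logb 2 k * Real.logb 2 n := by
  refine ⟨3, by norm_num, fun t k n ht htk hkn F hF => ?_⟩
  obtain ⟨H, hH, hcard⟩ := hF.exists_isMinSep (by omega) htk.le hkn
  refine ⟨H, hH, hcard.trans ?_⟩
  have hFne : F.Nonempty := hF.nonempty (by nlinarith [Nat.add_sub_cancel' htk.le])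
  have hF1 : (1 : ℝ) ≤ F.card := by exact_mod_cast hFne.card_pos
  have hk2 : (2 : ℝ) ≤ k := by exact_mod_cast (by omega : 2 ≤ k)
  have hn2 : (2 : ℝ) ≤ n := by exact_mod_cast (by omega : 2 ≤ n)
  have hlogb : ∀ x : ℝ, 2 ≤ x → 1 ≤ Real.logb 2 x := fun x hx => by
    rw [Real.le_logb_iff_rpow_le (by norm_num) (by linarith), Real.rpow_one]
    exact hx
  have hlog : Real.log n ≤ Real.logb 2 n := by
    rw [Real.logb, le_div_iff₀ (Real.log_pos (by norm_num))]
    have h0 : 0 ≤ Real.log n := Real.log_natCast_nonneg n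
    nlinarith [Real.log_two_lt_d9]
  have hkpow : (k : ℝ) ^ (3 : ℝ) = (k : ℝ) ^ 3 := by
    rw [← Real.rpow_natCast]
    norm_num
  have hexp : Real.exp t ≤ Real.exp (t + 3 * (Real.logb 2 t) ^ 2) :=
    Real.exp_le_exp.2 (by nlinarith [sq_nonneg (Real.logb 2 t)])
  have hone : 1 ≤ F.card * Real.exp t * Real.logb 2 n :=
    one_le_mul_of_one_le_of_one_le
      (one_le_mul_of_one_le_of_one_le hF1 (Real.one_le_exp (Nat.cast_nonneg t))) (hlogb n hn2)
  rw [hkpow]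
  calc k * Real.log n * (k * F.card * Real.exp t) + 1
      ≤ k * Real.logb 2 n * (k * F.card * Real.exp t) + F.card * Real.exp t * Real.logb 2 n := by
        gcongr
    _ = ((k : ℝ) ^ 2 + 1) * (F.card * Real.exp t * Real.logb 2 n) := by ring
    _ ≤ (k : ℝ) ^ 3 * (F.card * Real.exp t * Real.logb 2 n) := by
        gcongr
        nlinarith [sq_nonneg (k : ℝ)]
    _ = (k : ℝ) ^ 3 * F.card * Real.exp t * 1 * Real.logb 2 n := by ring
    _ ≤ _ := by
        have := hlogb n hn2
        gcongr
        exact hlogb k hk2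
end

section
/- For every ε > 0 there exist a constant C > 0 and an integer t₀ such that for all integers t, k, n with t₀ ≤ t < k ≤ n there exists a (t,k)-minimal separating family of functions from {1,…,n} to {1,…,t+1} of size at most k^C · (k/t)^{(1+ε)·t} · 2^{C·t} · log₂ n. -/
open Finset in
/-- One greedy step: if every `x ∈ U` is related to at least a fraction `p` of all `y`, some `y`
leaves at most a fraction `1 - p` of `U` unrelated to it. -/
theorem exists_card_filter_not_le {α β : Type*} [Fintype β] [Nonempty β]
    (R : α → β → Prop) [∀ x y, Decidable (R x y)] (p : ℝ) (U : Finset α)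
    (hR : ∀ x ∈ U, p * Fintype.card β ≤ #{y | R x y}) :
    ∃ y, (#{x ∈ U | ¬ R x y} : ℝ) ≤ (1 - p) * #U := by
  have hsum : ∑ y : β, (#{x ∈ U | ¬ R x y} : ℝ) ≤ ∑ _y : β, (1 - p) * (#U : ℝ) := by
    have hswap : ∑ y : β, (#{x ∈ U | ¬ R x y} : ℝ) = ∑ x ∈ U, (#{y | ¬ R x y} : ℝ) := by
      simp only [card_filter, Nat.cast_sum]
      exact sum_comm
    rw [hswap]
    calc ∑ x ∈ U, (#{y | ¬ R x y} : ℝ) ≤ ∑ _x ∈ U, (1 - p) * (Fintype.card β : ℝ) := by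
          refine sum_le_sum fun x hx => ?_
          have h1 := hR x hx
          have h2 : (#{y | R x y} : ℝ) + #{y | ¬ R x y} = Fintype.card β := by
            exact_mod_cast card_filter_add_card_filter_not (s := univ) (R x)
          linarith
      _ = ∑ _y : β, (1 - p) * (#U : ℝ) := by
          simp only [sum_const, nsmul_eq_mul, card_univ]
          ring
  obtain ⟨y, -, hy⟩ := exists_le_of_sum_le univ_nonempty hsum
  exact ⟨y, hy⟩

open Finset in
/-- Greedy covering: `N` elements suffice to leave at most a fraction `(1 - p) ^ N` uncovered. -/
theorem exists_card_uncovered_le {α β : Type*} [Fintype β] [Nonempty β] [DecidableEq β]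
    (R : α → β → Prop) [∀ x y, Decidable (R x y)] (p : ℝ) (hp : p ≤ 1) (X : Finset α)
    (hR : ∀ x ∈ X, p * Fintype.card β ≤ #{y | R x y}) (N : ℕ) :
    ∃ S : Finset β, #S ≤ N ∧ (#{x ∈ X | ∀ y ∈ S, ¬ R x y} : ℝ) ≤ (1 - p) ^ N * #X := by
  induction N with
  | zero => exact ⟨∅, by simp⟩
  | succ N ih =>
    obtain ⟨S, hS, hU⟩ := ih
    obtain ⟨y, hy⟩ := exists_card_filter_not_le R p {x ∈ X | ∀ y ∈ S, ¬ R x y}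
      fun x hx => hR x (mem_filter.1 hx).1
    refine ⟨insert y S, (card_insert_le _ _).trans (by lia), ?_⟩
    have heq : {x ∈ X | ∀ z ∈ insert y S, ¬ R x z} =
        {x ∈ {x ∈ X | ∀ z ∈ S, ¬ R x z} | ¬ R x y} := by
      ext x
      simp only [mem_filter, mem_insert, forall_eq_or_imp]
      tauto
    rw [heq]
    calc _ ≤ _ := hy
      _ ≤ (1 - p) * ((1 - p) ^ N * #X) := by
          gcongr
      _ = _ := by ring

open Finset in
/-- If every element of `X` is covered by at least a fraction `p` of all `y`, then `N` of them
cover `X` as soon as `#X < exp (p N)`. -/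
theorem exists_cover_of_card_lt_exp {α β : Type*} [Fintype β] [Nonempty β] [DecidableEq β]
    (R : α → β → Prop) [∀ x y, Decidable (R x y)] (p : ℝ) (hp : p ≤ 1) (X : Finset α)
    (hR : ∀ x ∈ X, p * Fintype.card β ≤ #{y | R x y}) (N : ℕ)
    (hX : (#X : ℝ) < Real.exp (p * N)) :
    ∃ S : Finset β, #S ≤ N ∧ ∀ x ∈ X, ∃ y ∈ S, R x y := by
  obtain ⟨S, hS, hU⟩ := exists_card_uncovered_le R p hp X hR N
  refine ⟨S, hS, fun x hx => ?_⟩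
  by_contra! hcon
  have hpos : 1 ≤ #{x ∈ X | ∀ y ∈ S, ¬ R x y} :=
    card_pos.2 ⟨x, mem_filter.2 ⟨hx, hcon⟩⟩
  have hpow : (1 - p) ^ N ≤ Real.exp (-(p * N)) := by
    calc (1 - p) ^ N ≤ Real.exp (-p) ^ N :=
          pow_le_pow_left₀ (by linarith) (Real.one_sub_le_exp_neg p) N
      _ = Real.exp (-(p * N)) := by
          rw [← Real.exp_nat_mul]
          ring_nf
  have hlt : (#{x ∈ X | ∀ y ∈ S, ¬ R x y} : ℝ) < 1 := by
    calc _ ≤ _ := hU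
      _ ≤ Real.exp (-(p * N)) * #X := by gcongr
      _ < Real.exp (-(p * N)) * Real.exp (p * N) := by gcongr
      _ = 1 := by rw [← Real.exp_add]; simp
  have : (1 : ℝ) ≤ #{x ∈ X | ∀ y ∈ S, ¬ R x y} := by exact_mod_cast hpos
  linarith

/-- Collapse all values `≥ t` to the last element of `Fin (t + 1)`. -/
def truncateFin (t : ℕ) {k : ℕ} (i : Fin k) : Fin (t + 1) :=
  ⟨min i t, by lia⟩

/-- Glue a bijection on `C`, a function on `D` and a function on the rest to a function into
`Fin k` taking values `< t` on `C` and `≥ t` on `D`. -/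
def glueFin {n t k : ℕ} (htk : t ≤ k) (C D : Finset (Fin n))
    (q : (C ≃ Fin t) × (D → Fin (k - t)) × ({x // x ∉ C ∪ D} → Fin k)) (x : Fin n) : Fin k :=
  if hC : x ∈ C then Fin.castLE htk (q.1 ⟨x, hC⟩)
  else if hD : x ∈ D then ⟨t + q.2.1 ⟨x, hD⟩, by lia⟩
  else q.2.2 ⟨x, by simp [hC, hD]⟩

theorem glueFin_injective {n t k : ℕ} (htk : t ≤ k) {C D : Finset (Fin n)} (hCD : Disjoint C D) :
    Function.Injective (glueFin htk C D) := by
  rintro ⟨σ, f, r⟩ ⟨σ', f', r'⟩ h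
  refine Prod.ext (Equiv.ext fun x => ?_) (Prod.ext (funext fun x => ?_) (funext fun x => ?_))
  · have := congrFun h x
    simpa [glueFin] using this
  · have hx : (x : Fin n) ∉ C := fun hC => Finset.disjoint_left.1 hCD hC x.2
    have := congrFun h x
    simp only [glueFin, hx, x.2, dite_true, dite_false, Fin.mk.injEq, Nat.add_left_cancel_iff] at this
    exact Fin.ext this
  · have hx : (x : Fin n) ∉ C ∧ (x : Fin n) ∉ D := by simpa using x.2
    have := congrFun h x
    simpa [glueFin, hx.1, hx.2] using this

theorem separates_truncateFin_glueFin {n t k : ℕ} (htk : t ≤ k) {C D : Finset (Fin n)}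
    (hCD : Disjoint C D)
    (q : (C ≃ Fin t) × (D → Fin (k - t)) × ({x // x ∉ C ∪ D} → Fin k)) :
    Separates C D (truncateFin t ∘ glueFin htk C D q) := by
  refine ⟨?_, fun x hx => ?_⟩
  · ext i
    simp only [Finset.mem_image, Finset.mem_erase, Finset.mem_univ, and_true, Function.comp]
    constructor
    · rintro ⟨x, hx, rfl⟩ h
      have := congrArg Fin.val h
      simp [truncateFin, glueFin, hx] at this
      have := (q.1 ⟨x, hx⟩).2
      lia
    · intro hi
      have hit : (i : ℕ) < t := by
        have := Fin.val_lt_last hi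
        simpa using this
      refine ⟨q.1.symm ⟨i, hit⟩, (q.1.symm ⟨i, hit⟩).2, Fin.ext ?_⟩
      simp [truncateFin, glueFin]
      lia
  · have hC : x ∉ C := fun hC => Finset.disjoint_left.1 hCD hC hx
    refine Fin.ext ?_
    simp [truncateFin, glueFin, hC, hx]

open Finset in
open Classical in
/-- Many functions into `Fin k` separate `C` from `D` after truncation. -/
theorem le_card_separates {n t k : ℕ} (htk : t ≤ k) {C D : Finset (Fin n)}
    (hCD : Disjoint C D) (hC : #C = t) (hD : #D = k - t) :
    t.factorial * (k - t) ^ (k - t) * k ^ (n - k) ≤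
      #{g : Fin n → Fin k | Separates C D (truncateFin t ∘ g)} := by
  have hcard : Fintype.card
      ((C ≃ Fin t) × (D → Fin (k - t)) × ({x // x ∉ C ∪ D} → Fin k)) =
      t.factorial * (k - t) ^ (k - t) * k ^ (n - k) := by
    have hU : #(C ∪ D) = k := by
      rw [card_union_of_disjoint hCD]
      lia
    have e : C ≃ Fin t := Fintype.equivFinOfCardEq (by simpa using hC)
    have hrest : Fintype.card {x // x ∉ C ∪ D} = n - k := by
      rw [Fintype.card_subtype_compl, Fintype.card_fin, Fintype.card_coe, hU]
    rw [Fintype.card_prod, Fintype.card_prod, Fintype.card_equiv e, Fintype.card_fun,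
      Fintype.card_fun, hrest, Fintype.card_coe, Fintype.card_coe, hC, hD, Fintype.card_fin,
      Fintype.card_fin, mul_assoc]
  rw [← hcard, ← card_univ, ← card_image_of_injective _ (glueFin_injective htk hCD)]
  refine card_le_card fun g hg => ?_
  obtain ⟨q, -, rfl⟩ := mem_image.1 hg
  exact mem_filter.2 ⟨mem_univ _, separates_truncateFin_glueFin htk hCD q⟩

open Finset in
/-- A minimal separating family of size `N` exists once `N` exceeds
`k log n` over the success probability of a random function. -/
theorem exists_isMinSep_card_le {n t k : ℕ} (htk : t < k) (hkn : k ≤ n) (N : ℕ)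
    (hN : k * Real.log n <
      (t.factorial * (k - t : ℕ) ^ (k - t) / (k : ℝ) ^ k) * N) :
    ∃ H : Finset (Fin n → Fin (t + 1)), IsMinSep n t k H ∧ #H ≤ N := by
  classical
  have hk : 0 < k := by lia
  have : NeZero k := ⟨hk.ne'⟩
  let X : Finset (Finset (Fin n) × Finset (Fin n)) :=
    {c ∈ powersetCard t univ ×ˢ powersetCard (k - t) univ | Disjoint c.1 c.2}
  have hXcard : #X ≤ n ^ k := by
    calc #X ≤ #(powersetCard t (univ : Finset (Fin n)) ×ˢ
          powersetCard (k - t) (univ : Finset (Fin n))) := card_filter_le _ _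
      _ = n.choose t * n.choose (k - t) := by simp
      _ ≤ n ^ t * n ^ (k - t) := by
          gcongr <;> exact Nat.choose_le_pow _ _
      _ = n ^ k := by rw [← pow_add]; congr 1; lia
  have hp : t.factorial * (k - t : ℕ) ^ (k - t) / (k : ℝ) ^ k ≤ 1 := by
    rw [div_le_one (by positivity)]
    have : t.factorial * (k - t) ^ (k - t) ≤ k ^ k := by
      calc t.factorial * (k - t) ^ (k - t) ≤ k ^ t * k ^ (k - t) := by
            gcongr
            · exact (Nat.factorial_le_pow t).trans (Nat.pow_le_pow_left htk.le t)
            · lia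
        _ = k ^ k := by rw [← pow_add]; congr 1; lia
    exact_mod_cast this
  have hcover := exists_cover_of_card_lt_exp
    (fun (c : Finset (Fin n) × Finset (Fin n)) (g : Fin n → Fin k) =>
      Separates c.1 c.2 (truncateFin t ∘ g)) _ hp X ?_ N ?_
  · obtain ⟨S, hS, hcov⟩ := hcover
    refine ⟨S.image (truncateFin t ∘ ·), fun C D hCD hC hD => ?_, card_image_le.trans hS⟩
    obtain ⟨E, hDE, hEC, hE⟩ := exists_subsuperset_card_eq (s := D) (t := Cᶜ) (n := k - t)
      (subset_compl_iff_disjoint_left.2 hCD) hD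
      (by rw [card_compl, Fintype.card_fin]; lia)
    obtain ⟨g, hg, h1, h2⟩ := hcov (C, E) (by
      simp only [X, mem_filter, mem_product, mem_powersetCard_univ]
      exact ⟨⟨hC, hE⟩, subset_compl_iff_disjoint_left.1 hEC⟩)
    exact ⟨_, mem_image_of_mem _ hg, h1, fun x hx => h2 x (hDE hx)⟩
  · rintro ⟨C, D⟩ hc
    simp only [X, mem_filter, mem_product, mem_powersetCard_univ] at hc
    have h := le_card_separates htk.le hc.2 hc.1.1 hc.1.2
    have hpow : (k : ℝ) ^ n = k ^ k * k ^ (n - k) := by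
      rw [← pow_add]; congr 1; lia
    calc (t.factorial * (k - t : ℕ) ^ (k - t) / (k : ℝ) ^ k) * Fintype.card (Fin n → Fin k)
        = ((t.factorial * (k - t) ^ (k - t) * k ^ (n - k) : ℕ) : ℝ) := by
          rw [Fintype.card_fun, Fintype.card_fin, Fintype.card_fin]
          push_cast
          rw [hpow]
          field_simp
      _ ≤ _ := by exact_mod_cast h
  · have hn : (0 : ℝ) < n := by exact_mod_cast (by lia : 0 < n)
    calc (#X : ℝ) ≤ (n : ℝ) ^ k := by exact_mod_cast hXcard
      _ = Real.exp (k * Real.log n) := by rw [Real.exp_nat_mul, Real.exp_log hn]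
      _ < _ := Real.exp_lt_exp.2 hN

/-- The inverse success probability is at most `(k / t) ^ t * 2 ^ (4 t)`. -/
theorem pow_div_factorial_mul_pow_le {t k : ℕ} (ht : 0 < t) (htk : t < k) :
    (k : ℝ) ^ k / (t.factorial * (k - t : ℕ) ^ (k - t)) ≤ ((k : ℝ) / t) ^ t * 2 ^ (4 * t) := by
  obtain ⟨m, rfl⟩ := Nat.exists_eq_add_of_lt htk
  set s := m + 1 with hs
  have hsub : t + m + 1 - t = s := by lia
  have hts : t + m + 1 = t + s := by lia
  rw [hsub, hts]
  have hs0 : (0 : ℝ) < s := by exact_mod_cast Nat.succ_pos m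
  have ht0 : (0 : ℝ) < t := by exact_mod_cast ht
  have h1 : (t : ℝ) ^ t / t.factorial ≤ Real.exp t :=
    Real.pow_div_factorial_le_exp _ ht0.le t
  have h2 : (((t + s : ℕ) : ℝ) / s) ^ s ≤ Real.exp t := by
    calc (((t + s : ℕ) : ℝ) / s) ^ s = (t / s + 1 : ℝ) ^ s := by
          push_cast
          rw [add_div, div_self hs0.ne']
      _ ≤ Real.exp (t / s) ^ s := by
          gcongr
          exact Real.add_one_le_exp _
      _ = Real.exp t := by
          rw [← Real.exp_nat_mul]
          field_simp
  have h3 : Real.exp t ≤ 4 ^ t := by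
    rw [← Real.exp_one_pow]
    gcongr
    linarith [Real.exp_one_lt_d9]
  calc ((t + s : ℕ) : ℝ) ^ (t + s) / (t.factorial * (s : ℝ) ^ s)
      = (((t + s : ℕ) : ℝ) / t) ^ t * ((t : ℝ) ^ t / t.factorial *
          (((t + s : ℕ) : ℝ) / s) ^ s) := by
        rw [pow_add, div_pow, div_pow]
        field_simp
    _ ≤ (((t + s : ℕ) : ℝ) / t) ^ t * (4 ^ t * 4 ^ t) := by
        gcongr
        · exact h1.trans h3
        · exact h2.trans h3
    _ = _ := by
        rw [← mul_pow, pow_mul]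
        norm_num

/-- For every `ε > 0` there are `C > 0` and `t₀` such that for all
`t₀ ≤ t < k ≤ n` there is a `(t,k)`-minimal separating family of size at most
`k^C · (k/t)^{(1+ε)t} · 2^{Ct} · log₂ n`. -/
theorem minsep_exists :
    ∀ ε : ℝ, 0 < ε → ∃ C : ℝ, 0 < C ∧ ∃ t₀ : ℕ, ∀ t k n : ℕ,
      t₀ ≤ t → t < k → k ≤ n →
      ∃ H : Finset (Fin n → Fin (t + 1)), IsMinSep n t k H ∧
        (H.card : ℝ) ≤ (k : ℝ) ^ C * ((k : ℝ) / t) ^ ((1 + ε) * t) *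
          2 ^ (C * t) * Real.logb 2 n := by
  intro ε hε
  refine ⟨4, by norm_num, 1, fun t k n ht htk hkn => ?_⟩
  have ht0 : (0 : ℝ) < t := by exact_mod_cast ht
  have hk2 : (2 : ℝ) ≤ k := by exact_mod_cast (by lia : 2 ≤ k)
  have hn2 : (2 : ℝ) ≤ n := by exact_mod_cast (by lia : 2 ≤ n)
  have hlogb : 1 ≤ Real.logb 2 n := by
    rw [Real.le_logb_iff_rpow_le (by norm_num) (by linarith)]
    simpa using hn2
  have hlog : Real.log n ≤ Real.logb 2 n := by
    rw [Real.logb, le_div_iff₀ (Real.log_pos (by norm_num))]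
    have := Real.log_two_lt_d9
    have := Real.log_nonneg (by linarith : (1 : ℝ) ≤ n)
    nlinarith
  have hkt : 1 ≤ (k : ℝ) / t := by
    rw [one_le_div ht0]
    exact_mod_cast htk.le
  have hsub : (0 : ℝ) < (k - t : ℕ) := by exact_mod_cast (by lia : 0 < k - t)
  set p : ℝ := t.factorial * (k - t : ℕ) ^ (k - t) / (k : ℝ) ^ k with hp
  have hp0 : 0 < p := by positivity
  set B : ℝ := ((k : ℝ) / t) ^ t * 2 ^ (4 * t) with hB
  have hpB : 1 / p ≤ B := by
    rw [hp, one_div_div]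
    exact pow_div_factorial_mul_pow_le ht htk
  have hB1 : 1 ≤ B := one_le_mul_of_one_le_of_one_le (one_le_pow₀ hkt) (one_le_pow₀ (by norm_num))
  obtain ⟨H, hH, hcard⟩ := exists_isMinSep_card_le htk hkn (⌊k * Real.log n / p⌋₊ + 1) (by
    rw [← div_lt_iff₀' hp0]
    exact_mod_cast Nat.lt_floor_add_one _)
  refine ⟨H, hH, ?_⟩
  have hlog0 : 0 ≤ Real.log n := Real.log_nonneg (by linarith)
  have hkL : 1 ≤ k * Real.logb 2 n := by nlinarith
  calc (H.card : ℝ) ≤ ((⌊k * Real.log n / p⌋₊ + 1 : ℕ) : ℝ) := by exact_mod_cast hcard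
    _ ≤ k * Real.log n * (1 / p) + 1 := by
        push_cast
        rw [mul_one_div]
        gcongr
        exact Nat.floor_le (by positivity)
    _ ≤ k * Real.logb 2 n * B + k * Real.logb 2 n * B := by
        gcongr
        exact one_le_mul_of_one_le_of_one_le hkL hB1
    _ = 2 * k * B * Real.logb 2 n := by ring
    _ ≤ k ^ 4 * (((k : ℝ) / t) ^ ((1 + ε) * t) * 2 ^ (4 * t)) * Real.logb 2 n := by
        gcongr
        · nlinarith [mul_nonneg (sq_nonneg (k : ℝ)) (sub_nonneg.2 hk2),
            pow_le_pow_right₀ (by linarith : (1 : ℝ) ≤ k) (by norm_num : 2 ≤ 4)]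
        · rw [hB]
          gcongr
          rw [← Real.rpow_natCast]
          exact Real.rpow_le_rpow_of_exponent_le hkt (by nlinarith)
    _ = _ := by
        have e1 : (k : ℝ) ^ (4 : ℝ) = k ^ 4 := by exact_mod_cast Real.rpow_natCast (k : ℝ) 4
        have e2 : (2 : ℝ) ^ ((4 : ℝ) * t) = 2 ^ (4 * t) := by
          exact_mod_cast Real.rpow_natCast 2 (4 * t)
        rw [e1, e2]
        ring
end

section
/- Fix integers n, r, k with 1 < r ≤ k ≤ n and let t := ⌊2k/r⌋. If there exists a (t,k)-minimal separating family H of functions from {1,…,n} to {1,…,t+1}, then there exists an (n,r,k)-multiset separator of size at most |H| · (r+1)^t. -/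
/-- If `s` sums to at most `k`, at most `2k/r` entries exceed `r/2`, and these entries extend to a
set of exactly `2k/r` indices leaving at most `k - 2k/r` indices of the support uncovered. -/
lemma exists_cover_large_entries {n r k : ℕ} (hr : 1 < r) (hkn : k ≤ n) (s : Fin n → ℕ)
    (hs : ∑ i, s i ≤ k) :
    ∃ C : Finset (Fin n), C.card = 2 * k / r ∧ (∀ i, r < 2 * s i → i ∈ C) ∧
      ((Finset.univ.filter fun i => s i ≠ 0) \ C).card ≤ k - 2 * k / r := by
  set L := Finset.univ.filter fun i => r < 2 * s i with hL
  set S := Finset.univ.filter fun i => s i ≠ 0 with hS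
  have hLS : L ⊆ S := by
    intro i
    simp only [hL, hS, Finset.mem_filter, Finset.mem_univ, true_and]
    omega
  have hLcard : L.card ≤ 2 * k / r := by
    rw [Nat.le_div_iff_mul_le (by omega)]
    calc L.card * r = ∑ _i ∈ L, r := by simp
      _ ≤ ∑ i ∈ L, 2 * s i :=
        Finset.sum_le_sum fun i hi => (Finset.mem_filter.1 hi).2.le
      _ ≤ ∑ i, 2 * s i :=
        Finset.sum_le_sum_of_subset (Finset.subset_univ L)
      _ ≤ 2 * k := by rw [← Finset.mul_sum]; omega
  have hScard : S.card ≤ k := by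
    calc S.card = ∑ _i ∈ S, 1 := by simp
      _ ≤ ∑ i ∈ S, s i :=
        Finset.sum_le_sum fun i hi => Nat.one_le_iff_ne_zero.2 (Finset.mem_filter.1 hi).2
      _ ≤ ∑ i, s i := Finset.sum_le_sum_of_subset (Finset.subset_univ S)
      _ ≤ k := hs
  have htk : 2 * k / r ≤ k := Nat.div_le_of_le_mul (Nat.mul_le_mul_right k hr)
  rcases le_total (2 * k / r) S.card with h | h
  · obtain ⟨C, hLC, hCS, hC⟩ := Finset.exists_subsuperset_card_eq hLS hLcard h
    refine ⟨C, hC, fun i hi => hLC (by simpa [hL] using hi), ?_⟩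
    rw [Finset.card_sdiff_of_subset hCS]
    omega
  · obtain ⟨C, hSC, -, hC⟩ := Finset.exists_subsuperset_card_eq (Finset.subset_univ S) h
      (by simpa using htk.trans hkn)
    refine ⟨C, hC, fun i hi => hSC (hLS (by simpa [hL] using hi)), ?_⟩
    simp [Finset.sdiff_eq_empty_iff_subset.2 hSC]

/-- The vector taking the value `v j` on the `j`-th colour class of `h`, and `r / 2` on the last
one. -/
def colourVector {n t : ℕ} (r : ℕ) (h : Fin n → Fin (t + 1)) (v : Fin t → Fin (r + 1)) :
    Fin n → ℕ :=
  fun i => Fin.snoc (α := fun _ => ℕ) (fun j => (v j : ℕ)) (r / 2) (h i)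

lemma colourVector_le {n t r : ℕ} (h : Fin n → Fin (t + 1)) (v : Fin t → Fin (r + 1))
    (i : Fin n) : colourVector r h v i ≤ r := by
  unfold colourVector
  cases h i using Fin.lastCases with
  | last => simpa using Nat.div_le_self r 2
  | cast j => simpa using Nat.lt_succ_iff.1 (v j).2

lemma colourVector_of_eq_last {n t r : ℕ} {h : Fin n → Fin (t + 1)} {v : Fin t → Fin (r + 1)}
    {i : Fin n} (hi : h i = Fin.last t) : colourVector r h v i = r / 2 := by
  simp [colourVector, hi]

/-- Prescribed values on a set that `h` maps bijectively onto the non-last colours are attained. -/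
lemma exists_colourVector_eq_on {n t r : ℕ} (h : Fin n → Fin (t + 1)) (C : Finset (Fin n))
    (hC : C.card = t)
    (him : C.image h = (Finset.univ : Finset (Fin (t + 1))).erase (Fin.last t))
    (A : Fin n → ℕ) (hA : ∀ i, A i ≤ r) :
    ∃ v : Fin t → Fin (r + 1), ∀ i ∈ C, colourVector r h v i = A i := by
  have hinj : Set.InjOn h C := by
    rw [← Finset.card_image_iff, him, Finset.card_erase_of_mem (Finset.mem_univ _), hC]
    simp
  have hsurj : ∀ j : Fin t, ∃ c ∈ C, h c = j.castSucc := by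
    intro j
    rw [← Finset.mem_image, him]
    simp
  choose c hcC hc using hsurj
  refine ⟨fun j => ⟨A (c j), Nat.lt_succ_iff.2 (hA _)⟩, fun i hi => ?_⟩
  have hne : h i ≠ Fin.last t :=
    Finset.ne_of_mem_erase (him ▸ Finset.mem_image_of_mem h hi)
  obtain ⟨j, hj⟩ := Fin.exists_castSucc_eq.2 hne
  have hij : c j = i := hinj (hcC j) hi ((hc j).trans hj)
  simp [colourVector, ← hj, hij]

/-- An `(n,r,k)`-multiset separator: a family `𝓕` of vectors in `{0,…,r}^n` such
that for every pair of `(r,k)`-compatible `(r,k)`-multisets `A, B` (i.e. `A, B`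
have multiplicities at most `r`, sizes at most `k`, `A + B` has multiplicities at
most `r` and `|A + B| = k`) there is `F ∈ 𝓕` with `A ≤ F ≤ r − B` coordinatewise. -/
def IsMultisetSep (n r k : ℕ) (𝓕 : Finset (Fin n → ℕ)) : Prop :=
  (∀ F ∈ 𝓕, ∀ i, F i ≤ r) ∧
  ∀ A B : Fin n → ℕ,
    (∀ i, A i ≤ r) → (∑ i, A i) ≤ k →
    (∀ i, B i ≤ r) → (∑ i, B i) ≤ k →
    (∀ i, A i + B i ≤ r) → (∑ i, (A i + B i)) = k →
    ∃ F ∈ 𝓕, ∀ i, A i ≤ F i ∧ F i ≤ r - B i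

/-- From a `(t,k)`-minimal separating family with `t = ⌊2k/r⌋` one obtains an
`(n,r,k)`-multiset separator of size at most `|H|·(r+1)^t`. -/
theorem minsep_to_multiset_sep (n r k : ℕ) (hr : 1 < r) (hrk : r ≤ k) (hkn : k ≤ n)
    (H : Finset (Fin n → Fin (2 * k / r + 1))) (hH : IsMinSep n (2 * k / r) k H) :
    ∃ 𝓕 : Finset (Fin n → ℕ), IsMultisetSep n r k 𝓕 ∧
      𝓕.card ≤ H.card * (r + 1) ^ (2 * k / r) := by
  classical
  refine ⟨(H ×ˢ Finset.univ).image fun p => colourVector r p.1 p.2, ⟨?_, ?_⟩, ?_⟩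
  · intro F hF i
    obtain ⟨p, -, rfl⟩ := Finset.mem_image.1 hF
    exact colourVector_le p.1 p.2 i
  · intro A B hA _ _ _ hAB hsum
    obtain ⟨C, hC, hlarge, hD⟩ :=
      exists_cover_large_entries hr hkn (fun i => A i + B i) hsum.le
    obtain ⟨h, hhH, him, hlast⟩ := hH C _ Finset.disjoint_sdiff hC hD
    obtain ⟨v, hv⟩ := exists_colourVector_eq_on h C hC him A hA
    refine ⟨colourVector r h v,
      Finset.mem_image.2 ⟨(h, v), by simp [hhH], rfl⟩, fun i => ?_⟩
    have hABi := hAB i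
    have hle := colourVector_le h v i
    by_cases hiC : i ∈ C
    · rw [hv i hiC]
      omega
    · by_cases hi : A i + B i = 0
      · omega
      · have hmid := colourVector_of_eq_last (v := v)
          (hlast i (Finset.mem_sdiff.2 ⟨by simpa using hi, hiC⟩))
        have hsmall := mt (hlarge i) hiC
        omega
  · refine Finset.card_image_le.trans ?_
    simp [Finset.card_product]
end

section
/- For every ε > 0 there exist a constant C > 0 and an integer T₀ such that for all integers n, r, k with 1 < r ≤ k ≤ n and ⌊2k/r⌋ ≥ T₀, there exists an (n,r,k)-multiset separator of size at most k^C · r^{(4+ε)·k/r} · 2^{C·k/r} · log₂ n. -/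
open Finset in
/-- Greedy covering: if every `j ∈ P` is related to at least a `p`-fraction of `U`, then some `m`
elements of `U` leave at most a `(1 - p) ^ m`-fraction of `P` uncovered. -/
theorem exists_greedy_cover_s18 {ι Ω : Type*} [DecidableEq Ω] (R : ι → Ω → Prop)
    [∀ j x, Decidable (R j x)] (P : Finset ι) (U : Finset Ω) (hU : U.Nonempty) (p : ℝ)
    (hp : p ≤ 1) (h : ∀ j ∈ P, p * (#U : ℝ) ≤ #{x ∈ U | R j x}) (m : ℕ) :
    ∃ F ⊆ U, #F ≤ m ∧ (#{j ∈ P | ∀ x ∈ F, ¬ R j x} : ℝ) ≤ (1 - p) ^ m * #P := by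
  induction m with
  | zero => exact ⟨∅, by simp, by simp, by simp⟩
  | succ m ih =>
    obtain ⟨F, hFU, hFm, hF⟩ := ih
    set Q := {j ∈ P | ∀ x ∈ F, ¬ R j x} with hQ
    have hcount : ∑ x ∈ U, (p * #Q : ℝ) ≤ ∑ x ∈ U, (#{j ∈ Q | R j x} : ℝ) := by
      have hdouble : ∑ x ∈ U, #{j ∈ Q | R j x} = ∑ j ∈ Q, #{x ∈ U | R j x} :=
        (sum_card_bipartiteAbove_eq_sum_card_bipartiteBelow (s := Q) (t := U) R).symm
      have hsum : ∑ j ∈ Q, (p * #U : ℝ) ≤ ∑ j ∈ Q, (#{x ∈ U | R j x} : ℝ) :=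
        sum_le_sum fun j hj => h j (mem_filter.1 hj).1
      have hdouble' : ∑ x ∈ U, (#{j ∈ Q | R j x} : ℝ) = ∑ j ∈ Q, (#{x ∈ U | R j x} : ℝ) := by
        exact_mod_cast hdouble
      rw [hdouble']
      refine le_trans (le_of_eq ?_) hsum
      simp only [sum_const, nsmul_eq_mul]
      ring
    obtain ⟨x, hxU, hx⟩ := exists_le_of_sum_le hU hcount
    refine ⟨insert x F, insert_subset hxU hFU, (card_insert_le _ _).trans (by omega), ?_⟩
    have hsplit : #{j ∈ Q | R j x} + #{j ∈ Q | ¬ R j x} = #Q :=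
      card_filter_add_card_filter_not _
    have hset : {j ∈ P | ∀ y ∈ insert x F, ¬ R j y} = {j ∈ Q | ¬ R j x} := by
      ext j
      simp only [hQ, mem_filter, forall_mem_insert]
      tauto
    rw [hset]
    have hsplit' : (#{j ∈ Q | R j x} : ℝ) + #{j ∈ Q | ¬ R j x} = #Q := by exact_mod_cast hsplit
    calc (#{j ∈ Q | ¬ R j x} : ℝ) ≤ (1 - p) * #Q := by linarith
      _ ≤ (1 - p) * ((1 - p) ^ m * #P) := by gcongr
      _ = (1 - p) ^ (m + 1) * #P := by ring

open Finset in
theorem card_piAntidiag_univ_le {α : Type*} [Fintype α] [DecidableEq α] (k : ℕ) :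
    #(piAntidiag (univ : Finset α) k) ≤ Fintype.card α ^ k := by
  have h := sum_pow_eq_sum_piAntidiag (univ : Finset α) (fun _ => (1 : ℕ)) k
  simp only [sum_const, card_univ, smul_eq_mul, mul_one, one_pow, prod_const_one,
    Nat.cast_id] at h
  rw [h, card_eq_sum_ones]
  exact sum_le_sum fun f _ => Nat.multinomial_pos _ _

theorem rpow_neg_div_le_one_sub_div {r s : ℝ} (hr : 0 < r) (hs : 0 ≤ s) (hsr : s ≤ r) :
    (r + 1) ^ (-(s / r)) ≤ 1 - s / (r + 1) := by
  have h := Real.geom_mean_le_arith_mean2_weighted (w₁ := s / r) (w₂ := 1 - s / r)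
    (p₁ := (r + 1)⁻¹) (p₂ := 1) (by positivity) (by rw [sub_nonneg, div_le_one hr]; exact hsr)
    (by positivity) zero_le_one (by ring)
  rw [Real.one_rpow, mul_one, mul_one, Real.inv_rpow (by positivity),
    ← Real.rpow_neg (by positivity)] at h
  refine h.trans (le_of_eq ?_)
  field_simp
  ring

open Finset in
/-- A uniformly random vector separates a compatible pair with probability at least
`(r + 1) ^ (-k / r)`. -/
theorem rpow_mul_card_le_card_separating {n r k : ℕ} (hr : 0 < r) (A B : Fin n → ℕ)
    (hAB : ∀ i, A i + B i ≤ r) (hk : ∑ i, (A i + B i) = k) :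
    ((r : ℝ) + 1) ^ (-((k : ℝ) / r)) * #(Fintype.piFinset fun _ : Fin n => range (r + 1)) ≤
      #{F ∈ Fintype.piFinset fun _ : Fin n => range (r + 1) |
        ∀ i, A i ≤ F i ∧ F i ≤ r - B i} := by
  have hset : {F ∈ Fintype.piFinset fun _ : Fin n => range (r + 1) |
      ∀ i, A i ≤ F i ∧ F i ≤ r - B i} = Fintype.piFinset fun i => Icc (A i) (r - B i) := by
    ext F
    simp only [mem_filter, Fintype.mem_piFinset, mem_range, mem_Icc]
    refine ⟨fun h => h.2, fun h => ⟨fun i => ?_, h⟩⟩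
    have := (h i).2
    omega
  rw [hset, Fintype.card_piFinset, Fintype.card_piFinset]
  have hr' : (0 : ℝ) < r := by exact_mod_cast hr
  have hpow : ((r : ℝ) + 1) ^ (-((k : ℝ) / r)) =
      ∏ i, ((r : ℝ) + 1) ^ (-(((A i + B i : ℕ) : ℝ) / r)) := by
    rw [← Real.rpow_sum_of_pos (by positivity), ← hk, sum_neg_distrib, ← sum_div]
    push_cast
    rfl
  rw [hpow]
  push_cast
  rw [← prod_mul_distrib]
  refine prod_le_prod (fun i _ => by positivity) fun i _ => ?_
  have hi : ((A i : ℝ) + B i) ≤ r := by exact_mod_cast hAB i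
  have hcard : (#(Icc (A i) (r - B i)) : ℝ) = r + 1 - (A i + B i) := by
    have : #(Icc (A i) (r - B i)) + (A i + B i) = r + 1 := by
      rw [Nat.card_Icc]
      have := hAB i
      omega
    rw [eq_sub_iff_add_eq]
    exact_mod_cast this
  rw [hcard, card_range]
  have h := rpow_neg_div_le_one_sub_div hr' (by positivity : (0 : ℝ) ≤ A i + B i) hi
  push_cast
  calc ((r : ℝ) + 1) ^ (-(((A i : ℝ) + B i) / r)) * (r + 1)
      ≤ (1 - ((A i : ℝ) + B i) / (r + 1)) * (r + 1) := by gcongr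
    _ = r + 1 - (A i + B i) := by field_simp

open Finset in
theorem exists_isMultisetSep_card_le {n r k : ℕ} (hr : 0 < r) (hn : 0 < n) :
    ∃ 𝓕 : Finset (Fin n → ℕ), IsMultisetSep n r k 𝓕 ∧
      (#𝓕 : ℝ) ≤ ((r : ℝ) + 1) ^ ((k : ℝ) / r) * (k * Real.log (2 * n)) + 1 := by
  set q : ℝ := ((r : ℝ) + 1) ^ ((k : ℝ) / r) with hq
  have hq1 : 1 ≤ q := Real.one_le_rpow (by simp) (by positivity)
  have hq0 : 0 < q := by linarith
  have hneg : ((r : ℝ) + 1) ^ (-((k : ℝ) / r)) = q⁻¹ := Real.rpow_neg (by positivity) _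
  set U := Fintype.piFinset fun _ : Fin n => range (r + 1)
  set P := {f ∈ piAntidiag (univ : Finset (Fin n ⊕ Fin n)) k |
    ∀ i, f (Sum.inl i) + f (Sum.inr i) ≤ r}
  set m := ⌊q * (k * Real.log (2 * n))⌋₊ + 1 with hm
  have hn' : (1 : ℝ) ≤ n := by exact_mod_cast hn
  have hlog : 0 ≤ Real.log (2 * n) := Real.log_nonneg (by linarith)
  obtain ⟨F, hFU, hFm, hF⟩ := exists_greedy_cover_s18
    (fun (f : Fin n ⊕ Fin n → ℕ) (x : Fin n → ℕ) =>
      ∀ i, f (Sum.inl i) ≤ x i ∧ x i ≤ r - f (Sum.inr i)) P U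
    ⟨fun _ => 0, by simp [U]⟩ q⁻¹ (inv_le_one_of_one_le₀ hq1)
    (fun f hf => by
      obtain ⟨hf₁, hf₂⟩ := mem_filter.1 hf
      have hsum := (mem_piAntidiag.1 hf₁).1
      rw [Fintype.sum_sum_type, ← sum_add_distrib] at hsum
      have := rpow_mul_card_le_card_separating hr (fun i => f (Sum.inl i))
        (fun i => f (Sum.inr i)) hf₂ hsum
      rwa [hneg] at this) m
  refine ⟨F, ⟨fun f hf i => ?_, fun A B _ _ _ _ hAB hk => ?_⟩, ?_⟩
  · have := Fintype.mem_piFinset.1 (hFU hf) i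
    rw [mem_range] at this
    omega
  · have hP : (#P : ℝ) ≤ Real.exp (k * Real.log (2 * n)) := by
      have h : #P ≤ (2 * n) ^ k := (card_filter_le _ _).trans <|
        (card_piAntidiag_univ_le k).trans_eq (by simp [two_mul])
      rw [mul_comm, Real.exp_mul, Real.exp_log (by linarith), Real.rpow_natCast]
      exact_mod_cast h
    have hdecay : (1 - q⁻¹) ^ m ≤ Real.exp (-(q⁻¹ * m)) := by
      calc (1 - q⁻¹) ^ m ≤ Real.exp (-q⁻¹) ^ m := by
            gcongr
            · exact sub_nonneg.2 (inv_le_one_of_one_le₀ hq1)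
            · exact Real.one_sub_le_exp_neg _
        _ = Real.exp (-(q⁻¹ * m)) := by rw [← Real.exp_nat_mul]; ring_nf
    have hlt : k * Real.log (2 * n) < q⁻¹ * m := by
      rw [inv_mul_eq_div, lt_div_iff₀ hq0, mul_comm, hm]
      exact_mod_cast Nat.lt_floor_add_one _
    have hone : (#{f ∈ P | ∀ x ∈ F, ¬ ∀ i, f (Sum.inl i) ≤ x i ∧ x i ≤ r - f (Sum.inr i)} : ℝ)
        < 1 := by
      refine hF.trans_lt ?_
      calc (1 - q⁻¹) ^ m * #P
          ≤ Real.exp (-(q⁻¹ * m)) * Real.exp (k * Real.log (2 * n)) := by gcongr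
        _ = Real.exp (-(q⁻¹ * m) + k * Real.log (2 * n)) := (Real.exp_add _ _).symm
        _ < 1 := Real.exp_lt_one_iff.2 (by linarith)
    have hempty := card_eq_zero.1 (Nat.lt_one_iff.1 (by exact_mod_cast hone))
    have hmem : Sum.elim A B ∈ P := by
      refine mem_filter.2 ⟨mem_piAntidiag.2 ⟨?_, by simp⟩, by simpa using hAB⟩
      rw [Fintype.sum_sum_type, ← hk, sum_add_distrib]
      simp
    have := filter_eq_empty_iff.1 hempty hmem
    push Not at this
    simpa using this
  · calc (#F : ℝ) ≤ m := by exact_mod_cast hFm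
      _ ≤ q * (k * Real.log (2 * n)) + 1 := by
        rw [hm]
        push_cast
        gcongr
        exact Nat.floor_le (by positivity)

/-- For every `ε > 0` there are `C > 0` and `T₀` such that for all
`1 < r ≤ k ≤ n` with `⌊2k/r⌋ ≥ T₀` there is an `(n,r,k)`-multiset separator of
size at most `k^C · r^{(4+ε)k/r} · 2^{Ck/r} · log₂ n`. -/
theorem multiset_sep_exists :
    ∀ ε : ℝ, 0 < ε → ∃ C : ℝ, 0 < C ∧ ∃ T₀ : ℕ, ∀ n r k : ℕ,
      1 < r → r ≤ k → k ≤ n → T₀ ≤ 2 * k / r →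
      ∃ 𝓕 : Finset (Fin n → ℕ), IsMultisetSep n r k 𝓕 ∧
        (𝓕.card : ℝ) ≤ (k : ℝ) ^ C * (r : ℝ) ^ ((4 + ε) * k / r) *
          2 ^ (C * k / r) * Real.logb 2 n := by
  intro ε hε
  refine ⟨3, by norm_num, 0, fun n r k hr hrk hkn _ => ?_⟩
  obtain ⟨𝓕, hsep, hcard⟩ := exists_isMultisetSep_card_le (n := n) (r := r) (k := k)
    (by omega) (by omega)
  refine ⟨𝓕, hsep, hcard.trans ?_⟩
  have hr2 : (2 : ℝ) ≤ r := by exact_mod_cast hr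
  have hk2 : (2 : ℝ) ≤ k := by exact_mod_cast hr.trans_le hrk
  have hn2 : (2 : ℝ) ≤ n := by exact_mod_cast (hr.trans_le hrk).trans_le hkn
  set q : ℝ := ((r : ℝ) + 1) ^ ((k : ℝ) / r) with hq
  have hq1 : 1 ≤ q := Real.one_le_rpow (by linarith) (by positivity)
  have hlog2 : Real.log 2 ≤ 1 := by linarith [Real.log_two_lt_d9]
  have hlogn : Real.log 2 ≤ Real.log n := Real.log_le_log (by norm_num) hn2
  have hlog2n : Real.log (2 * n) = Real.log 2 + Real.log n :=
    Real.log_mul (by norm_num) (by linarith)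
  have hlogb : Real.log n ≤ Real.logb 2 n := by
    rw [Real.logb, le_div_iff₀ (Real.log_pos (by norm_num))]
    exact mul_le_of_le_one_right (by linarith [Real.log_two_gt_d9]) hlog2
  have hone : 1 ≤ q * (k * Real.log (2 * n)) := by
    have h1 : 1 ≤ Real.log (2 * n) := by linarith [Real.log_two_gt_d9]
    exact one_le_mul_of_one_le_of_one_le hq1
      (one_le_mul_of_one_le_of_one_le (by linarith) h1)
  have hL : 0 ≤ Real.logb 2 n := by linarith [Real.log_two_gt_d9]
  have hqle : q ≤ (r : ℝ) ^ ((4 + ε) * k / r) * 2 ^ (3 * (k : ℝ) / r) := by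
    calc q ≤ ((r : ℝ) * 2) ^ ((k : ℝ) / r) := by
          rw [hq]
          gcongr
          linarith
      _ = (r : ℝ) ^ ((k : ℝ) / r) * 2 ^ ((k : ℝ) / r) :=
          Real.mul_rpow (by positivity) (by norm_num)
      _ ≤ _ := by
          gcongr
          · linarith
          · nlinarith
          · norm_num
          · linarith
  have hk3 : 4 * (k : ℝ) ≤ (k : ℝ) ^ (3 : ℝ) := by
    rw [show (3 : ℝ) = ((3 : ℕ) : ℝ) by norm_num, Real.rpow_natCast]
    nlinarith [mul_nonneg (sub_nonneg.2 hk2) (sub_nonneg.2 hk2)]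
  calc q * (k * Real.log (2 * n)) + 1 ≤ 2 * (q * (k * Real.log (2 * n))) := by linarith
    _ ≤ 2 * (q * (k * (2 * Real.logb 2 n))) := by
        gcongr
        linarith
    _ = 4 * (k : ℝ) * q * Real.logb 2 n := by ring
    _ ≤ (k : ℝ) ^ (3 : ℝ) * ((r : ℝ) ^ ((4 + ε) * k / r) * 2 ^ (3 * (k : ℝ) / r)) *
          Real.logb 2 n := by gcongr
    _ = _ := by ring
end

section
/- There exists a constant C > 0 such that for all integers r, s, n with 1 ≤ r ≤ s and d := r + s < n, there exists an (n,(r,s))-cover-free family of size at most C · √r · d · C(d,r) · log₂ n, where C(d,r) denotes the binomial coefficient 'd choose r'. -/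
/-- A Stirling-type upper bound for the factorial. -/
theorem factorial_le_stirling {n : ℕ} (hn : n ≠ 0) :
    (n.factorial : ℝ) ≤ 3 * √n * (n / Real.exp 1) ^ n := by
  obtain ⟨m, rfl⟩ := Nat.exists_eq_succ_of_ne_zero hn
  have h := Stirling.stirlingSeq'_antitone (Nat.zero_le m)
  simp only [Function.comp_apply, Nat.succ_eq_add_one, zero_add, Stirling.stirlingSeq_one] at h
  rw [Stirling.stirlingSeq, div_le_div_iff₀ (by positivity) (by positivity),
    Real.sqrt_mul zero_le_two] at h
  have h2 : 0 < √(2 : ℝ) := by positivity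
  have h3 : ((m + 1).factorial : ℝ) ≤
      Real.exp 1 * (√((m + 1 : ℕ) : ℝ) * (((m + 1 : ℕ) : ℝ) / Real.exp 1) ^ (m + 1)) := by
    refine le_of_mul_le_mul_right (h.trans_eq ?_) h2
    ring
  refine h3.trans ?_
  rw [mul_assoc]
  gcongr
  exact Real.exp_one_lt_three.le

/-- The binomial distribution with mean `r` on `r + s` trials gives its mean a probability of order
at least `1 / √r`. -/
theorem pow_add_le_sqrt_mul_choose {r s : ℕ} (hr : r ≠ 0) (hs : s ≠ 0) :
    ((r + s : ℕ) : ℝ) ^ (r + s) ≤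
      9 * √r * (r + s).choose r * ((r : ℝ) ^ r * (s : ℝ) ^ s) := by
  have hfac : (((r + s).choose r : ℕ) : ℝ) * r.factorial * s.factorial = (r + s).factorial := by
    rw [Nat.choose_symm_add]
    exact_mod_cast Nat.add_choose_mul_factorial_mul_factorial r s
  have hs' : 0 < √(s : ℝ) := by positivity
  have hlow : √(s : ℝ) * (((r + s : ℕ) : ℝ) / Real.exp 1) ^ (r + s) ≤ (r + s).factorial := by
    refine le_trans ?_ (Stirling.le_factorial_stirling (r + s))
    gcongr
    have := Real.pi_gt_three
    push_cast
    have : (0 : ℝ) ≤ r := by positivity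
    have : (0 : ℝ) ≤ s := by positivity
    nlinarith
  have hup : ((r + s).factorial : ℝ) ≤ (r + s).choose r *
      (3 * √r * (r / Real.exp 1) ^ r) * (3 * √s * (s / Real.exp 1) ^ s) := by
    rw [← hfac]
    gcongr
    · exact factorial_le_stirling hr
    · exact factorial_le_stirling hs
  have h := hlow.trans hup
  have he : 0 < Real.exp 1 := Real.exp_pos 1
  simp only [div_pow, pow_add] at h ⊢
  refine le_of_mul_le_mul_left ?_
    (show 0 < √(s : ℝ) * ((Real.exp 1 ^ r)⁻¹ * (Real.exp 1 ^ s)⁻¹) by positivity)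
  convert h using 1 <;> field_simp
  ring

/-- Greedy covering: if every element of `T` is hit by a random `a` (drawn with weights `w`) with
probability at least `q`, then `m` choices can leave at most a `(1 - q) ^ m` fraction unhit. -/
theorem exists_card_le_unhit_le {α β : Type*} [Fintype α] [DecidableEq α]
    (R : β → α → Prop) [∀ t a, Decidable (R t a)] (w : α → ℝ) (hw : ∀ a, 0 < w a)
    (hw1 : ∑ a, w a = 1) {q : ℝ} (hq : q ≤ 1) (T : Finset β)
    (hT : ∀ t ∈ T, q ≤ ∑ a with R t a, w a) (m : ℕ) :
    ∃ F : Finset α, F.card ≤ m ∧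
      ((T.filter fun t => ∀ a ∈ F, ¬ R t a).card : ℝ) ≤ (1 - q) ^ m * T.card := by
  induction m with
  | zero => exact ⟨∅, by simp⟩
  | succ m ih =>
    obtain ⟨F, hF, hU⟩ := ih
    set U := T.filter fun t => ∀ a ∈ F, ¬ R t a with hUdef
    have hne : (Finset.univ : Finset α).Nonempty := by
      by_contra h
      rw [Finset.not_nonempty_iff_eq_empty] at h
      simp [h] at hw1
    obtain ⟨a, -, ha⟩ : ∃ a ∈ (Finset.univ : Finset α),
        w a * (q * U.card) ≤ w a * (U.filter fun t => R t a).card := by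
      refine Finset.exists_le_of_sum_le hne ?_
      calc ∑ a, w a * (q * U.card) = ∑ t ∈ U, q := by
            rw [← Finset.sum_mul, hw1, Finset.sum_const, nsmul_eq_mul]; ring
        _ ≤ ∑ t ∈ U, ∑ a with R t a, w a :=
            Finset.sum_le_sum fun t ht => hT t (Finset.mem_filter.1 ht).1
        _ = ∑ a, w a * (U.filter fun t => R t a).card := by
            simp only [Finset.sum_filter]
            rw [Finset.sum_comm]
            refine Finset.sum_congr rfl fun a _ => ?_
            rw [← Finset.sum_filter, Finset.sum_const, nsmul_eq_mul, mul_comm]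
    have ha' := le_of_mul_le_mul_left ha (hw a)
    refine ⟨insert a F, (Finset.card_insert_le a F).trans (by lia), ?_⟩
    have hfilter : (T.filter fun t => ∀ b ∈ insert a F, ¬ R t b) =
        U.filter fun t => ¬ R t a := by
      ext t
      simp only [hUdef, Finset.mem_filter, Finset.forall_mem_insert]
      tauto
    have hsplit : ((U.filter fun t => R t a).card : ℝ) + (U.filter fun t => ¬ R t a).card =
        U.card := by
      exact_mod_cast Finset.card_filter_add_card_filter_not (s := U) fun t => R t a
    rw [hfilter]
    calc ((U.filter fun t => ¬ R t a).card : ℝ) ≤ (1 - q) * U.card := by linarith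
      _ ≤ (1 - q) * ((1 - q) ^ m * T.card) := by
          gcongr
      _ = (1 - q) ^ (m + 1) * T.card := by ring

/-- Under the product Bernoulli weight, the cylinder fixing the values on disjoint sets `J` and `K`
to `true` and `false` has weight `p ^ #J * (1 - p) ^ #K`. -/
theorem sum_bernoulli_cylinder {ι : Type*} [Fintype ι] [DecidableEq ι] (p : ℝ)
    {J K : Finset ι} (h : Disjoint J K) :
    ∑ a : ι → Bool with (∀ i ∈ J, a i = true) ∧ ∀ i ∈ K, a i = false,
      ∏ i, (if a i then p else 1 - p) = p ^ J.card * (1 - p) ^ K.card := by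
  have hset : (Finset.univ.filter fun a : ι → Bool =>
      (∀ i ∈ J, a i = true) ∧ ∀ i ∈ K, a i = false) =
      Fintype.piFinset fun i => if i ∈ J then {true} else if i ∈ K then {false} else
        Finset.univ := by
    ext a
    simp only [Finset.mem_filter, Finset.mem_univ, true_and, Fintype.mem_piFinset]
    constructor
    · rintro ⟨hJ, hK⟩ i
      split_ifs with h1 h2
      · simp [hJ i h1]
      · simp [hK i h2]
      · simp
    · intro ha
      refine ⟨fun i hi => by simpa [hi] using ha i, fun i hi => ?_⟩
      have : i ∉ J := Finset.disjoint_right.1 h hi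
      simpa [hi, this] using ha i
  rw [hset, ← Finset.prod_univ_sum _ fun (_ : ι) (b : Bool) => if b then p else 1 - p]
  have hfactor : ∀ i, ∑ b ∈ (if i ∈ J then {true} else if i ∈ K then {false} else
      (Finset.univ : Finset Bool)), (if b then p else 1 - p) =
      (if i ∈ J then p else 1) * (if i ∈ K then 1 - p else 1) := by
    intro i
    by_cases h1 : i ∈ J
    · simp [h1, Finset.disjoint_left.1 h h1]
    · by_cases h2 : i ∈ K <;> simp [h1, h2]
  simp_rw [hfactor, Finset.prod_mul_distrib, Finset.prod_ite_mem, Finset.univ_inter,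
    Finset.prod_const]

/-- The union bound: `m` random vectors suffice once the expected number of uncovered patterns
drops below one. -/
theorem exists_isCFF_card_le_s19 {n r s m : ℕ} {p : ℝ} (hp0 : 0 < p) (hp1 : p < 1)
    (h : (1 - p ^ r * (1 - p) ^ s) ^ m * (n : ℝ) ^ (r + s) < 1) :
    ∃ F : Finset (Fin n → Bool), IsCFF n r s F ∧ F.card ≤ m := by
  set q := p ^ r * (1 - p) ^ s with hq
  have hq1 : q ≤ 1 :=
    mul_le_one₀ (pow_le_one₀ hp0.le hp1.le) (pow_nonneg (by linarith) _)
      (pow_le_one₀ (by linarith) (by linarith))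
  let T : Finset (Finset (Fin n) × Finset (Fin n)) :=
    (Finset.univ.powersetCard r ×ˢ Finset.univ.powersetCard s).filter fun t => Disjoint t.1 t.2
  let w : (Fin n → Bool) → ℝ := fun a => ∏ i, (if a i then p else 1 - p)
  have hw : ∀ a, 0 < w a := fun a => Finset.prod_pos fun i _ => by split_ifs <;> linarith
  have hw1 : ∑ a, w a = 1 := by
    simpa using sum_bernoulli_cylinder p (Finset.disjoint_empty_left (∅ : Finset (Fin n)))
  have hmem : ∀ t, t ∈ T ↔ (t.1.card = r ∧ t.2.card = s) ∧ Disjoint t.1 t.2 := by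
    simp [T, Finset.mem_powersetCard]
  obtain ⟨F, hF, hU⟩ := exists_card_le_unhit_le
    (fun (t : Finset (Fin n) × Finset (Fin n)) (a : Fin n → Bool) =>
      (∀ i ∈ t.1, a i = true) ∧ ∀ i ∈ t.2, a i = false) w hw hw1 hq1 T
    (fun t ht => by
      obtain ⟨⟨h1, h2⟩, h3⟩ := (hmem t).1 ht
      have hsum := sum_bernoulli_cylinder p h3
      rw [h1, h2] at hsum
      refine hsum.ge.trans_eq (Finset.sum_congr ?_ fun _ _ => rfl)
      ext a
      simp only [Finset.mem_filter]) m
  have hTcard : (T.card : ℝ) ≤ (n : ℝ) ^ (r + s) := by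
    have : T.card ≤ n ^ (r + s) := by
      refine (Finset.card_filter_le _ _).trans ?_
      rw [Finset.card_product, Finset.card_powersetCard, Finset.card_powersetCard,
        Finset.card_univ, Fintype.card_fin, pow_add]
      exact Nat.mul_le_mul (Nat.choose_le_pow n r) (Nat.choose_le_pow n s)
    exact_mod_cast this
  have hlt := (hU.trans (mul_le_mul_of_nonneg_left hTcard (pow_nonneg (by linarith) m))).trans_lt h
  rw [Nat.cast_lt_one, Finset.card_eq_zero] at hlt
  refine ⟨F, fun S hS J hJS hJ => ?_, hF⟩
  have hT : (J, S \ J) ∈ T := by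
    rw [hmem]
    refine ⟨⟨hJ, ?_⟩, Finset.disjoint_sdiff⟩
    rw [Finset.card_sdiff_of_subset hJS, hS, hJ, Nat.add_sub_cancel_left]
  have := Finset.filter_eq_empty_iff.1 hlt hT
  push Not at this
  simpa using this

/-- Non-constructive (union-bound) upper bound: there is a constant `C > 0` such
that for all `1 ≤ r ≤ s` and `d := r + s < n` there is an `(n,(r,s))`-CFF of size
at most `C·√r·d·C(d,r)·log₂ n`. -/
theorem cff_union_bound :
    ∃ C : ℝ, 0 < C ∧ ∀ r s n : ℕ, 1 ≤ r → r ≤ s → r + s < n →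
      ∃ F : Finset (Fin n → Bool), IsCFF n r s F ∧
        (F.card : ℝ) ≤ C * Real.sqrt r * (r + s) * ((r + s).choose r) * Real.logb 2 n := by
  refine ⟨10, by norm_num, fun r s n hr hrs hn => ?_⟩
  have hr0 : (1 : ℝ) ≤ r := by exact_mod_cast hr
  have hs0 : (1 : ℝ) ≤ s := by exact_mod_cast hr.trans hrs
  have hn2 : (2 : ℝ) ≤ n := by exact_mod_cast (by lia : 2 ≤ n)
  have hd : (0 : ℝ) < r + s := by linarith
  set p : ℝ := r / (r + s) with hp
  have hp' : 1 - p = s / (r + s) := by rw [hp]; field_simp; ring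
  have hp0 : 0 < p := by positivity
  have hp1 : p < 1 := by
    have : 0 < 1 - p := by rw [hp']; positivity
    linarith
  set q : ℝ := p ^ r * (1 - p) ^ s with hq
  have hq0 : 0 < q := mul_pos (pow_pos hp0 _) (pow_pos (by linarith) _)
  have hq1 : q ≤ 1 :=
    mul_le_one₀ (pow_le_one₀ hp0.le hp1.le) (pow_nonneg (by linarith) _)
      (pow_le_one₀ (by linarith) (by linarith))
  have hqinv : 1 / q ≤ 9 * √r * (r + s).choose r := by
    have h := pow_add_le_sqrt_mul_choose (r := r) (s := s) (by lia) (by lia)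
    rw [div_le_iff₀ hq0, hq, hp', hp, div_pow, div_pow, div_mul_div_comm, ← pow_add,
      mul_div_assoc', le_div_iff₀ (by positivity), one_mul]
    exact_mod_cast h
  have hln : 0 < Real.log n := Real.log_pos (by linarith)
  have hlogb : Real.log n ≤ Real.logb 2 n := by
    rw [Real.logb, le_div_iff₀ (Real.log_pos one_lt_two)]
    nlinarith [Real.log_two_lt_d9]
  have hlogb1 : 1 ≤ Real.logb 2 n := by
    rw [Real.le_logb_iff_rpow_le one_lt_two (by linarith)]
    simpa using hn2
  set x : ℝ := (r + s) * Real.log n / q with hx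
  obtain ⟨F, hF, hcard⟩ := exists_isCFF_card_le_s19 (n := n) (m := ⌊x⌋₊ + 1) hp0 hp1 (by
    rw [← hq]
    have hm : x < ((⌊x⌋₊ + 1 : ℕ) : ℝ) := by exact_mod_cast Nat.lt_floor_add_one x
    rw [hx, div_lt_iff₀ hq0] at hm
    calc (1 - q) ^ (⌊x⌋₊ + 1) * (n : ℝ) ^ (r + s)
        ≤ Real.exp (-q) ^ (⌊x⌋₊ + 1) * Real.exp (Real.log n) ^ (r + s) := by
          rw [Real.exp_log (by linarith)]
          gcongr
          exact Real.one_sub_le_exp_neg q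
      _ = Real.exp ((r + s) * Real.log n - ((⌊x⌋₊ + 1 : ℕ) : ℝ) * q) := by
          rw [← Real.exp_nat_mul, ← Real.exp_nat_mul, ← Real.exp_add]
          congr 1
          push_cast
          ring
      _ < 1 := by
          rw [Real.exp_lt_one_iff]
          linarith)
  refine ⟨F, hF, ?_⟩
  have hx0 : 0 ≤ x := by positivity
  have hsqrt : 1 ≤ √(r : ℝ) := Real.one_le_sqrt.2 hr0
  have hchoose : (1 : ℝ) ≤ (r + s).choose r := by
    exact_mod_cast Nat.choose_pos (Nat.le_add_right r s)
  have hone : 1 ≤ √(r : ℝ) * (r + s) * (r + s).choose r * Real.logb 2 n :=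
    one_le_mul_of_one_le_of_one_le (one_le_mul_of_one_le_of_one_le
      (one_le_mul_of_one_le_of_one_le hsqrt (by linarith)) hchoose) hlogb1
  have hxle : x ≤ 9 * √r * (r + s).choose r * ((r + s) * Real.logb 2 n) := by
    calc x = 1 / q * ((r + s) * Real.log n) := by rw [hx]; ring
      _ ≤ _ := by gcongr
  calc (F.card : ℝ) ≤ ((⌊x⌋₊ + 1 : ℕ) : ℝ) := by exact_mod_cast hcard
    _ ≤ x + 1 := by
        push_cast
        linarith [Nat.floor_le hx0]
    _ ≤ _ := by linarith
end
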